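/- For 𝔽 ∈ {ℝ, ℂ} and integers n, m ≥ 3: 3³·10^{−20/9}·2^{−1/2}·max(n,m)^{−1/2} ≤ (Vol P̃os_{𝒞_𝔽} / Vol B_{𝓜_{𝒞_𝔽}})^{1/D_{𝓜_{𝒞_𝔽}}} ≤ 2·(min(1/(1+n), 1/(1+m)))^{1/2}. -/

import Mathlib

open MeasureTheory MvPolynomial

noncomputable section

namespace BiformPaper

/-- The weight function on the variables: the `x`-variables get weight `(1,0)` and the
`y`-variables get weight `(0,1)`. -/
def bw (n m : ℕ) : Fin n ⊕ Fin m → ℕ × ℕ := Sum.elim (fun _ => (1, 0)) (fun _ => (0, 1))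

/-- The set of biforms of bidegree `(k₁, k₂)`: real polynomials in
`x = (x₁, …, xₙ)` and `y = (y₁, …, y_m)`, homogeneous of degree `k₁` in `x` and of degree
`k₂` in `y`. -/
def Biform (n m k₁ k₂ : ℕ) : Set (MvPolynomial (Fin n ⊕ Fin m) ℝ) :=
  {f | MvPolynomial.IsWeightedHomogeneous (bw n m) f (k₁, k₂)}

/-- Evaluation of a polynomial at a point `(x, y) ∈ ℝⁿ × ℝᵐ`. -/
def beval {n m : ℕ} (f : MvPolynomial (Fin n ⊕ Fin m) ℝ) (x : Fin n → ℝ) (y : Fin m → ℝ) : ℝ :=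
  eval (Sum.elim x y) f

/-- The Euclidean unit sphere `S^{n-1}` in `ℝⁿ`. -/
def unitSphere (n : ℕ) : Set (Fin n → ℝ) := {x | ∑ i, x i ^ 2 = 1}

/-- `σ` is the normalized uniform measure on the unit sphere `S^{n-1} ⊆ ℝⁿ`, i.e., the
unique rotation-invariant Borel probability measure concentrated on the sphere. -/
structure IsSphereMeasure (n : ℕ) (σ : Measure (Fin n → ℝ)) : Prop where
  prob : IsProbabilityMeasure σ
  onSphere : σ (unitSphere n)ᶜ = 0
  invariant : ∀ Q : Matrix (Fin n) (Fin n) ℝ, Q * Q.transpose = 1 → σ.map Q.mulVec = σ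

/-- The average `∫_T f dσ` of `f` over `T = S^{n-1} × S^{m-1}` (with `σ` the product of the
normalized sphere measures `σ₁`, `σ₂`). -/
def bavg {n m : ℕ} (σ₁ : Measure (Fin n → ℝ)) (σ₂ : Measure (Fin m → ℝ))
    (f : MvPolynomial (Fin n ⊕ Fin m) ℝ) : ℝ :=
  ∫ x, ∫ y, beval f x y ∂σ₂ ∂σ₁

/-- The `L²(σ)` inner product `⟨f, g⟩ = ∫_T f·g dσ` on biforms. -/
def bip {n m : ℕ} (σ₁ : Measure (Fin n → ℝ)) (σ₂ : Measure (Fin m → ℝ))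
    (f g : MvPolynomial (Fin n ⊕ Fin m) ℝ) : ℝ :=
  ∫ x, ∫ y, beval f x y * beval g x y ∂σ₂ ∂σ₁

/-- The cone `Pos^{(n,m)}_{(2k₁,2k₂)}` of nonnegative biforms of bidegree `(2k₁, 2k₂)`. -/
def PosSet (n m k₁ k₂ : ℕ) : Set (MvPolynomial (Fin n ⊕ Fin m) ℝ) :=
  {f | f ∈ Biform n m (2 * k₁) (2 * k₂) ∧ ∀ x y, 0 ≤ beval f x y}

/-- The cone `Sq^{(n,m)}_{(2k₁,2k₂)}` of finite sums of squares of biforms of bidegree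
`(k₁, k₂)`. -/
def SqSet (n m k₁ k₂ : ℕ) : Set (MvPolynomial (Fin n ⊕ Fin m) ℝ) :=
  {f | ∃ (N : ℕ) (g : Fin N → MvPolynomial (Fin n ⊕ Fin m) ℝ),
      (∀ i, g i ∈ Biform n m k₁ k₂) ∧ f = ∑ i, g i ^ 2}

/-- The cone `Lf^{(n,m)}_{(2k₁,2k₂)}` of finite sums of products
`ℓᵢ(x)^{2k₁} · ℓ′ᵢ(y)^{2k₂}` of even powers of linear forms. -/
def LfSet (n m k₁ k₂ : ℕ) : Set (MvPolynomial (Fin n ⊕ Fin m) ℝ) :=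
  {f | ∃ (N : ℕ) (a : Fin N → Fin n → ℝ) (b : Fin N → Fin m → ℝ),
      f = ∑ r, (∑ i, C (a r i) * X (Sum.inl i)) ^ (2 * k₁) *
               (∑ j, C (b r j) * X (Sum.inr j)) ^ (2 * k₂)}

/-- The biform `q = (x₁² + ⋯ + xₙ²)^{k₁} · (y₁² + ⋯ + y_m²)^{k₂}`. -/
def qpoly (n m k₁ k₂ : ℕ) : MvPolynomial (Fin n ⊕ Fin m) ℝ :=
  (∑ i : Fin n, X (Sum.inl i) ^ 2) ^ k₁ * (∑ j : Fin m, X (Sum.inr j) ^ 2) ^ k₂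

/-- The hyperplane `𝓜` of biforms of bidegree `(2k₁, 2k₂)` with average `0` on `T`. -/
def MSet (n m k₁ k₂ : ℕ) (σ₁ : Measure (Fin n → ℝ)) (σ₂ : Measure (Fin m → ℝ)) :
    Set (MvPolynomial (Fin n ⊕ Fin m) ℝ) :=
  {f | f ∈ Biform n m (2 * k₁) (2 * k₂) ∧ bavg σ₁ σ₂ f = 0}

/-- The translated section `K̃ = {f ∈ 𝓜 : f + q ∈ K}` of a cone `K`. -/
def tilde (n m k₁ k₂ : ℕ) (σ₁ : Measure (Fin n → ℝ)) (σ₂ : Measure (Fin m → ℝ))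
    (K : Set (MvPolynomial (Fin n ⊕ Fin m) ℝ)) : Set (MvPolynomial (Fin n ⊕ Fin m) ℝ) :=
  {f | f ∈ MSet n m k₁ k₂ σ₁ σ₂ ∧ f + qpoly n m k₁ k₂ ∈ K}

/-- The unit ball `B_𝓜` of `𝓜` in the `L²(σ)` norm. -/
def bball (n m k₁ k₂ : ℕ) (σ₁ : Measure (Fin n → ℝ)) (σ₂ : Measure (Fin m → ℝ)) :
    Set (MvPolynomial (Fin n ⊕ Fin m) ℝ) :=
  {f | f ∈ MSet n m k₁ k₂ σ₁ σ₂ ∧ bip σ₁ σ₂ f f ≤ 1}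

/-- `ψ : ℝ^D → Mset` is a unitary isomorphism: an injective linear map with range `Mset`
carrying the standard inner product of `ℝ^D` to the `L²(σ)` inner product.  Volumes of
Borel subsets `E` of `Mset` are computed as the Lebesgue measure of `ψ ⁻¹' E`
(by Lemma 1.1 of the paper this does not depend on the choice of `ψ`). -/
structure IsUnitaryParam (n m D : ℕ) (σ₁ : Measure (Fin n → ℝ)) (σ₂ : Measure (Fin m → ℝ))
    (Mset : Set (MvPolynomial (Fin n ⊕ Fin m) ℝ))
    (ψ : (Fin D → ℝ) →ₗ[ℝ] MvPolynomial (Fin n ⊕ Fin m) ℝ) : Prop where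
  inj : Function.Injective ψ
  range : Set.range ψ = Mset
  ip : ∀ a b : Fin D → ℝ, bip σ₁ σ₂ (ψ a) (ψ b) = ∑ i, a i * b i

/-- The apolar inner product `⟨r, s⟩_d = D_r(s)` on biforms, where `D_r` is the
differential operator obtained from `r` by replacing each variable by the corresponding
partial derivative; its value on a pair of forms of the same bidegree is
`∑_α r_α · s_α · α!`. -/
def apolar {n m : ℕ} (r s : MvPolynomial (Fin n ⊕ Fin m) ℝ) : ℝ :=
  ∑ α ∈ r.support, coeff α r * coeff α s * α.prod fun _ k => (k.factorial : ℝ)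

end BiformPaper

namespace BiformPaper

/-! ### The complex/real multiform setting

Complex variables `z_j = x_j + i·x_{n+j}` (`1 ≤ j ≤ n`) and `w_k = y_k + i·y_{m+k}`
(`1 ≤ k ≤ m`) inside polynomials in the real variables `x = (x₁,…,x_{2n})`,
`y = (y₁,…,y_{2m})`. -/

/-- The real part `x_j` of the complex variable `z_j`. -/
def zRe (n m : ℕ) (i : Fin n) : MvPolynomial (Fin (2 * n) ⊕ Fin (2 * m)) ℂ :=
  X (Sum.inl ⟨i.1, by have := i.2; omega⟩)

/-- The imaginary part `x_{n+j}` of the complex variable `z_j`. -/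
def zIm (n m : ℕ) (i : Fin n) : MvPolynomial (Fin (2 * n) ⊕ Fin (2 * m)) ℂ :=
  X (Sum.inl ⟨n + i.1, by have := i.2; omega⟩)

/-- The real part `y_k` of the complex variable `w_k`. -/
def wRe (n m : ℕ) (k : Fin m) : MvPolynomial (Fin (2 * n) ⊕ Fin (2 * m)) ℂ :=
  X (Sum.inr ⟨k.1, by have := k.2; omega⟩)

/-- The imaginary part `y_{m+k}` of the complex variable `w_k`. -/
def wIm (n m : ℕ) (k : Fin m) : MvPolynomial (Fin (2 * n) ⊕ Fin (2 * m)) ℂ :=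
  X (Sum.inr ⟨m + k.1, by have := k.2; omega⟩)

/-- The complex variable `z_j = x_j + i·x_{n+j}` as a complex polynomial. -/
def Zv (n m : ℕ) (i : Fin n) : MvPolynomial (Fin (2 * n) ⊕ Fin (2 * m)) ℂ :=
  zRe n m i + C Complex.I * zIm n m i

/-- The conjugate variable `z̄_j = x_j − i·x_{n+j}`. -/
def Zc (n m : ℕ) (i : Fin n) : MvPolynomial (Fin (2 * n) ⊕ Fin (2 * m)) ℂ :=
  zRe n m i - C Complex.I * zIm n m i

/-- The complex variable `w_k = y_k + i·y_{m+k}`. -/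
def Wv (n m : ℕ) (k : Fin m) : MvPolynomial (Fin (2 * n) ⊕ Fin (2 * m)) ℂ :=
  wRe n m k + C Complex.I * wIm n m k

/-- The conjugate variable `w̄_k = y_k − i·y_{m+k}`. -/
def Wc (n m : ℕ) (k : Fin m) : MvPolynomial (Fin (2 * n) ⊕ Fin (2 * m)) ℂ :=
  wRe n m k - C Complex.I * wIm n m k

/-- The multiform `∑ a_{ijkl}·z̄ᵢ·zⱼ·w̄ₖ·w_l` determined by coefficients `a`. -/
def herm (n m : ℕ) (a : Fin n → Fin n → Fin m → Fin m → ℂ) :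
    MvPolynomial (Fin (2 * n) ⊕ Fin (2 * m)) ℂ :=
  ∑ i, ∑ j, ∑ k, ∑ l, C (a i j k l) * Zc n m i * Zv n m j * Wc n m k * Wv n m l

/-- The subspace `𝒞_𝔽 ⊆ ℝ[x,y]_{2,2}`: the image under the substitution
`z_j = x_j + i·x_{n+j}`, `w_k = y_k + i·y_{m+k}` of the real vector space
`Symm𝔽[z,z̄,w,w̄]_{1,1,1,1}` of symmetric multiforms of multidegree `(1,1,1,1)`
(`𝔽 = ℝ` corresponds to `isR = true`, `𝔽 = ℂ` to `isR = false`). -/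
def CF (n m : ℕ) (isR : Bool) : Set (MvPolynomial (Fin (2 * n) ⊕ Fin (2 * m)) ℝ) :=
  {f | ∃ a : Fin n → Fin n → Fin m → Fin m → ℂ,
    (∀ i j k l, a i j k l = (starRingEnd ℂ) (a j i l k)) ∧
    (isR = true → ∀ i j k l, (a i j k l).im = 0) ∧
    MvPolynomial.map (algebraMap ℝ ℂ) f = herm n m a}

/-- The cone `Pos_{𝒞_𝔽}` of nonnegative multiforms. -/
def PosCF (n m : ℕ) (isR : Bool) : Set (MvPolynomial (Fin (2 * n) ⊕ Fin (2 * m)) ℝ) :=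
  {f | f ∈ CF n m isR ∧ ∀ x y, 0 ≤ beval f x y}

/-- The cone `Sq_{𝒞_𝔽}`: images of finite sums `∑ f_r*·f_r` of hermitian squares with
`f_r ∈ 𝔽[z,w]_{1,1}` bilinear in `z` and `w`. -/
def SqCF (n m : ℕ) (isR : Bool) : Set (MvPolynomial (Fin (2 * n) ⊕ Fin (2 * m)) ℝ) :=
  {f | ∃ (N : ℕ) (b : Fin N → Fin n → Fin m → ℂ),
    (isR = true → ∀ r i j, (b r i j).im = 0) ∧
    MvPolynomial.map (algebraMap ℝ ℂ) f =
      ∑ r, (∑ i, ∑ j, C ((starRingEnd ℂ) (b r i j)) * Zc n m i * Wc n m j) *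
           (∑ i, ∑ j, C (b r i j) * Zv n m i * Wv n m j)}

/-- The cone `𝒫_{𝒞_ℝ}` of multiforms (for `𝔽 = ℝ`) that are nonnegative on the real
points `z ∈ ℝⁿ`, `w ∈ ℝᵐ`. -/
def PRSet (n m : ℕ) : Set (MvPolynomial (Fin (2 * n) ⊕ Fin (2 * m)) ℝ) :=
  {f | f ∈ CF n m true ∧ ∀ (z : Fin n → ℝ) (w : Fin m → ℝ),
    0 ≤ beval f (fun i => if h : (i : ℕ) < n then z ⟨i, h⟩ else 0)
                (fun j => if h : (j : ℕ) < m then w ⟨j, h⟩ else 0)}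

/-- The hyperplane `𝓜_{𝒞_𝔽}` of elements of `𝒞_𝔽` with average `0` on
`T = S^{2n−1} × S^{2m−1}`. -/
def MCF (n m : ℕ) (isR : Bool) (σ₁ : Measure (Fin (2 * n) → ℝ))
    (σ₂ : Measure (Fin (2 * m) → ℝ)) : Set (MvPolynomial (Fin (2 * n) ⊕ Fin (2 * m)) ℝ) :=
  {f | f ∈ CF n m isR ∧ bavg σ₁ σ₂ f = 0}

/-- The translated section `K̃ = {f ∈ 𝓜_{𝒞_𝔽} : f + q ∈ K}` where
`q = (x₁²+⋯+x_{2n}²)(y₁²+⋯+y_{2m}²)`. -/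
def tildeCF (n m : ℕ) (isR : Bool) (σ₁ : Measure (Fin (2 * n) → ℝ))
    (σ₂ : Measure (Fin (2 * m) → ℝ)) (K : Set (MvPolynomial (Fin (2 * n) ⊕ Fin (2 * m)) ℝ)) :
    Set (MvPolynomial (Fin (2 * n) ⊕ Fin (2 * m)) ℝ) :=
  {f | f ∈ MCF n m isR σ₁ σ₂ ∧ f + qpoly (2 * n) (2 * m) 1 1 ∈ K}

/-- The unit ball `B_{𝓜_{𝒞_𝔽}}` of `𝓜_{𝒞_𝔽}` in the `L²(σ)` norm. -/
def ballCF (n m : ℕ) (isR : Bool) (σ₁ : Measure (Fin (2 * n) → ℝ))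
    (σ₂ : Measure (Fin (2 * m) → ℝ)) : Set (MvPolynomial (Fin (2 * n) ⊕ Fin (2 * m)) ℝ) :=
  {f | f ∈ MCF n m isR σ₁ σ₂ ∧ bip σ₁ σ₂ f f ≤ 1}

/-- `D_{𝓜_{𝒞_𝔽}}`. -/
def DCF (n m : ℕ) (isR : Bool) : ℕ :=
  if isR then n * m * (n * m + 1) / 2 - 1 else n ^ 2 * m ^ 2 - 1

end BiformPaper

namespace BiformPaper

open scoped ENNReal Pointwise Matrix ComplexConjugate

lemma volume_add_le_of_isCompact {A B C : Set ℝ} (hA : IsCompact A) (hB : IsCompact B)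
    (hA0 : A.Nonempty) (hB0 : B.Nonempty) (h : ∀ a ∈ A, ∀ b ∈ B, a + b ∈ C) :
    volume A + volume B ≤ volume C := by
  have ha : sSup A ∈ A := hA.sSup_mem hA0
  have hb : sInf B ∈ B := hB.sInf_mem hB0
  have hsub : ((fun x => x + sInf B) '' A) ∪ ((fun x => sSup A + x) '' B) ⊆ C := by
    rintro _ (⟨x, hx, rfl⟩ | ⟨x, hx, rfl⟩)
    · exact h _ hx _ hb
    · exact h _ ha _ hx
  have hd : AEDisjoint volume ((fun x => x + sInf B) '' A) ((fun x => sSup A + x) '' B) := by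
    refine measure_mono_null (t := {sSup A + sInf B}) ?_ (by simp)
    rintro z ⟨⟨x, hx, rfl⟩, ⟨y, hy, hxy⟩⟩
    have h1 := le_csSup hA.bddAbove hx
    have h2 := csInf_le hB.bddBelow hy
    simp only [Set.mem_singleton_iff] at *
    linarith
  have hm : MeasurableSet ((fun x => sSup A + x) '' B) :=
    (hB.image (continuous_const.add continuous_id)).measurableSet
  calc volume A + volume B
      = volume ((fun x => x + sInf B) '' A) + volume ((fun x => sSup A + x) '' B) := by
        simp
    _ = volume (((fun x => x + sInf B) '' A) ∪ ((fun x => sSup A + x) '' B)) :=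
        (measure_union₀ hm.nullMeasurableSet hd).symm
    _ ≤ volume C := measure_mono hsub

lemma volume_add_le_of_measurableSet {A B C : Set ℝ} (hA : MeasurableSet A)
    (hB : MeasurableSet B) (hA0 : A.Nonempty) (hB0 : B.Nonempty)
    (h : ∀ a ∈ A, ∀ b ∈ B, a + b ∈ C) :
    volume A + volume B ≤ volume C := by
  obtain ⟨a, ha⟩ := hA0
  obtain ⟨b, hb⟩ := hB0
  have key : ∀ K ⊆ A, IsCompact K → ∀ L ⊆ B, IsCompact L →
      volume K + volume L ≤ volume C := by
    intro K hK hKc L hL hLc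
    calc volume K + volume L ≤ volume (insert a K) + volume (insert b L) := by
          gcongr <;> exact Set.subset_insert _ _
      _ ≤ volume C := volume_add_le_of_isCompact (hKc.insert a) (hLc.insert b)
          (Set.insert_nonempty _ _) (Set.insert_nonempty _ _) (fun x hx y hy =>
            h _ (Set.insert_subset ha hK hx) _ (Set.insert_subset hb hL hy))
  rw [hA.measure_eq_iSup_isCompact, hB.measure_eq_iSup_isCompact]
  simp only [iSup_and']
  exact ENNReal.biSup_add_biSup_le' ⟨∅, by simp⟩ ⟨∅, by simp⟩
    fun K hK L hL => key K hK.1 hK.2 L hL.1 hL.2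

lemma volume_combo_le {A B C : Set ℝ} {s t : ℝ} (hs : 0 < s) (ht : 0 < t)
    (hA : MeasurableSet A) (hB : MeasurableSet B) (hA0 : A.Nonempty) (hB0 : B.Nonempty)
    (h : ∀ a ∈ A, ∀ b ∈ B, s * a + t * b ∈ C) :
    ENNReal.ofReal s * volume A + ENNReal.ofReal t * volume B ≤ volume C := by
  have := volume_add_le_of_measurableSet (C := C) (hA.const_smul₀ s) (hB.const_smul₀ t)
    (hA0.smul_set (a := s)) (hB0.smul_set (a := t)) (by
      rintro _ ⟨a, ha, rfl⟩ _ ⟨b, hb, rfl⟩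
      exact h a ha b hb)
  simpa [Measure.addHaar_smul, abs_of_pos hs, abs_of_pos ht] using this

/-- One-dimensional Prékopa–Leindler inequality for functions with supremum one. -/
lemma prekopa_leindler_normalized {f g h : ℝ → ℝ} {s t : ℝ} (hs : 0 < s) (ht : 0 < t)
    (hst : s + t = 1) (hf : Measurable f) (hg : Measurable g) (hh : Measurable h)
    (hf0 : ∀ x, 0 ≤ f x) (hg0 : ∀ x, 0 ≤ g x) (hh0 : ∀ x, 0 ≤ h x)
    (hf1 : ∀ x, f x ≤ 1) (hg1 : ∀ x, g x ≤ 1)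
    (hf2 : ∀ c < 1, ∃ x, c < f x) (hg2 : ∀ c < 1, ∃ x, c < g x)
    (H : ∀ x y, f x ^ s * g y ^ t ≤ h (s * x + t * y)) :
    ENNReal.ofReal s * (∫⁻ x, ENNReal.ofReal (f x)) +
      ENNReal.ofReal t * (∫⁻ x, ENNReal.ofReal (g x))
      ≤ ∫⁻ x, ENNReal.ofReal (h x) := by
  rw [lintegral_eq_lintegral_meas_lt volume (.of_forall hf0) hf.aemeasurable,
    lintegral_eq_lintegral_meas_lt volume (.of_forall hg0) hg.aemeasurable,
    lintegral_eq_lintegral_meas_lt volume (.of_forall hh0) hh.aemeasurable,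
    ← lintegral_const_mul' _ _ ENNReal.ofReal_ne_top,
    ← lintegral_const_mul' _ _ ENNReal.ofReal_ne_top]
  have hmeas : Measurable fun c : ℝ => ENNReal.ofReal s * volume {a | c < f a} := by
    refine Measurable.const_mul ?_ _
    refine Antitone.measurable fun a b hab => measure_mono fun x hx => lt_of_le_of_lt hab hx
  rw [← lintegral_add_left hmeas]
  refine setLIntegral_mono' measurableSet_Ioi fun c hc => ?_
  have hc0 : 0 < c := hc
  by_cases hc1 : c < 1
  · refine volume_combo_le hs ht (measurableSet_lt measurable_const hf)
      (measurableSet_lt measurable_const hg) (hf2 c hc1) (hg2 c hc1) fun a ha b hb => ?_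
    refine lt_of_lt_of_le ?_ (H a b)
    calc c = c ^ s * c ^ t := by rw [← Real.rpow_add hc0, hst, Real.rpow_one]
      _ < f a ^ s * g b ^ t := by
        apply mul_lt_mul'' (Real.rpow_lt_rpow hc0.le ha hs) (Real.rpow_lt_rpow hc0.le hb ht)
          <;> positivity
  · have e1 : {a | c < f a} = ∅ := by
      ext x; simpa using (hf1 x).trans (not_lt.1 hc1)
    have e2 : {a | c < g a} = ∅ := by
      ext x; simpa using (hg1 x).trans (not_lt.1 hc1)
    simp [e1, e2]


/-- The Prékopa–Leindler inequality for a measure on a real vector space. -/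
def PrekopaLeindler {E : Type*} [AddCommGroup E] [Module ℝ E] [MeasurableSpace E]
    (μ : Measure E) : Prop :=
  ∀ s t : ℝ, 0 < s → 0 < t → s + t = 1 → ∀ f g h : E → ℝ≥0∞,
    Measurable f → Measurable g → Measurable h →
    (∀ x y, f x ^ s * g y ^ t ≤ h (s • x + t • y)) →
    (∫⁻ x, f x ∂μ) ^ s * (∫⁻ x, g x ∂μ) ^ t ≤ ∫⁻ x, h x ∂μ

lemma ennreal_geom_mean_le_arith_mean {s t : ℝ} (hs : 0 < s) (ht : 0 < t) (hst : s + t = 1)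
    (a b : ℝ≥0∞) : a ^ s * b ^ t ≤ ENNReal.ofReal s * a + ENNReal.ofReal t * b := by
  rcases eq_or_ne a ⊤ with rfl | ha
  · simp [hs]
  rcases eq_or_ne b ⊤ with rfl | hb
  · simp [ht]
  lift a to NNReal using ha
  lift b to NNReal using hb
  have := Real.geom_mean_le_arith_mean2_weighted hs.le ht.le a.2 b.2 hst
  rw [← ENNReal.ofReal_coe_nnreal (p := a), ← ENNReal.ofReal_coe_nnreal (p := b),
    ENNReal.ofReal_rpow_of_nonneg a.coe_nonneg hs.le,
    ENNReal.ofReal_rpow_of_nonneg b.coe_nonneg ht.le, ← ENNReal.ofReal_mul (by positivity),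
      ← ENNReal.ofReal_mul (by positivity),
    ← ENNReal.ofReal_mul (by positivity), ← ENNReal.ofReal_add (by positivity) (by positivity)]
  exact ENNReal.ofReal_le_ofReal this

lemma prekopa_leindler_of_bounded {f g h : ℝ → ℝ≥0∞} {s t : ℝ} (hs : 0 < s) (ht : 0 < t)
    (hst : s + t = 1) (hf : Measurable f) (hg : Measurable g) (hh : Measurable h)
    {N : ℝ≥0∞} (hN : N ≠ ⊤) (hfN : ∀ x, f x ≤ N) (hgN : ∀ x, g x ≤ N)
    (H : ∀ x y, f x ^ s * g y ^ t ≤ h (s * x + t * y)) :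
    (∫⁻ x, f x) ^ s * (∫⁻ x, g x) ^ t ≤ ∫⁻ x, h x := by
  set A := ⨆ x, f x with hA
  set B := ⨆ x, g x with hB
  have hAt : A ≠ ⊤ := ne_top_of_le_ne_top hN (iSup_le hfN)
  have hBt : B ≠ ⊤ := ne_top_of_le_ne_top hN (iSup_le hgN)
  rcases eq_or_ne A 0 with hA0 | hA0
  · have : ∀ x, f x = 0 := by simpa [hA] using hA0
    simp [this, hs]
  rcases eq_or_ne B 0 with hB0 | hB0
  · have : ∀ x, g x = 0 := by simpa [hB] using hB0
    simp [this, ht]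
  set P := A ^ s * B ^ t with hP
  have hP0 : P ≠ 0 := by simp [hP, hA0, hB0, hAt, hBt]
  have hPt : P ≠ ⊤ := ENNReal.mul_ne_top (by simp [hA0, hAt]) (by simp [hB0, hBt])
  have hfA : ∀ x, f x / A ≤ 1 := fun x => ENNReal.div_le_of_le_mul (by simpa using le_iSup f x)
  have hgB : ∀ x, g x / B ≤ 1 := fun x => ENNReal.div_le_of_le_mul (by simpa using le_iSup g x)
  have ex : ∀ (u : ℝ → ℝ≥0∞), (⨆ x, u x) ≠ 0 → (⨆ x, u x) ≠ ⊤ → ∀ c < (1 : ℝ), ∃ x,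
      c < (u x / ⨆ x, u x).toReal := by
    intro u h0 h1 c hc
    have : ENNReal.ofReal c * (⨆ x, u x) < ⨆ x, u x := by
      conv_rhs => rw [← one_mul (⨆ x, u x)]
      exact (ENNReal.mul_lt_mul_iff_left h0 h1).2 (by simpa using hc)
    obtain ⟨x, hx⟩ := lt_iSup_iff.1 this
    refine ⟨x, ?_⟩
    have hux : u x ≠ ⊤ := ne_top_of_le_ne_top h1 (le_iSup u x)
    rcases lt_or_ge c 0 with hc0 | hc0
    · exact hc0.trans_le ENNReal.toReal_nonneg
    · rwa [← ENNReal.ofReal_lt_iff_lt_toReal hc0 (ENNReal.div_ne_top hux h0),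
        ENNReal.lt_div_iff_mul_lt (.inl h0) (.inl h1)]
  have main := prekopa_leindler_normalized (f := fun x => (f x / A).toReal)
    (g := fun x => (g x / B).toReal) (h := fun x => (min (h x / P) 1).toReal) hs ht hst
    (hf.div_const _).ennreal_toReal (hg.div_const _).ennreal_toReal
    ((hh.div_const _).min measurable_const).ennreal_toReal
    (fun _ => ENNReal.toReal_nonneg) (fun _ => ENNReal.toReal_nonneg)
    (fun _ => ENNReal.toReal_nonneg)
    (fun x => ENNReal.toReal_le_of_le_ofReal zero_le_one (by simpa using hfA x))
    (fun x => ENNReal.toReal_le_of_le_ofReal zero_le_one (by simpa using hgB x))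
    (ex f hA0 hAt) (ex g hB0 hBt) (by
      intro x y
      rw [ENNReal.toReal_rpow, ENNReal.toReal_rpow, ← ENNReal.toReal_mul]
      refine ENNReal.toReal_mono (by simp) (le_min ?_ ?_)
      · rw [ENNReal.div_rpow_of_nonneg _ _ hs.le, ENNReal.div_rpow_of_nonneg _ _ ht.le,
          ENNReal.le_div_iff_mul_le (.inl hP0) (.inl hPt)]
        refine le_trans (le_of_eq ?_) (H x y)
        have h1 : f x ^ s / A ^ s * A ^ s = f x ^ s :=
          ENNReal.div_mul_cancel (by simp [hA0, hAt]) (by simp [hA0, hAt])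
        have h2 : g y ^ t / B ^ t * B ^ t = g y ^ t :=
          ENNReal.div_mul_cancel (by simp [hB0, hBt]) (by simp [hB0, hBt])
        rw [hP, mul_mul_mul_comm, h1, h2]
      · calc (f x / A) ^ s * (g y / B) ^ t ≤ 1 ^ s * 1 ^ t := by
              gcongr
              · exact hfA x
              · exact hgB y
          _ = 1 := by simp)
  have e1 : ∀ x, ENNReal.ofReal (f x / A).toReal = f x / A := fun x =>
    ENNReal.ofReal_toReal (ne_top_of_le_ne_top (by simp) (hfA x))
  have e2 : ∀ x, ENNReal.ofReal (g x / B).toReal = g x / B := fun x =>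
    ENNReal.ofReal_toReal (ne_top_of_le_ne_top (by simp) (hgB x))
  have e3 : ∀ x, ENNReal.ofReal (min (h x / P) 1).toReal ≤ h x / P := fun x =>
    ENNReal.ofReal_toReal_le.trans (min_le_left _ _)
  simp only [e1, e2] at main
  have main2 := (ennreal_geom_mean_le_arith_mean hs ht hst _ _).trans
    (main.trans (lintegral_mono e3))
  simp only [div_eq_mul_inv] at main2
  rw [lintegral_mul_const _ hf, lintegral_mul_const _ hg, lintegral_mul_const _ hh,
    ← div_eq_mul_inv, ← div_eq_mul_inv, ← div_eq_mul_inv,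
    ENNReal.le_div_iff_mul_le (.inl hP0) (.inl hPt), ENNReal.div_rpow_of_nonneg _ _ hs.le,
    ENNReal.div_rpow_of_nonneg _ _ ht.le, hP, mul_mul_mul_comm,
    ENNReal.div_mul_cancel (by simp [hA0, hAt]) (by simp [hA0, hAt]),
    ENNReal.div_mul_cancel (by simp [hB0, hBt]) (by simp [hB0, hBt])] at main2
  exact main2

lemma prekopaLeindler_real : PrekopaLeindler (volume : Measure ℝ) := by
  intro s t hs ht hst f g h hf hg hh H
  rcases eq_or_ne (∫⁻ x, f x) 0 with hf0 | hf0
  · simp [hf0, hs]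
  rcases eq_or_ne (∫⁻ x, g x) 0 with hg0 | hg0
  · simp [hg0, ht]
  have key : ∀ N : ℕ, (∫⁻ x, min (f x) N) ^ s * (∫⁻ x, min (g x) N) ^ t ≤ ∫⁻ x, h x := by
    intro N
    refine prekopa_leindler_of_bounded hs ht hst (hf.min measurable_const)
      (hg.min measurable_const) hh (N := N) (by simp) (fun x => min_le_right _ _)
      (fun x => min_le_right _ _) fun x y => le_trans ?_ (H x y)
    gcongr <;> exact min_le_left _ _
  have lim : ∀ u : ℝ → ℝ≥0∞, Measurable u →
      Filter.Tendsto (fun N : ℕ => ∫⁻ x, min (u x) N) Filter.atTop (nhds (∫⁻ x, u x)) := by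
    intro u hu
    refine lintegral_tendsto_of_tendsto_of_monotone
      (fun N => (hu.min measurable_const).aemeasurable) (.of_forall fun x a b hab => ?_)
      (.of_forall fun x => ?_)
    · exact min_le_min le_rfl (by exact_mod_cast hab)
    · have := (tendsto_const_nhds (x := u x)).min ENNReal.tendsto_nat_nhds_top
      simpa using this
  refine le_of_tendsto (ENNReal.Tendsto.mul ((lim f hf).ennrpow_const s) ?_
    ((lim g hg).ennrpow_const t) ?_) (.of_forall key)
  · left; simp [hf0, hs.le]
  · left; simp [hg0, ht.le]

lemma PrekopaLeindler.prod {E F : Type*} [AddCommGroup E] [Module ℝ E] [MeasurableSpace E]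
    [AddCommGroup F] [Module ℝ F] [MeasurableSpace F] {μ : Measure E} {ν : Measure F}
    [SFinite μ] [SFinite ν]
    (hμ : PrekopaLeindler μ) (hν : PrekopaLeindler ν) : PrekopaLeindler (μ.prod ν) := by
  intro s t hs ht hst f g h hf hg hh H
  rw [lintegral_prod _ hf.aemeasurable, lintegral_prod _ hg.aemeasurable,
    lintegral_prod _ hh.aemeasurable]
  refine hμ s t hs ht hst _ _ _ hf.lintegral_prod_right' hg.lintegral_prod_right'
    hh.lintegral_prod_right' fun x y => ?_
  exact hν s t hs ht hst _ _ _ (hf.comp measurable_prodMk_left)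
    (hg.comp measurable_prodMk_left) (hh.comp measurable_prodMk_left)
    fun a b => H (x, a) (y, b)

lemma PrekopaLeindler.of_measurePreserving {E F : Type*} [AddCommGroup E] [Module ℝ E]
    [MeasurableSpace E] [AddCommGroup F] [Module ℝ F] [MeasurableSpace F] {μ : Measure E}
    {ν : Measure F} (e : E → F) (he : MeasurePreserving e μ ν)
    (hadd : ∀ (s t : ℝ) x y, e (s • x + t • y) = s • e x + t • e y)
    (hμ : PrekopaLeindler μ) : PrekopaLeindler ν := by
  intro s t hs ht hst f g h hf hg hh H
  rw [← he.lintegral_comp hf, ← he.lintegral_comp hg, ← he.lintegral_comp hh]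
  refine hμ s t hs ht hst _ _ _ (hf.comp he.measurable) (hg.comp he.measurable)
    (hh.comp he.measurable) fun x y => ?_
  rw [hadd]
  exact H _ _

lemma prekopaLeindler_pi (n : ℕ) : PrekopaLeindler (volume : Measure (Fin n → ℝ)) := by
  induction n with
  | zero =>
    intro s t hs ht hst f g h hf hg hh H
    have : (volume : Measure (Fin 0 → ℝ)) Set.univ = 1 := by simp [volume_pi]
    simpa only [lintegral_unique, this, mul_one, Subsingleton.elim _ (default : Fin 0 → ℝ)]
      using H default default
  | succ n ih =>
    refine PrekopaLeindler.of_measurePreserving _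
      (volume_preserving_piFinSuccAbove (fun _ => ℝ) 0).symm ?_ (prekopaLeindler_real.prod ih)
    intro s t x y
    ext i
    refine Fin.cases ?_ (fun j => ?_) i <;>
      simp [MeasurableEquiv.piFinSuccAbove]

lemma PrekopaLeindler.measure_rpow_mul_le {E : Type*} [AddCommGroup E] [Module ℝ E]
    [MeasurableSpace E] {μ : Measure E} (hμ : PrekopaLeindler μ) {s t : ℝ} (hs : 0 < s)
    (ht : 0 < t) (hst : s + t = 1) {A B C : Set E} (hA : MeasurableSet A)
    (hB : MeasurableSet B) (hC : MeasurableSet C)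
    (h : ∀ a ∈ A, ∀ b ∈ B, s • a + t • b ∈ C) : μ A ^ s * μ B ^ t ≤ μ C := by
  have := hμ s t hs ht hst (A.indicator 1) (B.indicator 1) (C.indicator 1)
    (measurable_one.indicator hA) (measurable_one.indicator hB) (measurable_one.indicator hC)
    (by
      intro x y
      by_cases hx : x ∈ A
      · by_cases hy : y ∈ B
        · simp [hx, hy, h x hx y hy]
        · simp [hy, ht]
      · simp [hx, hs])
  simpa [lintegral_indicator_one, hA, hB, hC] using this

lemma PrekopaLeindler.le_measure {E : Type*} [AddCommGroup E] [Module ℝ E]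
    [MeasurableSpace E] {μ : Measure E} (hμ : PrekopaLeindler μ) {s t : ℝ} (hs : 0 ≤ s)
    (ht : 0 ≤ t) (hst : s + t = 1) {A B C : Set E} (hA : MeasurableSet A)
    (hB : MeasurableSet B) (hC : MeasurableSet C) {c : ℝ≥0∞} (hcA : c ≤ μ A) (hcB : c ≤ μ B)
    (h : ∀ a ∈ A, ∀ b ∈ B, s • a + t • b ∈ C) : c ≤ μ C := by
  rcases eq_or_ne c 0 with rfl | hc
  · exact zero_le
  have hAne : A.Nonempty := by
    by_contra hne
    rw [Set.not_nonempty_iff_eq_empty] at hne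
    simp [hne] at hcA; exact hc hcA
  have hBne : B.Nonempty := by
    by_contra hne
    rw [Set.not_nonempty_iff_eq_empty] at hne
    simp [hne] at hcB; exact hc hcB
  obtain ⟨a₀, ha₀⟩ := hAne
  obtain ⟨b₀, hb₀⟩ := hBne
  rcases hs.eq_or_lt with rfl | hs
  · obtain rfl : t = 1 := by linarith
    exact hcB.trans (measure_mono fun b hb => by simpa using h a₀ ha₀ b hb)
  rcases ht.eq_or_lt with rfl | ht
  · obtain rfl : s = 1 := by linarith
    exact hcA.trans (measure_mono fun a ha => by simpa using h a ha b₀ hb₀)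
  refine le_trans ?_ (hμ.measure_rpow_mul_le hs ht hst hA hB hC h)
  calc c = c ^ s * c ^ t := by
        rw [← ENNReal.rpow_add_of_nonneg _ _ hs.le ht.le, hst, ENNReal.rpow_one]
    _ ≤ _ := by gcongr

/-- A convex body with a finite group of measure-preserving linear symmetries without nonzero
fixed vectors has volume at most `2 ^ D` times that of its symmetric part. -/
lemma volume_le_two_pow_mul_volume_inter_neg {D : ℕ} {K : Set (Fin D → ℝ)}
    (hK : MeasurableSet K) (hc : Convex ℝ K) (hfin : volume K ≠ ⊤) {G : Type*} [Fintype G]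
    [Nonempty G] (g : G → (Fin D → ℝ) →ₗ[ℝ] (Fin D → ℝ))
    (hg : ∀ i, MeasurePreserving (g i) volume volume)
    (hgK : ∀ i x, g i x ∈ K ↔ x ∈ K) (hsum : ∀ x, ∑ i, g i x = 0) :
    volume K ≤ 2 ^ D * volume (K ∩ -K) := by
  rcases eq_or_ne (volume K) 0 with h0 | h0
  · simp [h0]
  set N : (Fin D → ℝ) → ℝ≥0∞ := fun x => volume {h | x + h ∈ K ∧ x - h ∈ K} with hN
  have hmeas : ∀ x, MeasurableSet {h : Fin D → ℝ | x + h ∈ K ∧ x - h ∈ K} := fun x =>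
    ((measurable_const_add x) hK).inter ((measurable_const.sub measurable_id) hK)
  have hNg : ∀ i x, N (g i x) = N x := by
    intro i x
    rw [hN]
    simp only
    rw [← (hg i).measure_preimage (hmeas _).nullMeasurableSet]
    congr 1
    ext h
    simp only [Set.mem_preimage, Set.mem_ofPred_eq, ← map_add, ← map_sub, hgK]
  have hconv : ∀ c, Convex ℝ {x | c ≤ N x} := by
    intro c x hx y hy s t hs ht hst
    refine (prekopaLeindler_pi D).le_measure hs ht hst (hmeas x) (hmeas y) (hmeas _) hx hy ?_
    rintro a ⟨ha1, ha2⟩ b ⟨hb1, hb2⟩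
    constructor
    · convert hc ha1 hb1 hs ht hst using 1
      simp only [smul_add]; abel
    · convert hc ha2 hb2 hs ht hst using 1
      simp only [smul_sub]; abel
  have hN0 : ∀ x, N x ≤ N 0 := by
    intro x
    have h1 := (hconv (N x)).sum_mem (t := Finset.univ)
      (w := fun _ : G => (Fintype.card G : ℝ)⁻¹) (z := fun i => g i x)
      (fun _ _ => by positivity) (by simp) (fun i _ => (hNg i x).ge)
    rw [← Finset.smul_sum, hsum, smul_zero] at h1
    exact h1
  have hNK : ∀ x, N x ≤ K.indicator (fun _ => N 0) x := by
    intro x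
    by_cases hx : x ∈ K
    · simpa [hx] using hN0 x
    · have : {h | x + h ∈ K ∧ x - h ∈ K} = ∅ := by
        ext h
        simp only [Set.mem_ofPred_eq, Set.mem_empty_iff_false, iff_false, not_and]
        intro h1 h2
        apply hx
        have := hc h1 h2 (a := 1 / 2) (b := 1 / 2) (by norm_num) (by norm_num) (by norm_num)
        convert this using 1
        rw [← smul_add, add_add_sub_cancel, ← two_smul ℝ x, smul_smul]
        norm_num
      simp [hN, this]
  have hint : ∫⁻ x, N x = (2 ^ D)⁻¹ * (volume K * volume K) := by
    have e1 : ∀ x, N x = ∫⁻ h, K.indicator 1 (x + h) * K.indicator 1 (x - h) := by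
      intro x
      rw [hN]
      simp only
      rw [← lintegral_indicator_one (hmeas x)]
      congr 1
      ext h
      by_cases h1 : x + h ∈ K <;> by_cases h2 : x - h ∈ K <;> simp [h1, h2]
    have hKm : Measurable (K.indicator (1 : (Fin D → ℝ) → ℝ≥0∞)) := measurable_one.indicator hK
    simp_rw [e1]
    rw [lintegral_lintegral_swap (Measurable.aemeasurable (by
      exact (hKm.comp (measurable_fst.add measurable_snd)).mul
        (hKm.comp (measurable_fst.sub measurable_snd))))]
    have e2 : ∀ h : Fin D → ℝ, ∫⁻ x, K.indicator (1 : (Fin D → ℝ) → ℝ≥0∞) (x + h) *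
        K.indicator 1 (x - h) = ∫⁻ x, K.indicator 1 x * K.indicator 1 (x + (-2 : ℝ) • h) := by
      intro h
      rw [← lintegral_add_right_eq_self _ (-h)]
      congr 1
      ext x
      congr 3 <;> module
    have e3 : ∀ x : Fin D → ℝ, ∫⁻ h, K.indicator (1 : (Fin D → ℝ) → ℝ≥0∞) (x + (-2 : ℝ) • h) =
        (2 ^ D)⁻¹ * volume K := by
      intro x
      have hpre : MeasurableSet ((fun h : Fin D → ℝ => (-2 : ℝ) • h) ⁻¹' ((fun h => x +
        h) ⁻¹' K)) :=
        (measurable_const_smul (-2 : ℝ)) ((measurable_const_add x) hK)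
      have : ∀ h : Fin D → ℝ, K.indicator (1 : (Fin D → ℝ) → ℝ≥0∞) (x + (-2 : ℝ) • h) =
          ((fun h : Fin D → ℝ => (-2 : ℝ) • h) ⁻¹' ((fun h => x + h) ⁻¹' K)).indicator 1 h :=
        fun h => rfl
      simp_rw [this]
      rw [lintegral_indicator_one hpre, Measure.addHaar_preimage_smul _ (by norm_num),
        measure_preimage_add]
      congr 1
      rw [abs_inv, abs_pow, ENNReal.ofReal_inv_of_pos (by positivity),
        ENNReal.ofReal_pow (by positivity)]
      norm_num
    simp_rw [e2]
    rw [lintegral_lintegral_swap (Measurable.aemeasurable (by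
      exact (hKm.comp measurable_snd).mul
        (hKm.comp (measurable_snd.add (measurable_fst.const_smul (-2 : ℝ))))))]
    have e4 : ∀ x : Fin D → ℝ, ∫⁻ h, K.indicator (1 : (Fin D → ℝ) → ℝ≥0∞) x *
        K.indicator 1 (x + (-2 : ℝ) • h) = K.indicator 1 x * ((2 ^ D)⁻¹ * volume K) := by
      intro x
      rw [lintegral_const_mul' _ _ (by
        by_cases hx : x ∈ K <;> simp [hx]), e3]
    simp_rw [e4]
    rw [lintegral_mul_const _ hKm, lintegral_indicator_one hK]
    ring
  have h1 : (2 ^ D)⁻¹ * (volume K * volume K) ≤ N 0 * volume K := by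
    rw [← hint]
    refine (lintegral_mono hNK).trans ?_
    rw [lintegral_indicator_const hK]
  have h2 : N 0 = volume (K ∩ -K) := by
    have : {h | 0 + h ∈ K ∧ 0 - h ∈ K} = K ∩ -K := by ext h; simp
    rw [hN, ← this]
  rw [← mul_assoc, ENNReal.mul_le_mul_iff_left h0 hfin, h2] at h1
  calc volume K = 2 ^ D * ((2 ^ D)⁻¹ * volume K) := by
        rw [← mul_assoc, ENNReal.mul_inv_cancel (by simp) (by simp), one_mul]
    _ ≤ _ := by gcongr

section Symmetric

variable {D : ℕ} {F : Type*} [NormedAddCommGroup F] [NormedSpace ℝ F]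
  {S : Set (Fin D → ℝ)}

lemma measurableSet_inter_norm_sub_le (hS : MeasurableSet S) (u : (Fin D → ℝ) →L[ℝ] F)
    (a : F) (ε : ℝ) : MeasurableSet {x | x ∈ S ∧ ‖u x - a‖ ≤ ε} := by
  have : IsClosed {x | ‖u x - a‖ ≤ ε} := isClosed_le (by fun_prop) continuous_const
  exact hS.inter this.measurableSet

lemma volume_inter_norm_sub_le_smul (hS : MeasurableSet S) (hc : Convex ℝ S)
    (hsymm : ∀ x ∈ S, -x ∈ S) (u : (Fin D → ℝ) →L[ℝ] F) (a : F) (ε : ℝ) {t : ℝ}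
    (ht0 : 0 ≤ t) (ht1 : t ≤ 1) :
    volume {x | x ∈ S ∧ ‖u x - a‖ ≤ ε} ≤ volume {x | x ∈ S ∧ ‖u x - t • a‖ ≤ ε} := by
  have hneg : volume {x | x ∈ S ∧ ‖u x - (-a)‖ ≤ ε} = volume {x | x ∈ S ∧ ‖u x - a‖ ≤ ε} := by
    rw [← Measure.measure_neg]
    congr 1
    ext x
    simp only [Set.mem_neg, Set.mem_ofPred_eq, map_neg]
    have e : ‖-u x - -a‖ = ‖u x - a‖ := by rw [← norm_neg]; congr 1; abel
    rw [e]
    exact and_congr_left fun _ => ⟨fun h => by simpa using hsymm _ h, fun h => hsymm _ h⟩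
  refine (prekopaLeindler_pi D).le_measure (s := (1 + t) / 2) (t := (1 - t) / 2) (by linarith)
    (by linarith) (by ring) (measurableSet_inter_norm_sub_le hS u a ε)
    (measurableSet_inter_norm_sub_le hS u (-a) ε) (measurableSet_inter_norm_sub_le hS u _ ε)
    le_rfl hneg.ge ?_
  rintro x ⟨hx, hxa⟩ y ⟨hy, hya⟩
  refine ⟨hc hx hy (by linarith) (by linarith) (by ring), ?_⟩
  have e : u (((1 + t) / 2) • x + ((1 - t) / 2) • y) - t • a =
      ((1 + t) / 2) • (u x - a) + ((1 - t) / 2) • (u y - -a) := by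
    simp only [map_add, map_smul]
    module
  rw [e]
  refine (norm_add_le _ _).trans ?_
  rw [norm_smul, norm_smul, Real.norm_of_nonneg (by linarith), Real.norm_of_nonneg (by linarith)]
  nlinarith

/-- The image of a symmetric convex body in the unit ball of a `d`-dimensional space
gives measure at least `t ^ d` to the ball of radius `t`. -/
lemma rpow_mul_volume_le [FiniteDimensional ℝ F] (hS : MeasurableSet S) (hc : Convex ℝ S)
    (hsymm : ∀ x ∈ S, -x ∈ S) (u : (Fin D → ℝ) →L[ℝ] F) (hu : ∀ x ∈ S, ‖u x‖ ≤ 1) {t : ℝ}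
    (ht0 : 0 < t) (ht1 : t ≤ 1) :
    ENNReal.ofReal (t ^ Module.finrank ℝ F) * volume S ≤ volume {x | x ∈ S ∧ ‖u x‖ ≤ t} := by
  let : MeasurableSpace F := borel F
  have : BorelSpace F := ⟨rfl⟩
  set d := Module.finrank ℝ F
  set μ : Measure F := Measure.addHaar
  have hμε : ∀ ε : ℝ, 0 < ε → μ (Metric.closedBall 0 ε) ≠ 0 := fun ε hε =>
    (Metric.measure_closedBall_pos _ _ hε).ne'
  have hμt : ∀ ε : ℝ, μ (Metric.closedBall 0 ε) ≠ ⊤ := fun ε => measure_closedBall_lt_top.ne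
  have key : ∀ r ε : ℝ, 0 < r → 0 < ε → r * (1 + ε) + ε ≤ t →
      ENNReal.ofReal (r ^ d) * volume S ≤ volume {x | x ∈ S ∧ ‖u x‖ ≤ t} := by
    intro r ε hr hε hrt
    have hr1 : r ≤ 1 := by nlinarith
    set N : F → ℝ≥0∞ := fun a => volume {x | x ∈ S ∧ ‖u x - a‖ ≤ ε} with hN
    have hJ : MeasurableSet {p : (Fin D → ℝ) × F | p.1 ∈ S ∧ ‖u p.1 - p.2‖ ≤ ε} := by
      have : IsClosed {p : (Fin D → ℝ) × F | ‖u p.1 - p.2‖ ≤ ε} :=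
        isClosed_le (by fun_prop) continuous_const
      exact (measurable_fst hS).inter this.measurableSet
    have swap : ∀ R : ℝ, ∫⁻ a in Metric.closedBall 0 R, N a ∂μ =
        ∫⁻ x in S, μ (Metric.closedBall (u x) ε ∩ Metric.closedBall 0 R) := by
      intro R
      have h1 : ∀ a, N a = ∫⁻ x, {p : (Fin D → ℝ) × F | p.1 ∈ S ∧ ‖u p.1 - p.2‖ ≤ ε}.indicator 1
          (x, a) := by
        intro a
        rw [hN]
        simp only
        rw [← lintegral_indicator_one (measurableSet_inter_norm_sub_le hS u a ε)]
        rfl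
      simp_rw [h1]
      rw [lintegral_lintegral_swap (Measurable.aemeasurable (by
        exact (measurable_one.indicator hJ).comp measurable_swap)), ← lintegral_indicator hS]
      congr 1
      ext x
      by_cases hx : x ∈ S
      · rw [Set.indicator_of_mem hx, ← Measure.restrict_apply measurableSet_closedBall,
          ← lintegral_indicator_one measurableSet_closedBall]
        congr 1
        ext a
        by_cases ha : ‖u x - a‖ ≤ ε
        · rw [Set.indicator_of_mem (by exact ⟨hx, ha⟩), Set.indicator_of_mem (by
            rwa [Metric.mem_closedBall, dist_comm, dist_eq_norm])]
          rfl
        · rw [Set.indicator_of_notMem (by exact fun h => ha h.2), Set.indicator_of_notMem (by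
            rwa [Metric.mem_closedBall, dist_comm, dist_eq_norm])]
      · rw [Set.indicator_of_notMem hx]
        have : ∀ a, {p : (Fin D → ℝ) × F | p.1 ∈ S ∧ ‖u p.1 - p.2‖ ≤ ε}.indicator
            (1 : (Fin D → ℝ) × F → ℝ≥0∞) (x, a) = 0 := fun a =>
          Set.indicator_of_notMem (fun h => hx h.1) _
        simp [this]
    have lower : μ (Metric.closedBall 0 ε) * volume S ≤
        ∫⁻ a in Metric.closedBall 0 (1 + ε), N a ∂μ := by
      rw [swap, ← setLIntegral_const]
      refine setLIntegral_mono' hS fun x hx => ?_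
      rw [Set.inter_eq_left.2, Measure.addHaar_closedBall_center μ (u x)]
      refine Metric.closedBall_subset_closedBall' ?_
      rw [dist_zero_right]
      linarith [hu x hx]
    have upper : ∫⁻ a in Metric.closedBall 0 (r * (1 + ε)), N a ∂μ ≤
        μ (Metric.closedBall 0 ε) * volume {x | x ∈ S ∧ ‖u x‖ ≤ t} := by
      rw [swap, ← lintegral_indicator hS, ← lintegral_indicator_const (by
        simpa using measurableSet_inter_norm_sub_le hS u 0 t)]
      refine lintegral_mono fun x => ?_
      by_cases hx : x ∈ S
      · rw [Set.indicator_of_mem hx]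
        by_cases hxt : ‖u x‖ ≤ t
        · rw [Set.indicator_of_mem (by exact ⟨hx, hxt⟩),
            ← Measure.addHaar_closedBall_center μ (u x)]
          exact measure_mono Set.inter_subset_left
        · have : Metric.closedBall (u x) ε ∩ Metric.closedBall 0 (r * (1 + ε)) = ∅ := by
            ext a
            simp only [Set.mem_inter_iff, Metric.mem_closedBall, dist_eq_norm, sub_zero,
              Set.mem_empty_iff_false, iff_false, not_and]
            intro h1 h2
            have := norm_sub_norm_le (u x) a
            rw [norm_sub_rev] at this
            linarith
          simp [this]
      · simp [hx]
    have scale : ENNReal.ofReal (r ^ d) * ∫⁻ a in Metric.closedBall 0 (1 + ε), N a ∂μ ≤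
        ∫⁻ a in Metric.closedBall 0 (r * (1 + ε)), N a ∂μ := by
      have h1 : ∫⁻ a in Metric.closedBall 0 (1 + ε), N (r • a) ∂μ =
          ENNReal.ofReal (r ^ d)⁻¹ * ∫⁻ a in Metric.closedBall 0 (r * (1 + ε)), N a ∂μ := by
        rw [← lintegral_indicator measurableSet_closedBall,
          ← lintegral_indicator measurableSet_closedBall]
        have e1 : ∀ a : F, (Metric.closedBall (0 : F) (1 + ε)).indicator (fun a => N (r • a)) a =
            (Metric.closedBall (0 : F) (r * (1 + ε))).indicator N
              (MeasurableEquiv.smul₀ r hr.ne' a) := by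
          intro a
          rw [MeasurableEquiv.coe_smul₀]
          have : a ∈ Metric.closedBall (0 : F) (1 + ε) ↔
              r • a ∈ Metric.closedBall (0 : F) (r * (1 + ε)) := by
            simp [norm_smul, abs_of_pos hr, hr]
          by_cases ha : a ∈ Metric.closedBall (0 : F) (1 + ε)
          · rw [Set.indicator_of_mem ha, Set.indicator_of_mem (this.1 ha)]
          · rw [Set.indicator_of_notMem ha, Set.indicator_of_notMem (fun h => ha (this.2 h))]
        simp_rw [e1]
        rw [← lintegral_map_equiv (μ := μ) _ (MeasurableEquiv.smul₀ r hr.ne')]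
        have : Measure.map (MeasurableEquiv.smul₀ r hr.ne') μ = ENNReal.ofReal (r ^ d)⁻¹ • μ := by
          have := Measure.map_addHaar_smul μ hr.ne'
          rwa [abs_of_pos (by positivity)] at this
        rw [this, lintegral_smul_measure, smul_eq_mul]
      calc _ ≤ ENNReal.ofReal (r ^ d) * ∫⁻ a in Metric.closedBall 0 (1 + ε), N (r • a) ∂μ := by
            gcongr with a
            exact volume_inter_norm_sub_le_smul hS hc hsymm u a ε hr.le hr1
        _ = _ := by
            rw [h1, ← mul_assoc, ← ENNReal.ofReal_mul (by positivity),
              mul_inv_cancel₀ (by positivity), ENNReal.ofReal_one, one_mul]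
    have h := (mul_le_mul_right lower _).trans (scale.trans upper)
    rwa [mul_left_comm, ENNReal.mul_le_mul_iff_right (hμε ε hε) (hμt ε)] at h
  have hcont : Filter.Tendsto (fun r : ℝ => ENNReal.ofReal (r ^ d) * volume S)
      (nhdsWithin t (Set.Iio t)) (nhds (ENNReal.ofReal (t ^ d) * volume S)) := by
    refine ENNReal.Tendsto.mul_const (ENNReal.tendsto_ofReal ?_) (.inl ?_)
    · exact ((continuous_id.pow d).tendsto t).mono_left nhdsWithin_le_nhds
    · rw [Ne, ENNReal.ofReal_eq_zero, not_le]
      positivity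
  refine le_of_tendsto hcont ?_
  have : Set.Ioo 0 t ∈ nhdsWithin t (Set.Iio t) := Ioo_mem_nhdsLT ht0
  filter_upwards [this] with r hr
  refine key r ((t - r) / 2) hr.1 (by linarith [hr.2]) ?_
  nlinarith [hr.1, hr.2]

lemma lintegral_norm_sq_le [FiniteDimensional ℝ F] (hS : MeasurableSet S) (hc : Convex ℝ S)
    (hfin : volume S ≠ ⊤)
    (hsymm : ∀ x ∈ S, -x ∈ S) (u : (Fin D → ℝ) →L[ℝ] F) (hu : ∀ x ∈ S, ‖u x‖ ≤ 1) :
    ∫⁻ x in S, ENNReal.ofReal (‖u x‖ ^ 2) ≤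
      ENNReal.ofReal (Module.finrank ℝ F / (Module.finrank ℝ F + 2)) * volume S := by
  set d := Module.finrank ℝ F
  have h1 := lintegral_rpow_eq_lintegral_meas_lt_mul (volume.restrict S) (f := fun x => ‖u x‖)
    (.of_forall fun x => norm_nonneg _)
    (Continuous.aemeasurable (by fun_prop)) (p := 2) (by norm_num)
  simp only [Real.rpow_two] at h1
  rw [h1]
  have h2 : ∀ t ∈ Set.Ioi (0 : ℝ), volume.restrict S {a | t < ‖u a‖} *
      ENNReal.ofReal (t ^ ((2 : ℝ) - 1)) ≤ (Set.Ioc (0 : ℝ) 1).indicator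
        (fun t => ENNReal.ofReal (t - t ^ (d + 1)) * volume S) t := by
    intro t ht
    have ht0 : (0 : ℝ) < t := ht
    have hm : MeasurableSet {a : Fin D → ℝ | t < ‖u a‖} :=
      (isOpen_lt continuous_const (by fun_prop)).measurableSet
    rw [Measure.restrict_apply hm]
    by_cases ht1 : t ≤ 1
    · rw [Set.indicator_of_mem (by exact ⟨ht0, ht1⟩)]
      have h3 := rpow_mul_volume_le hS hc hsymm u hu ht0 ht1
      have h4 : volume ({a | t < ‖u a‖} ∩ S) + volume {x | x ∈ S ∧ ‖u x‖ ≤ t} = volume S := by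
        have := measure_inter_add_sdiff (μ := volume) S hm
        rw [← this, Set.inter_comm]
        congr 2
        ext x
        simp
      have h5 : volume ({a | t < ‖u a‖} ∩ S) ≤ ENNReal.ofReal (1 - t ^ d) * volume S := by
        rw [ENNReal.ofReal_sub _ (by positivity), ENNReal.sub_mul (fun _ _ => hfin),
          ENNReal.ofReal_one, one_mul]
        refine ENNReal.le_sub_of_add_le_right (ENNReal.mul_ne_top ENNReal.ofReal_ne_top hfin) ?_
        rw [← h4]
        gcongr
        rwa [h4]
      have h6 : t - t ^ (d + 1) = (1 - t ^ d) * t := by ring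
      rw [h6, ENNReal.ofReal_mul (by simpa using pow_le_one₀ ht0.le ht1), mul_right_comm]
      gcongr
      norm_num
    · have : {a | t < ‖u a‖} ∩ S = ∅ := by
        ext x
        simp only [Set.mem_inter_iff, Set.mem_ofPred_eq, Set.mem_empty_iff_false, iff_false,
          not_and]
        intro h hx
        linarith [hu x hx]
      simp [this]
  refine (mul_le_mul_right (setLIntegral_mono' measurableSet_Ioi h2) _).trans ?_
  rw [setLIntegral_indicator measurableSet_Ioc,
    Set.inter_eq_left.2 (fun x hx => hx.1), lintegral_mul_const _ (by fun_prop),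
    ← ofReal_integral_eq_lintegral_ofReal, ← intervalIntegral.integral_of_le zero_le_one,
    ← mul_assoc, ← ENNReal.ofReal_mul (by norm_num)]
  · refine le_of_eq ?_
    congr 2
    rw [intervalIntegral.integral_sub (by simp) (by simp)]
    simp only [integral_id, integral_pow]
    push_cast
    field_simp
    ring
  · exact (Continuous.integrableOn_Icc (by fun_prop)).mono_set Set.Ioc_subset_Icc_self
  · refine (ae_restrict_iff' measurableSet_Ioc).2 (.of_forall fun t ht => ?_)
    simp only [Pi.zero_apply, sub_nonneg]
    exact pow_le_of_le_one ht.1.le ht.2 (by omega)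

end Symmetric

lemma volume_sum_sq_le {D : ℕ} {t : ℝ} (ht : 0 ≤ t) (hD : 0 < D) :
    volume {x : Fin D → ℝ | ∑ i, x i ^ 2 ≤ t ^ 2} =
      ENNReal.ofReal (t ^ D) * volume {x : Fin D → ℝ | ∑ i, x i ^ 2 ≤ 1} := by
  rcases ht.eq_or_lt with rfl | ht
  · have : {x : Fin D → ℝ | ∑ i, x i ^ 2 ≤ 0 ^ 2} ⊆ {0} := by
      intro x hx
      have h0 : ∑ i, x i ^ 2 = 0 :=
        le_antisymm (by simpa using hx) (Finset.sum_nonneg fun i _ => sq_nonneg _)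
      rw [Finset.sum_eq_zero_iff_of_nonneg fun i _ => sq_nonneg _] at h0
      ext i
      simpa using h0 i (Finset.mem_univ i)
    have hne : Nonempty (Fin D) := ⟨⟨0, hD⟩⟩
    rw [measure_mono_null this (by simp)]
    simp [hD.ne']
  · have : {x : Fin D → ℝ | ∑ i, x i ^ 2 ≤ t ^ 2} = t • {x : Fin D → ℝ | ∑ i, x i ^ 2 ≤ 1} := by
      ext x
      rw [Set.mem_smul_set_iff_inv_smul_mem₀ ht.ne']
      simp only [Set.mem_ofPred_eq, Pi.smul_apply, smul_eq_mul, mul_pow, ← Finset.mul_sum]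
      rw [inv_pow, inv_mul_le_iff₀ (by positivity), mul_one]
    rw [this, Measure.addHaar_smul, abs_of_nonneg (by positivity)]
    simp

lemma isCompact_sum_sq_le (D : ℕ) (t : ℝ) : IsCompact {x : Fin D → ℝ | ∑ i, x i ^ 2 ≤ t ^ 2} := by
  refine Metric.isCompact_of_isClosed_isBounded (isClosed_le (by fun_prop) continuous_const) ?_
  refine (Metric.isBounded_closedBall (x := (0 : Fin D → ℝ)) (r := |t|)).subset fun x hx => ?_
  rw [mem_closedBall_zero_iff, pi_norm_le_iff_of_nonneg (abs_nonneg t)]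
  intro i
  rw [Real.norm_eq_abs, ← sq_le_sq]
  exact (Finset.single_le_sum (f := fun i => x i ^ 2) (fun _ _ => sq_nonneg _)
    (Finset.mem_univ i)).trans hx

lemma volume_unit_ball_ne_top (D : ℕ) : volume {x : Fin D → ℝ | ∑ i, x i ^ 2 ≤ 1} ≠ ⊤ := by
  have := (isCompact_sum_sq_le D 1).measure_lt_top (μ := volume).ne
  simpa using this

lemma volume_unit_ball_ne_zero (D : ℕ) : volume {x : Fin D → ℝ | ∑ i, x i ^ 2 ≤ 1} ≠ 0 := by
  have ho : IsOpen {x : Fin D → ℝ | ∑ i, x i ^ 2 < 1} :=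
    isOpen_lt (by fun_prop) continuous_const
  have := ho.measure_pos volume ⟨0, by simp⟩
  refine (this.trans_le (measure_mono fun x hx => ?_)).ne'
  exact le_of_lt (Set.mem_ofPred_eq.mp hx)

/-- Among sets of given volume, the centered ball minimizes the second moment. -/
lemma volume_le_of_second_moment_le {D : ℕ} (hD : 0 < D) {S : Set (Fin D → ℝ)}
    (hfin : volume S ≠ ⊤) {c : ℝ} (hc : 0 ≤ c)
    (h : ∫⁻ x in S, ENNReal.ofReal (∑ i, x i ^ 2) ≤ ENNReal.ofReal c * volume S) :
    volume S ≤ ENNReal.ofReal ((c * ((D + 2) / D)) ^ ((D : ℝ) / 2)) *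
      volume {x : Fin D → ℝ | ∑ i, x i ^ 2 ≤ 1} := by
  have hD' : (0 : ℝ) < D := by exact_mod_cast hD
  set ω := (volume {x : Fin D → ℝ | ∑ i, x i ^ 2 ≤ 1}).toReal with hω
  set v := (volume S).toReal with hv
  have hω' : volume {x : Fin D → ℝ | ∑ i, x i ^ 2 ≤ 1} = ENNReal.ofReal ω :=
    (ENNReal.ofReal_toReal (volume_unit_ball_ne_top D)).symm
  have hv' : volume S = ENNReal.ofReal v := (ENNReal.ofReal_toReal hfin).symm
  have hω0 : 0 < ω := ENNReal.toReal_pos (volume_unit_ball_ne_zero D) (volume_unit_ball_ne_top D)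
  rcases ENNReal.toReal_nonneg.eq_or_lt with hv0 | hv0
  · rw [hv', hv, ← hv0]; simp
  rw [← hv] at hv0
  set r := (v / ω) ^ ((D : ℝ)⁻¹) with hr
  have hr0 : 0 < r := by positivity
  have hrD : v = ω * r ^ D := by
    rw [hr, Real.rpow_inv_natCast_pow (by positivity) hD.ne']
    field_simp
  have h1 := lintegral_rpow_eq_lintegral_meas_lt_mul (volume.restrict S)
    (f := fun x => √(∑ i, x i ^ 2))
    (.of_forall fun x => Real.sqrt_nonneg _) (Continuous.aemeasurable (by fun_prop)) (p :=
      2) (by norm_num)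
  have hsq : ∀ x : Fin D → ℝ, √(∑ i, x i ^ 2) ^ 2 = ∑ i, x i ^ 2 := fun x =>
    Real.sq_sqrt (Finset.sum_nonneg fun i _ => sq_nonneg _)
  simp only [Real.rpow_two, hsq] at h1
  have h2 : ∀ t ∈ Set.Ioi (0 : ℝ), (Set.Ioc (0 : ℝ) r).indicator
        (fun t => ENNReal.ofReal (v * t - ω * t ^ (D + 1))) t ≤
        volume.restrict S {a | t < √(∑ i, a i ^ 2)} * ENNReal.ofReal (t ^ ((2 : ℝ) - 1)) := by
    intro t ht
    have ht0 : (0 : ℝ) < t := ht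
    by_cases htr : t ≤ r
    · rw [Set.indicator_of_mem (by exact ⟨ht0, htr⟩)]
      have e : v * t - ω * t ^ (D + 1) = (v - t ^ D * ω) * t := by ring
      rw [e, ENNReal.ofReal_mul' ht0.le]
      have hm : MeasurableSet {a : Fin D → ℝ | t < √(∑ i, a i ^ 2)} :=
        (isOpen_lt continuous_const (by fun_prop)).measurableSet
      gcongr
      · rw [Measure.restrict_apply hm, ENNReal.ofReal_sub _ (by positivity),
          ENNReal.ofReal_mul (by positivity), ← hω', ← volume_sum_sq_le ht0.le hD, ← hv']
        rw [tsub_le_iff_right]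
        refine (measure_mono (fun x hx => ?_)).trans (measure_union_le _ _)
        by_cases hx2 : t < √(∑ i, x i ^ 2)
        · exact .inl ⟨hx2, hx⟩
        · right
          rw [not_lt, Real.sqrt_le_left ht0.le] at hx2
          exact hx2
      · norm_num
    · rw [Set.indicator_of_notMem (fun h => htr h.2)]
      exact zero_le
  have h3 := mul_le_mul_right (setLIntegral_mono' (μ := volume) measurableSet_Ioi h2)
    (ENNReal.ofReal 2)
  rw [← h1, setLIntegral_indicator measurableSet_Ioc,
    Set.inter_eq_left.2 (fun x hx => hx.1),
    ← ofReal_integral_eq_lintegral_ofReal, ← intervalIntegral.integral_of_le hr0.le,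
    ← ENNReal.ofReal_mul (by norm_num)] at h3
  · have h4 := h3.trans h
    rw [hv', ← ENNReal.ofReal_mul hc, ENNReal.ofReal_le_ofReal_iff (by positivity),
      intervalIntegral.integral_sub (Continuous.intervalIntegrable (by fun_prop) _ _)
        (Continuous.intervalIntegrable (by fun_prop) _ _),
      intervalIntegral.integral_const_mul, intervalIntegral.integral_const_mul] at h4
    simp only [integral_id, integral_pow] at h4
    have h5 : r ^ 2 ≤ c * ((D + 2) / D) := by
      have e : 2 * (v * ((r ^ 2 - 0 ^ 2) / 2) -
          ω * ((r ^ (D + 1 + 1) - 0 ^ (D + 1 + 1)) / ((D + 1 : ℕ) + 1))) =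
          r ^ 2 * (D / (D + 2)) * v := by
        have : r ^ (D + 1 + 1) = r ^ D * r ^ 2 := by ring
        rw [this, hrD]
        push_cast
        field_simp
        simp
        ring
      rw [e] at h4
      have h6 := le_of_mul_le_mul_right h4 hv0
      rw [← mul_div_assoc, div_le_iff₀ (by positivity)] at h6
      rw [← mul_div_assoc, le_div_iff₀ hD']
      linarith
    rw [hv', hω', ← ENNReal.ofReal_mul (by positivity), hrD, mul_comm]
    refine ENNReal.ofReal_le_ofReal ?_
    gcongr
    calc r ^ D = (r ^ 2) ^ ((D : ℝ) / 2) := by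
          rw [← Real.rpow_natCast r 2, ← Real.rpow_mul hr0.le, ← Real.rpow_natCast]
          congr 1
          push_cast
          ring
      _ ≤ _ := by gcongr
  · exact (Continuous.integrableOn_Icc (by fun_prop)).mono_set Set.Ioc_subset_Icc_self
  · refine (ae_restrict_iff' measurableSet_Ioc).2 (.of_forall fun t ht => ?_)
    simp only [Pi.zero_apply, sub_nonneg]
    rw [pow_succ, ← mul_assoc, hrD]
    have := ht.1
    gcongr
    exact ht.2

lemma exists_orthogonal_diagonalization {ι : Type*} [Fintype ι] [DecidableEq ι]
    {T : Matrix ι ι ℝ} (hT : Tᵀ = T) :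
    ∃ (U : Matrix ι ι ℝ) (l : ι → ℝ), Uᵀ * U = 1 ∧ U * Uᵀ = 1 ∧
      T = U * Matrix.diagonal l * Uᵀ ∧ T.rank = Fintype.card {i // l i ≠ 0} := by
  have hH : T.IsHermitian :=
    by rwa [Matrix.IsHermitian, Matrix.conjTranspose_eq_transpose_of_trivial]
  have hst : star (hH.eigenvectorUnitary : Matrix ι ι ℝ) =
    (hH.eigenvectorUnitary : Matrix ι ι ℝ)ᵀ := by
    rw [Matrix.star_eq_conjTranspose, Matrix.conjTranspose_eq_transpose_of_trivial]
  refine ⟨hH.eigenvectorUnitary, hH.eigenvalues, ?_, ?_, ?_, hH.rank_eq_card_non_zero_eigs⟩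
  · rw [← hst]; exact Unitary.coe_star_mul_self _
  · rw [← hst]; exact Unitary.coe_mul_star_self _
  · have := hH.spectral_theorem
    rw [Unitary.conjStarAlgAut_apply, hst] at this
    exact this

lemma mulVec_dotProduct_mulVec_of_transpose_mul_eq_one {ι κ : Type*} [Fintype ι] [Fintype κ]
    [DecidableEq κ]
    {U : Matrix ι κ ℝ} (hU : Uᵀ * U = 1) (a b : κ → ℝ) : (U *ᵥ a) ⬝ᵥ (U *ᵥ b) = a ⬝ᵥ b := by
  rw [Matrix.dotProduct_mulVec, Matrix.vecMul_mulVec, hU, Matrix.vecMul_one]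

lemma exists_matrix_of_quadratic_le {D : ℕ} {T : Matrix (Fin D) (Fin D) ℝ} (hT : Tᵀ = T)
    (hT1 : ∀ a : Fin D → ℝ, a ⬝ᵥ T *ᵥ a ≤ a ⬝ᵥ a) {N : ℝ} (hN : 0 ≤ N) :
    ∃ A : Matrix (Fin D) (Fin D) ℝ,
      (∀ a, (A *ᵥ a) ⬝ᵥ (A *ᵥ a) ≤ (N + 1) * (a ⬝ᵥ a) - N * (a ⬝ᵥ T *ᵥ a)) ∧
      |A.det| = √(N + 1) ^ (D - T.rank) := by
  obtain ⟨U, l, hU1, hU2, hTU, hrank⟩ := exists_orthogonal_diagonalization hT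
  set w : Fin D → ℝ := fun i => if l i = 0 then √(N + 1) else 1 with hw
  have hquad : ∀ (d : Fin D → ℝ) (a : Fin D → ℝ), a ⬝ᵥ (U * Matrix.diagonal d * Uᵀ) *ᵥ a =
      ∑ i, d i * (Uᵀ *ᵥ a) i ^ 2 := by
    intro d a
    rw [← Matrix.mulVec_mulVec, ← Matrix.mulVec_mulVec, Matrix.dotProduct_mulVec,
      ← Matrix.mulVec_transpose, dotProduct]
    refine Finset.sum_congr rfl fun i _ => ?_
    rw [Matrix.mulVec_diagonal]
    ring
  have hl : ∀ i, l i ≤ 1 := by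
    intro i
    have := hT1 (U *ᵥ Pi.single i 1)
    rw [mulVec_dotProduct_mulVec_of_transpose_mul_eq_one hU1, hTU, hquad, Matrix.mulVec_mulVec, hU1,
      Matrix.one_mulVec] at this
    simpa [Pi.single_apply] using this
  have hsq : ∀ a : Fin D → ℝ, a ⬝ᵥ a = ∑ i, (Uᵀ *ᵥ a) i ^ 2 := by
    intro a
    rw [← mulVec_dotProduct_mulVec_of_transpose_mul_eq_one (U := Uᵀ) (by simpa using hU2),
      dotProduct]
    exact Finset.sum_congr rfl fun i _ => by ring
  refine ⟨Matrix.diagonal w * Uᵀ, fun a => ?_, ?_⟩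
  · rw [hsq a, hTU, hquad, ← Matrix.mulVec_mulVec, dotProduct, Finset.mul_sum, Finset.mul_sum,
      ← Finset.sum_sub_distrib]
    refine Finset.sum_le_sum fun i _ => ?_
    rw [Matrix.mulVec_diagonal, hw]
    simp only
    split_ifs with h0
    · rw [h0, mul_mul_mul_comm, Real.mul_self_sqrt (by linarith)]
      linarith
    · nlinarith [mul_nonneg (mul_nonneg hN (sub_nonneg.2 (hl i))) (sq_nonneg ((Uᵀ *ᵥ a) i))]
  · have hdet : |Uᵀ.det| = 1 := by
      have h1 : U.det * U.det = 1 := by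
        have := congrArg Matrix.det hU1
        simpa using this
      rw [Matrix.det_transpose]
      rcases mul_self_eq_one_iff.1 h1 with h | h <;> simp [h]
    rw [Matrix.det_mul, abs_mul, hdet, mul_one, Matrix.det_diagonal, hw, Finset.prod_ite]
    simp only [Finset.prod_const, one_pow, mul_one]
    rw [abs_of_nonneg (by positivity)]
    congr 1
    rw [hrank, Fintype.card_subtype]
    simp only [ne_eq]
    have := Finset.card_filter_add_card_filter_not (s :=
      (Finset.univ : Finset (Fin D))) (fun i => l i = 0)
    rw [Finset.card_univ, Fintype.card_fin] at this
    omega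

/-- A volume bound for symmetric sets from an average bound on a quadratic form with a small
defect from a multiple of the Euclidean norm. -/
lemma volume_le_of_quadratic_average_le {D : ℕ} (hD : 0 < D) {S : Set (Fin D → ℝ)}
    (hS : MeasurableSet S) (hfin : volume S ≠ ⊤) {T : Matrix (Fin D) (Fin D) ℝ} (hT : Tᵀ = T)
    (hT1 : ∀ a : Fin D → ℝ, a ⬝ᵥ T *ᵥ a ≤ a ⬝ᵥ a) {N c : ℝ} (hN : 0 ≤ N) (hc : 0 ≤ c)
    (hQ : ∫⁻ a in S, ENNReal.ofReal ((N + 1) * (a ⬝ᵥ a) - N * (a ⬝ᵥ T *ᵥ a)) ≤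
      ENNReal.ofReal c * volume S) :
    ENNReal.ofReal (√(N + 1) ^ (D - T.rank)) * volume S ≤
      ENNReal.ofReal ((c * ((D + 2) / D)) ^ ((D : ℝ) / 2)) *
        volume {x : Fin D → ℝ | ∑ i, x i ^ 2 ≤ 1} := by
  obtain ⟨A, hA, hdet⟩ := exists_matrix_of_quadratic_le hT hT1 hN
  set f : (Fin D → ℝ) →L[ℝ] (Fin D → ℝ) := LinearMap.toContinuousLinearMap (Matrix.toLin' A) with hf
  have hfA : ∀ a, f a = A *ᵥ a := fun a => rfl
  have hfdet : f.det = A.det := by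
    rw [ContinuousLinearMap.det, hf, LinearMap.coe_toContinuousLinearMap, LinearMap.det_toLin']
  have hdet0 : A.det ≠ 0 := by
    intro h0
    rw [h0, abs_zero] at hdet
    have : 0 < √(N + 1) ^ (D - T.rank) := by positivity
    exact this.ne hdet
  have hinj : Function.Injective f := by
    have : Function.Injective A.mulVec :=
      Matrix.mulVec_injective_iff_isUnit.2 ((Matrix.isUnit_iff_isUnit_det A).2 (isUnit_iff_ne_zero.2 hdet0))
    exact this
  have change : ∀ g : (Fin D → ℝ) → ℝ≥0∞, ∫⁻ x in f '' S, g x =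
      ENNReal.ofReal |A.det| * ∫⁻ a in S, g (f a) := by
    intro g
    rw [lintegral_image_eq_lintegral_abs_det_fderiv_mul volume hS
      (fun x _ => f.hasFDerivWithinAt) hinj.injOn, hfdet,
      lintegral_const_mul' _ _ ENNReal.ofReal_ne_top]
  have hvol : volume (f '' S) = ENNReal.ofReal |A.det| * volume S := by
    simpa using change 1
  rw [← hdet, ← hvol]
  refine volume_le_of_second_moment_le hD ?_ hc ?_
  · rw [hvol]; exact ENNReal.mul_ne_top ENNReal.ofReal_ne_top hfin
  · rw [change, hvol, mul_left_comm]
    gcongr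
    refine le_trans (lintegral_mono fun a => ENNReal.ofReal_le_ofReal ?_) hQ
    refine le_trans (le_of_eq ?_) (hA a)
    rw [hfA, dotProduct]
    exact Finset.sum_congr rfl fun i _ => by ring

lemma lintegral_exp_neg_indicator {t : ℝ} (ht : 0 ≤ t) :
    ∫⁻ s in Set.Ioi (0 : ℝ), (Set.Ici t).indicator (fun s => ENNReal.ofReal (Real.exp (-s))) s =
      ENNReal.ofReal (Real.exp (-t)) := by
  rw [lintegral_indicator measurableSet_Ici, Measure.restrict_restrict measurableSet_Ici,
    ← integral_exp_neg_Ioi t, ofReal_integral_eq_lintegral_ofReal (integrableOn_exp_neg_Ioi t)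
      (by filter_upwards with x using (Real.exp_pos _).le)]
  apply setLIntegral_congr
  refine ae_eq_trans ?_ Ioi_ae_eq_Ici.symm
  rcases ht.eq_or_lt with rfl | h
  · rw [Set.inter_eq_right.2 Set.Ioi_subset_Ici_self]; exact Ioi_ae_eq_Ici
  · have : Set.Ici t ⊆ Set.Ioi 0 := fun x (hx : t ≤ x) => lt_of_lt_of_le h hx
    rw [Set.inter_eq_left.2 this]
    exact Filter.EventuallyEq.rfl

lemma lintegral_sum_sq_le_of_homogeneous {D k : ℕ} {F : (Fin D → ℝ) → ℝ≥0∞}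
    (hFm : Measurable F)
    (hF : ∀ (r : ℝ) x, 0 < r → F (r • x) = ENNReal.ofReal (r ^ (2 * k)) * F x) {s : ℝ}
    (hs : 0 < s) :
    ∫⁻ x in {x : Fin D → ℝ | ∑ i, x i ^ 2 ≤ s}, F x =
      ENNReal.ofReal (s ^ ((D : ℝ) / 2 + k)) * ∫⁻ x in {x : Fin D → ℝ | ∑ i, x i ^ 2 ≤ 1}, F x := by
  have hr : 0 < √s := Real.sqrt_pos.2 hs
  have hmeas : ∀ t : ℝ, MeasurableSet {x : Fin D → ℝ | ∑ i, x i ^ 2 ≤ t} := fun t =>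
    measurableSet_le (by fun_prop) measurable_const
  have key := lintegral_map (μ := (volume : Measure (Fin D → ℝ)))
    (hFm.indicator (hmeas s)) (measurable_const_smul (√s))
  rw [Measure.map_addHaar_smul _ hr.ne', lintegral_smul_measure,
    lintegral_indicator (hmeas s)] at key
  have h2 : ∀ x : Fin D → ℝ, Set.indicator {x : Fin D → ℝ | ∑ i, x i ^ 2 ≤ s} F (√s • x) =
      ENNReal.ofReal (√s ^ (2 * k)) * Set.indicator {x : Fin D → ℝ | ∑ i, x i ^ 2 ≤ 1} F x := by
    intro x
    have h3 : (∑ i, (√s • x) i ^ 2 ≤ s) ↔ ∑ i, x i ^ 2 ≤ 1 := by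
      simp only [Pi.smul_apply, smul_eq_mul, mul_pow, Real.sq_sqrt hs.le, ← Finset.mul_sum]
      exact mul_le_iff_le_one_right hs
    by_cases h : ∑ i, x i ^ 2 ≤ 1
    · rw [Set.indicator_of_mem (by exact h3.2 h), Set.indicator_of_mem (by exact h), hF _ _ hr]
    · rw [Set.indicator_of_notMem (by exact fun h' => h (h3.1 h')),
        Set.indicator_of_notMem (by exact h), mul_zero]
  simp only [h2] at key
  rw [lintegral_const_mul' _ _ ENNReal.ofReal_ne_top, lintegral_indicator (hmeas 1)] at key
  have h4 : ENNReal.ofReal (√s ^ D) * ENNReal.ofReal |(√s ^ Module.finrank ℝ (Fin D → ℝ))⁻¹| =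
    1 := by
    rw [← ENNReal.ofReal_mul (by positivity), Module.finrank_fin_fun, abs_of_nonneg (by positivity),
      mul_inv_cancel₀ (by positivity), ENNReal.ofReal_one]
  have h5 : s ^ ((D : ℝ) / 2 + k) = √s ^ D * √s ^ (2 * k) := by
    rw [← pow_add, Real.sqrt_eq_rpow, ← Real.rpow_natCast, ← Real.rpow_mul hs.le]
    congr 1; push_cast; ring
  rw [h5, ENNReal.ofReal_mul (by positivity), mul_assoc, ← key, smul_eq_mul, ← mul_assoc, h4,
    one_mul]

lemma lintegral_gaussian_of_homogeneous {D k : ℕ} {F : (Fin D → ℝ) → ℝ≥0∞}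
    (hFm : Measurable F)
    (hF : ∀ (r : ℝ) x, 0 < r → F (r • x) = ENNReal.ofReal (r ^ (2 * k)) * F x) :
    ∫⁻ x, F x * ENNReal.ofReal (Real.exp (-∑ i, x i ^ 2)) =
      ENNReal.ofReal (Real.Gamma ((D : ℝ) / 2 + k + 1)) *
        ∫⁻ x in {x : Fin D → ℝ | ∑ i, x i ^ 2 ≤ 1}, F x := by
  have hmeas : ∀ t : ℝ, MeasurableSet {x : Fin D → ℝ | ∑ i, x i ^ 2 ≤ t} := fun t =>
    measurableSet_le (by fun_prop) measurable_const
  have h1 : ∀ x : Fin D → ℝ, F x * ENNReal.ofReal (Real.exp (-∑ i, x i ^ 2)) =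
      ∫⁻ s in Set.Ioi (0 : ℝ), Set.indicator {p : (Fin D → ℝ) × ℝ | ∑ i, p.1 i ^ 2 ≤ p.2}
        (fun p => F p.1 * ENNReal.ofReal (Real.exp (-p.2))) (x, s) := by
    intro x
    rw [← lintegral_exp_neg_indicator (Finset.sum_nonneg fun i _ => sq_nonneg (x i)),
      ← lintegral_const_mul _ (by measurability)]
    refine lintegral_congr fun s => ?_
    by_cases h : ∑ i, x i ^ 2 ≤ s
    · rw [Set.indicator_of_mem (by exact h), Set.indicator_of_mem (by exact h)]
    · rw [Set.indicator_of_notMem (by exact h), Set.indicator_of_notMem (by exact h), mul_zero]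
  simp only [h1]
  rw [lintegral_lintegral_swap]
  · have h2 : ∀ s ∈ Set.Ioi (0 : ℝ), ∫⁻ x,
        Set.indicator {p : (Fin D → ℝ) × ℝ | ∑ i, p.1 i ^ 2 ≤ p.2}
        (fun p => F p.1 * ENNReal.ofReal (Real.exp (-p.2))) (x, s) =
        ENNReal.ofReal (Real.exp (-s) * s ^ ((D : ℝ) / 2 + k + 1 - 1)) *
          ∫⁻ x in {x : Fin D → ℝ | ∑ i, x i ^ 2 ≤ 1}, F x := by
      intro s hs
      rw [ENNReal.ofReal_mul (Real.exp_pos _).le, add_sub_cancel_right, mul_assoc,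
        ← lintegral_sum_sq_le_of_homogeneous hFm hF hs, ← lintegral_indicator (hmeas s),
        ← lintegral_const_mul' _ _ ENNReal.ofReal_ne_top]
      refine lintegral_congr fun x => ?_
      by_cases h : ∑ i, x i ^ 2 ≤ s
      · rw [Set.indicator_of_mem (by exact h), Set.indicator_of_mem (by exact h), mul_comm]
      · rw [Set.indicator_of_notMem (by exact h), Set.indicator_of_notMem (by exact h), mul_zero]
    rw [setLIntegral_congr_fun measurableSet_Ioi h2, lintegral_mul_const _ (by fun_prop),
      Real.Gamma_eq_integral (by positivity), ofReal_integral_eq_lintegral_ofReal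
        (Real.GammaIntegral_convergent (by positivity))]
    filter_upwards [ae_restrict_mem measurableSet_Ioi] with s hs
    exact mul_nonneg (Real.exp_pos _).le (Real.rpow_nonneg (le_of_lt hs) _)
  · apply Measurable.aemeasurable
    apply Measurable.indicator
    · exact (hFm.comp measurable_fst).mul (by fun_prop)
    · exact measurableSet_le (by fun_prop) (by fun_prop)


lemma lintegral_pow_mul_exp_neg_sq (k : ℕ) :
    ∫⁻ x : ℝ, ENNReal.ofReal (x ^ (2 * k)) * ENNReal.ofReal (Real.exp (-x ^ 2)) =
      ENNReal.ofReal (Real.Gamma (k + 1 / 2)) := by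
  have h1 : ∫ x : ℝ, x ^ (2 * k) * Real.exp (-x ^ 2) = Real.Gamma (k + 1 / 2) := by
    have h2 := integral_comp_abs (f := fun x : ℝ => x ^ (2 * k) * Real.exp (-x ^ 2))
    simp only [sq_abs, pow_mul] at h2
    simp only [pow_mul]
    rw [h2]
    have h3 := integral_rpow_mul_exp_neg_rpow (p := 2) (q := 2 * k) two_pos
      (by have : (0 : ℝ) ≤ k := k.cast_nonneg
          linarith)
    rw [show (2 * (k : ℝ) + 1) / 2 = k + 1 / 2 by ring] at h3
    rw [show Real.Gamma (k + 1 / 2) = 2 * (1 / 2 * Real.Gamma (k + 1 / 2)) by ring, ← h3]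
    congr 1
    refine setIntegral_congr_fun measurableSet_Ioi fun x hx => ?_
    rw [show (2 * (k : ℝ)) = ((2 * k : ℕ) : ℝ) by push_cast; ring, Real.rpow_natCast, pow_mul,
      Real.rpow_two]
  have hpos : 0 < Real.Gamma ((k : ℝ) + 1 / 2) := Real.Gamma_pos_of_pos (by positivity)
  rw [← h1, ofReal_integral_eq_lintegral_ofReal]
  · refine lintegral_congr fun x => ?_
    rw [ENNReal.ofReal_mul (by rw [pow_mul]; positivity)]
  · by_contra h
    rw [integral_undef h] at h1
    linarith
  · exact Filter.Eventually.of_forall fun x => by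
      simp only [Pi.zero_apply, pow_mul]; positivity

lemma lintegral_coord_pow_ball (D k : ℕ) :
    ENNReal.ofReal (Real.Gamma (((D + 1 : ℕ) : ℝ) / 2 + k + 1)) *
        ∫⁻ x in {x : Fin (D + 1) → ℝ | ∑ i, x i ^ 2 ≤ 1}, ENNReal.ofReal (x 0 ^ (2 * k)) =
      ENNReal.ofReal (Real.Gamma (k + 1 / 2)) *
        ∫⁻ y : Fin D → ℝ, ENNReal.ofReal (Real.exp (-∑ i, y i ^ 2)) := by
  rw [← lintegral_gaussian_of_homogeneous (by fun_prop), ← lintegral_pow_mul_exp_neg_sq,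
    ← lintegral_prod_mul (Measurable.aemeasurable (by fun_prop))
      (Measurable.aemeasurable (by fun_prop))]
  · rw [← (volume_preserving_piFinSuccAbove (fun _ : Fin (D + 1) => ℝ) 0).symm.lintegral_comp
      (by fun_prop)]
    refine lintegral_congr fun p => ?_
    simp only [MeasurableEquiv.piFinSuccAbove_symm_apply, Fin.insertNthEquiv_apply,
      Fin.insertNth_zero, Fin.sum_univ_succ, Fin.cons_zero, Fin.cons_succ, neg_add, Real.exp_add]
    rw [ENNReal.ofReal_mul (Real.exp_pos _).le, mul_assoc]
    rfl
  · intro r x hr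
    rw [Pi.smul_apply, smul_eq_mul, mul_pow, ENNReal.ofReal_mul (by positivity)]

lemma prod_add_half_le (k : ℕ) : ∏ i ∈ Finset.range k, ((i : ℝ) + 1 / 2) ≤ ((k : ℝ) / 2) ^ k := by
  have hpos : 0 ≤ ∏ i ∈ Finset.range k, ((i : ℝ) + 1 / 2) :=
    Finset.prod_nonneg fun i _ => by positivity
  refine le_of_sq_le_sq ?_ (by positivity)
  rw [sq, ← pow_mul, mul_comm k 2, pow_mul]
  nth_rewrite 2 [← Finset.prod_range_reflect]
  rw [← Finset.prod_mul_distrib]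
  refine le_trans (Finset.prod_le_prod (g := fun _ => ((k : ℝ) / 2) ^ 2) (fun i _ => by positivity)
    fun i hi => ?_) (by simp)
  have hi' := Finset.mem_range.1 hi
  rw [Nat.cast_sub (by omega), Nat.cast_sub (by omega)]
  push_cast
  nlinarith [sq_nonneg ((i : ℝ) + 1 / 2 - k / 2)]

lemma Gamma_add_nat {s : ℝ} (hs : 0 < s) (k : ℕ) :
    Real.Gamma (s + k) = (∏ i ∈ Finset.range k, (s + i)) * Real.Gamma s := by
  induction k with
  | zero => simp
  | succ k ih =>
    rw [Nat.cast_succ, ← add_assoc, Real.Gamma_add_one (by positivity), ih, Finset.prod_range_succ]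
    ring

lemma Gamma_mul_Gamma_le {D : ℕ} (hD : 0 < D) (k : ℕ) :
    Real.Gamma (k + 1 / 2) * Real.Gamma ((D : ℝ) / 2 + 1) ≤
      ((k : ℝ) / D) ^ k * (Real.Gamma (1 / 2) * Real.Gamma ((D : ℝ) / 2 + k + 1)) := by
  have hD' : (0 : ℝ) < D := by exact_mod_cast hD
  rw [add_comm (k : ℝ), Gamma_add_nat (by norm_num), show (D : ℝ) / 2 + k + 1 =
    ((D : ℝ) / 2 + 1) + k by ring,
    Gamma_add_nat (by positivity)]
  have h1 : ∏ i ∈ Finset.range k, ((1 : ℝ) / 2 + i) ≤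
      ((k : ℝ) / D) ^ k * ∏ i ∈ Finset.range k, ((D : ℝ) / 2 + 1 + i) := by
    calc _ = ∏ i ∈ Finset.range k, ((i : ℝ) + 1 / 2) := by simp only [add_comm]
      _ ≤ ((k : ℝ) / 2) ^ k := prod_add_half_le k
      _ = ((k : ℝ) / D) ^ k * ∏ i ∈ Finset.range k, ((D : ℝ) / 2) := by
        rw [Finset.prod_const, Finset.card_range, ← mul_pow]; congr 1; field_simp
      _ ≤ _ := by
        gcongr with i hi
        have : (0 : ℝ) ≤ i := i.cast_nonneg
        linarith
  have h2 : 0 < Real.Gamma (1 / 2) := Real.Gamma_pos_of_pos (by norm_num)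
  have h3 : 0 < Real.Gamma ((D : ℝ) / 2 + 1) := Real.Gamma_pos_of_pos (by positivity)
  have := mul_le_mul_of_nonneg_right h1 (mul_pos h2 h3).le
  nlinarith [this]

lemma lintegral_coord_pow_le (D k : ℕ) :
    ∫⁻ x in {x : Fin (D + 1) → ℝ | ∑ i, x i ^ 2 ≤ 1}, ENNReal.ofReal (x 0 ^ (2 * k)) ≤
      ENNReal.ofReal (((k : ℝ) / (D + 1 : ℕ)) ^ k) *
        volume {x : Fin (D + 1) → ℝ | ∑ i, x i ^ 2 ≤ 1} := by
  have h1 := lintegral_coord_pow_ball D k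
  have h0 := lintegral_coord_pow_ball D 0
  simp only [mul_zero, pow_zero, ENNReal.ofReal_one, lintegral_const, Measure.restrict_apply_univ,
    one_mul, Nat.cast_zero, zero_add, add_zero] at h0
  have hg1 : 0 < Real.Gamma (((D + 1 : ℕ) : ℝ) / 2 + k + 1) := Real.Gamma_pos_of_pos (by positivity)
  have hg0 : 0 < Real.Gamma (1 / 2) := Real.Gamma_pos_of_pos (by norm_num)
  have hg2 : 0 < Real.Gamma ((k : ℝ) + 1 / 2) := Real.Gamma_pos_of_pos (by positivity)
  have h2 := ENNReal.ofReal_le_ofReal (Gamma_mul_Gamma_le (Nat.succ_pos D) k)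
  rw [ENNReal.ofReal_mul hg2.le, ENNReal.ofReal_mul (by positivity),
    ENNReal.ofReal_mul hg0.le] at h2
  have hc : ENNReal.ofReal (Real.Gamma (((D + 1 : ℕ) : ℝ) / 2 + k + 1)) *
    ENNReal.ofReal (Real.Gamma (1 / 2)) ≠ 0 :=
    mul_ne_zero (ENNReal.ofReal_pos.2 hg1).ne' (ENNReal.ofReal_pos.2 hg0).ne'
  have hc' : ENNReal.ofReal (Real.Gamma (((D + 1 : ℕ) : ℝ) / 2 + k + 1)) *
    ENNReal.ofReal (Real.Gamma (1 / 2)) ≠ ⊤ :=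
    ENNReal.mul_ne_top ENNReal.ofReal_ne_top ENNReal.ofReal_ne_top
  rw [← ENNReal.mul_le_mul_iff_right hc hc']
  set I := ∫⁻ x in {x : Fin (D + 1) → ℝ | ∑ i, x i ^ 2 ≤ 1}, ENNReal.ofReal (x 0 ^ (2 * k))
  set H := ∫⁻ y : Fin D → ℝ, ENNReal.ofReal (Real.exp (-∑ i, y i ^ 2))
  set w := volume {x : Fin (D + 1) → ℝ | ∑ i, x i ^ 2 ≤ 1}
  rw [mul_right_comm, h1]
  calc _ = ENNReal.ofReal (Real.Gamma ((k : ℝ) + 1 / 2)) *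
      (ENNReal.ofReal (Real.Gamma (1 / 2)) * H) := by ring
    _ = (ENNReal.ofReal (Real.Gamma ((k : ℝ) + 1 / 2)) *
        ENNReal.ofReal (Real.Gamma (((D + 1 : ℕ) : ℝ) / 2 + 1))) * w := by
      rw [← h0]; ring
    _ ≤ _ := (mul_le_mul_left h2 w)
    _ = _ := by ring


/-- The orthogonal group acts transitively on vectors of a given length. -/
lemma exists_orthogonal_mulVec_eq {ι : Type*} [Fintype ι] [DecidableEq ι] {u v : ι → ℝ}
    (h : u ⬝ᵥ u = v ⬝ᵥ v) : ∃ Q : Matrix ι ι ℝ, Q * Qᵀ = 1 ∧ Qᵀ * Q = 1 ∧ Q *ᵥ u = v := by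
  by_cases huv : u = v
  · exact ⟨1, by simp, by simp, by simp [huv]⟩
  set w := u - v with hw
  have hw0 : w ⬝ᵥ w ≠ 0 := fun h0 => huv (sub_eq_zero.1 (dotProduct_self_eq_zero.1 h0))
  have hwu : w ⬝ᵥ w = 2 * (w ⬝ᵥ u) := by
    simp only [hw, sub_dotProduct, dotProduct_sub]
    rw [dotProduct_comm u v, ← h]; ring
  set Q : Matrix ι ι ℝ := 1 - (2 / (w ⬝ᵥ w)) • Matrix.vecMulVec w w with hQ
  have hQt : Qᵀ = Q := by
    simp [hQ, Matrix.transpose_sub, Matrix.transpose_smul, Matrix.transpose_vecMulVec]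
  have hQQ : Q * Q = 1 := by
    have h1 : Matrix.vecMulVec w w * Matrix.vecMulVec w w = (w ⬝ᵥ w) • Matrix.vecMulVec w w := by
      rw [Matrix.vecMulVec_mul_vecMulVec]
      ext i j
      simp [Matrix.vecMulVec_apply]; ring
    simp only [hQ, sub_mul, mul_sub, one_mul, mul_one, Matrix.smul_mul, Matrix.mul_smul, h1,
      smul_smul]
    rw [show 2 / (w ⬝ᵥ w) * (2 / (w ⬝ᵥ w) * (w ⬝ᵥ w)) = 2 / (w ⬝ᵥ w) +
      2 / (w ⬝ᵥ w) by field_simp; ring,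
      add_smul]
    abel
  refine ⟨Q, by rw [hQt, hQQ], by rw [hQt, hQQ], ?_⟩
  rw [hQ, Matrix.sub_mulVec, Matrix.one_mulVec, Matrix.smul_mulVec, Matrix.vecMulVec_mulVec]
  ext i
  have : w i = u i - v i := rfl
  have h2 : 2 / (w ⬝ᵥ w) * (w ⬝ᵥ u) = 1 := by
    rw [div_mul_eq_mul_div, ← hwu, div_self hw0]
  simp only [Pi.sub_apply, Pi.smul_apply, smul_eq_mul, MulOpposite.smul_eq_mul_unop,
    MulOpposite.unop_op]
  have h3 : 2 / (w ⬝ᵥ w) * (w i * (w ⬝ᵥ u)) = w i * (2 / (w ⬝ᵥ w) * (w ⬝ᵥ u)) := by ring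
  rw [h3, h2, this]; ring

lemma measurePreserving_mulVec_of_orthogonal {ι : Type*} [Fintype ι] [DecidableEq ι]
    {Q : Matrix ι ι ℝ} (hQ : Q * Qᵀ = 1) :
    MeasurePreserving (fun x : ι → ℝ => Q *ᵥ x) volume volume := by
  have hdet : |Q.det| = 1 := by
    have h1 : Q.det * Q.det = 1 := by
      have := congrArg Matrix.det hQ
      simpa using this
    rcases mul_self_eq_one_iff.1 h1 with h | h <;> simp [h]
  have h0 : Q.det ≠ 0 := fun h => by simp [h] at hdet
  have := Real.map_matrix_volume_pi_eq_smul_volume_pi h0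
  rw [abs_inv, hdet, inv_one, ENNReal.ofReal_one, one_smul] at this
  exact ⟨(Continuous.measurable (by fun_prop)), this⟩

/-- Even moments of linear forms on the unit ball. -/
lemma lintegral_dotProduct_pow_le {D : ℕ} (hD : 0 < D) {k : ℕ} (φ : Fin D → ℝ) :
    ∫⁻ a in {x : Fin D → ℝ | ∑ i, x i ^ 2 ≤ 1}, ENNReal.ofReal ((φ ⬝ᵥ a) ^ (2 * k)) ≤
      ENNReal.ofReal ((φ ⬝ᵥ φ) ^ k * ((k : ℝ) / D) ^ k) *
        volume {x : Fin D → ℝ | ∑ i, x i ^ 2 ≤ 1} := by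
  obtain ⟨D, rfl⟩ : ∃ D', D = D' + 1 := ⟨D - 1, by omega⟩
  set e : Fin (D + 1) → ℝ := Pi.single 0 √(φ ⬝ᵥ φ) with he
  have hφ : 0 ≤ φ ⬝ᵥ φ := Finset.sum_nonneg fun i _ => mul_self_nonneg _
  have hee : e ⬝ᵥ e = φ ⬝ᵥ φ := by
    rw [he, single_dotProduct, Pi.single_eq_same, Real.mul_self_sqrt hφ]
  obtain ⟨Q, hQ, hQ', hQe⟩ := exists_orthogonal_mulVec_eq hee
  have hB : MeasurableSet {x : Fin (D + 1) → ℝ | ∑ i, x i ^ 2 ≤ 1} :=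
    measurableSet_le (by fun_prop) measurable_const
  have hpre : (fun x => Q *ᵥ x) ⁻¹' {x : Fin (D + 1) → ℝ | ∑ i, x i ^ 2 ≤ 1} =
      {x : Fin (D + 1) → ℝ | ∑ i, x i ^ 2 ≤ 1} := by
    ext x
    have := mulVec_dotProduct_mulVec_of_transpose_mul_eq_one hQ' x x
    simp only [dotProduct, ← sq] at this
    rw [Set.mem_preimage, Set.mem_ofPred_eq, Set.mem_ofPred_eq, this]
  have key := (measurePreserving_mulVec_of_orthogonal hQ).setLIntegral_comp_preimage hB
    (f := fun a => ENNReal.ofReal ((φ ⬝ᵥ a) ^ (2 * k))) (by fun_prop)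
  rw [hpre] at key
  have h1 : ∀ a, (φ ⬝ᵥ Q *ᵥ a) ^ (2 * k) = (φ ⬝ᵥ φ) ^ k * a 0 ^ (2 * k) := by
    intro a
    rw [← hQe, mulVec_dotProduct_mulVec_of_transpose_mul_eq_one hQ', he, single_dotProduct, mul_pow,
      pow_mul √_, Real.sq_sqrt hφ, ← he, hQe]
  rw [← key]
  simp only [h1]
  have h2 : ∀ a : Fin (D + 1) → ℝ, ENNReal.ofReal ((φ ⬝ᵥ φ) ^ k * a 0 ^ (2 * k)) =
    ENNReal.ofReal ((φ ⬝ᵥ φ) ^ k) * ENNReal.ofReal (a 0 ^ (2 * k)) := fun a =>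
      ENNReal.ofReal_mul (by positivity)
  simp only [h2]
  rw [lintegral_const_mul' _ _ ENNReal.ofReal_ne_top, ENNReal.ofReal_mul (by positivity), mul_assoc]
  gcongr
  exact lintegral_coord_pow_le D k

lemma mem_unitSphere {d : ℕ} {x : Fin d → ℝ} : x ∈ unitSphere d ↔ x ⬝ᵥ x = 1 := by
  simp only [unitSphere, dotProduct, ← sq]; exact Iff.rfl

lemma isCompact_unitSphere (d : ℕ) : IsCompact (unitSphere d) := by
  have h : unitSphere d ⊆ {x : Fin d → ℝ | ∑ i, x i ^ 2 ≤ (1 : ℝ)} := fun x hx => le_of_eq hx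
  have h1 := isCompact_sum_sq_le d 1
  refine h1.of_isClosed_subset (isClosed_eq (by fun_prop) continuous_const) ?_
  intro x hx
  have : ∑ i, x i ^ 2 = 1 := hx
  simp [this]

namespace IsSphereMeasure

variable {d : ℕ} {σ : Measure (Fin d → ℝ)}

lemma ae_mem (hσ : IsSphereMeasure d σ) : ∀ᵐ x ∂σ, x ∈ unitSphere d :=
  hσ.onSphere

lemma restrict_eq (hσ : IsSphereMeasure d σ) : σ.restrict (unitSphere d) = σ :=
  Measure.restrict_eq_self_of_ae_mem hσ.ae_mem

lemma integrable {E : Type*} [NormedAddCommGroup E] (hσ : IsSphereMeasure d σ) {f : (Fin d → ℝ) → E}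
    (hf : Continuous f) : Integrable f σ := by
  have := hσ.prob
  rw [← hσ.restrict_eq]
  exact hf.continuousOn.integrableOn_compact (isCompact_unitSphere d)

lemma integrable_prod {d' : ℕ} {σ' : Measure (Fin d' → ℝ)} (hσ : IsSphereMeasure d σ)
    (hσ' : IsSphereMeasure d' σ') {f : (Fin d → ℝ) × (Fin d' → ℝ) → ℝ} (hf : Continuous f) :
    Integrable f (σ.prod σ') := by
  have := hσ.prob
  have := hσ'.prob
  rw [← hσ.restrict_eq, ← hσ'.restrict_eq, Measure.prod_restrict]
  exact hf.continuousOn.integrableOn_compact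
    ((isCompact_unitSphere d).prod (isCompact_unitSphere d'))

lemma measurePreserving (hσ : IsSphereMeasure d σ) {Q : Matrix (Fin d) (Fin d) ℝ}
    (hQ : Q * Qᵀ = 1) : MeasurePreserving Q.mulVec σ σ :=
  ⟨Continuous.measurable (by fun_prop), hσ.invariant Q hQ⟩

lemma integral_comp_mulVec (hσ : IsSphereMeasure d σ) {Q : Matrix (Fin d) (Fin d) ℝ}
    (hQ : Q * Qᵀ = 1) {f : (Fin d → ℝ) → ℝ} (hf : Continuous f) :
    ∫ x, f (Q *ᵥ x) ∂σ = ∫ x, f x ∂σ := by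
  conv_rhs => rw [← hσ.invariant Q hQ]
  rw [integral_map (Continuous.aemeasurable (by fun_prop)) hf.aestronglyMeasurable]

lemma integral_congr (hσ : IsSphereMeasure d σ) {f g : (Fin d → ℝ) → ℝ}
    (h : ∀ x, x ⬝ᵥ x = 1 → f x = g x) : ∫ x, f x ∂σ = ∫ x, g x ∂σ :=
  integral_congr_ae (hσ.ae_mem.mono fun x hx => h x (mem_unitSphere.1 hx))

lemma integral_mono (hσ : IsSphereMeasure d σ) {f g : (Fin d → ℝ) → ℝ} (hf : Continuous f)
    (hg : Continuous g) (h : ∀ x, x ⬝ᵥ x = 1 → f x ≤ g x) : ∫ x, f x ∂σ ≤ ∫ x, g x ∂σ :=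
  integral_mono_ae (hσ.integrable hf) (hσ.integrable hg)
    (hσ.ae_mem.mono fun x hx => h x (mem_unitSphere.1 hx))

lemma integral_dotProduct_pow_four (hσ : IsSphereMeasure d σ) {u v : Fin d → ℝ}
    (h : u ⬝ᵥ u = v ⬝ᵥ v) : ∫ x, (u ⬝ᵥ x) ^ 4 ∂σ = ∫ x, (v ⬝ᵥ x) ^ 4 ∂σ := by
  obtain ⟨Q, hQ, hQ', rfl⟩ := exists_orthogonal_mulVec_eq h
  rw [← hσ.integral_comp_mulVec hQ (f := fun x => ((Q *ᵥ u) ⬝ᵥ x) ^ 4) (by fun_prop)]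
  simp only [mulVec_dotProduct_mulVec_of_transpose_mul_eq_one hQ']

lemma integral_sq_mul_sq (hσ : IsSphereMeasure d σ) (i j : Fin d) :
    ∫ x, x i ^ 2 * x j ^ 2 ∂σ = (if i = j then 3 else 1) / (d * (d + 2)) := by
  have hprob := hσ.prob
  have hd : (0 : ℝ) < d := by
    have := i.pos
    exact_mod_cast this
  set p := ∫ x, x i ^ 4 ∂σ with hp
  have h1 : ∀ k, ∫ x, x k ^ 4 ∂σ = p := fun k => by
    have := hσ.integral_dotProduct_pow_four (u := Pi.single k 1) (v := Pi.single i 1) (by simp)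
    simpa using this
  have h2 : ∀ k l, ∫ x, x k ^ 2 * x l ^ 2 ∂σ = if k = l then p else p / 3 := by
    intro k l
    split_ifs with hkl
    · subst hkl
      rw [← h1 k]; congr 1; ext x; ring
    · have ha := hσ.integral_dotProduct_pow_four (u := Pi.single k 1 + Pi.single l 1)
        (v := Pi.single i √2) (by
          simp [dotProduct_add, hkl, Ne.symm hkl]; norm_num)
      have hb := hσ.integral_dotProduct_pow_four (u := Pi.single k 1 - Pi.single l 1)
        (v := Pi.single i √2) (by
          simp [dotProduct_sub, hkl, Ne.symm hkl]; norm_num)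
      have h4 : (√2 : ℝ) ^ 4 = 4 := by
        rw [show (4 : ℕ) = 2 * 2 by norm_num, pow_mul, Real.sq_sqrt (by norm_num)]; norm_num
      simp only [add_dotProduct, sub_dotProduct, single_dotProduct, one_mul, mul_pow, h4,
        integral_const_mul] at ha hb
      have hc : ∫ x, x k ^ 2 * x l ^ 2 ∂σ =
          ∫ x, ((1 / 12 : ℝ) * (x k + x l) ^ 4 + (1 / 12 : ℝ) * (x k - x l) ^ 4) - (1 / 6 *
            x k ^ 4 + 1 / 6 * x l ^ 4) ∂σ := by
        congr 1; ext x; ring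
      rw [hc, integral_sub (hσ.integrable (by fun_prop)) (hσ.integrable (by fun_prop)),
        integral_add (hσ.integrable (by fun_prop)) (hσ.integrable (by fun_prop)),
        integral_add (hσ.integrable (by fun_prop)) (hσ.integrable (by fun_prop))]
      simp only [integral_const_mul, ha, hb, h1]
      ring
  have h3 : ∑ k, ∑ l, ∫ x, x k ^ 2 * x l ^ 2 ∂σ = 1 := by
    have : ∑ k, ∑ l, ∫ x, x k ^ 2 * x l ^ 2 ∂σ = ∫ x, (∑ k, x k ^ 2) * ∑ l, x l ^ 2 ∂σ := by
      simp only [Finset.sum_mul_sum]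
      rw [integral_finsetSum _ fun k _ => hσ.integrable (by fun_prop)]
      refine Finset.sum_congr rfl fun k _ => ?_
      rw [integral_finsetSum _ fun k _ => hσ.integrable (by fun_prop)]
    rw [this, hσ.integral_congr (g := fun _ => 1)]
    · simp
    · intro x hx
      have : ∑ i, x i ^ 2 = 1 := mem_unitSphere.2 hx
      simp [this]
  simp only [h2] at h3
  have h5 : ∀ k : Fin d, ∑ l, (if k = l then p else p / 3) = p + (d - 1) * (p / 3) := by
    intro k
    have : ∀ l, (if k = l then p else p / 3) = (if k = l then p - p / 3 else 0) + p / 3 := by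
      intro l; split_ifs <;> ring
    simp only [this, Finset.sum_add_distrib, Finset.sum_ite_eq, Finset.mem_univ, if_true,
      Finset.sum_const, Finset.card_univ, Fintype.card_fin, nsmul_eq_mul]
    ring
  simp only [h5, Finset.sum_const, Finset.card_univ, Fintype.card_fin, nsmul_eq_mul] at h3
  have hp3 : p = 3 / (d * (d + 2)) := by
    rw [eq_div_iff (by positivity)]
    linarith
  rw [h2, hp3]
  split_ifs
  · rfl
  · field_simp

lemma integral_quadratic_sq (hσ : IsSphereMeasure d σ) {S : Matrix (Fin d) (Fin d) ℝ}
    (hS : Sᵀ = S) :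
    ∫ x, (x ⬝ᵥ S *ᵥ x) ^ 2 ∂σ = (2 * (S * S).trace + S.trace ^ 2) / (d * (d + 2)) := by
  obtain ⟨U, l, hU, hU', rfl, -⟩ := exists_orthogonal_diagonalization hS
  have hq : ∀ x, (x ⬝ᵥ (U * Matrix.diagonal l * Uᵀ) *ᵥ x) ^ 2 =
      (fun x : Fin d → ℝ => (∑ i, l i * x i ^ 2) ^ 2) (Uᵀ *ᵥ x) := by
    intro x
    rw [← Matrix.mulVec_mulVec, ← Matrix.mulVec_mulVec, Matrix.dotProduct_mulVec,
      ← Matrix.mulVec_transpose, dotProduct]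
    simp only [Matrix.mulVec_diagonal]
    congr 1
    exact Finset.sum_congr rfl fun i _ => by ring
  rw [integral_congr_ae (Filter.Eventually.of_forall hq),
    hσ.integral_comp_mulVec (by rw [Matrix.transpose_transpose, hU])
      (f := fun x : Fin d → ℝ => (∑ i, l i * x i ^ 2) ^ 2) (by fun_prop)]
  have htr : (U * Matrix.diagonal l * Uᵀ).trace = ∑ i, l i := by
    rw [Matrix.trace_mul_comm, ← mul_assoc, hU, one_mul, Matrix.trace_diagonal]
  have htr2 : (U * Matrix.diagonal l * Uᵀ * (U * Matrix.diagonal l * Uᵀ)).trace = ∑ i, l i ^ 2 := by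
    have : U * Matrix.diagonal l * Uᵀ * (U * Matrix.diagonal l * Uᵀ) =
        U * Matrix.diagonal l * (Uᵀ * U) * Matrix.diagonal l * Uᵀ := by simp only [mul_assoc]
    rw [this, hU, mul_one, Matrix.trace_mul_comm, ← mul_assoc, ← mul_assoc, hU, one_mul,
      Matrix.diagonal_mul_diagonal, Matrix.trace_diagonal]
    exact Finset.sum_congr rfl fun i _ => by ring
  rw [htr, htr2]
  have h1 : ∀ x : Fin d → ℝ, (∑ i, l i * x i ^ 2) ^ 2 =
      ∑ i, ∑ j, l i * l j * (x i ^ 2 * x j ^ 2) := by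
    intro x
    rw [sq, Finset.sum_mul_sum]
    exact Finset.sum_congr rfl fun i _ => Finset.sum_congr rfl fun j _ => by ring
  simp only [h1]
  rw [integral_finsetSum _ fun k _ => hσ.integrable (by fun_prop)]
  have h2 : ∀ i, ∫ x, ∑ j, l i * l j * (x i ^ 2 * x j ^ 2) ∂σ =
      (2 * l i ^ 2 + l i * ∑ j, l j) / (d * (d + 2)) := by
    intro i
    rw [integral_finsetSum _ fun k _ => hσ.integrable (by fun_prop)]
    simp only [integral_const_mul, hσ.integral_sq_mul_sq]
    have : ∀ j, l i * l j * ((if i = j then 3 else 1) / ((d : ℝ) * (d + 2))) =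
        ((if i = j then 2 * l i * l j else 0) + l i * l j) / ((d : ℝ) * (d + 2)) := by
      intro j; split_ifs <;> ring
    simp only [this, ← Finset.sum_div, Finset.sum_add_distrib, Finset.sum_ite_eq, Finset.mem_univ,
      if_true, ← Finset.mul_sum]
    ring
  simp only [h2, ← Finset.sum_div, Finset.sum_add_distrib, ← Finset.mul_sum, ← Finset.sum_mul]
  ring

lemma integral_quadratic_mul_quadratic (hσ : IsSphereMeasure d σ) {S T : Matrix (Fin d) (Fin d) ℝ}
    (hS : Sᵀ = S) (hT : Tᵀ = T) :
    ∫ x, (x ⬝ᵥ S *ᵥ x) * (x ⬝ᵥ T *ᵥ x) ∂σ =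
      (2 * (S * T).trace + S.trace * T.trace) / (d * (d + 2)) := by
  have h1 := hσ.integral_quadratic_sq (S := S + T) (by rw [Matrix.transpose_add, hS, hT])
  have h2 := hσ.integral_quadratic_sq hS
  have h3 := hσ.integral_quadratic_sq hT
  have h4 : ∀ x, (x ⬝ᵥ (S + T) *ᵥ x) ^ 2 = (x ⬝ᵥ S *ᵥ x) ^ 2 + (x ⬝ᵥ T *ᵥ x) ^ 2 +
      2 * ((x ⬝ᵥ S *ᵥ x) * (x ⬝ᵥ T *ᵥ x)) := by
    intro x; rw [Matrix.add_mulVec, dotProduct_add]; ring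
  simp only [h4] at h1
  rw [integral_add (hσ.integrable (by fun_prop)) (hσ.integrable (by fun_prop)),
    integral_add (hσ.integrable (by fun_prop)) (hσ.integrable (by fun_prop)), h2, h3,
    integral_const_mul] at h1
  have h5 : ((S + T) * (S + T)).trace = (S * S).trace + (T * T).trace + 2 * (S * T).trace := by
    rw [add_mul, mul_add, mul_add, Matrix.trace_add, Matrix.trace_add, Matrix.trace_add,
      Matrix.trace_mul_comm T S]
    ring
  rw [h5, Matrix.trace_add] at h1
  linear_combination h1 / 2

/-- A pointwise bound for quadratic forms taking equal values at two orthonormal vectors. -/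
lemma sq_quadratic_le (hσ : IsSphereMeasure d σ) {S : Matrix (Fin d) (Fin d) ℝ} (hS : Sᵀ = S)
    {u v : Fin d → ℝ} (hu : u ⬝ᵥ u = 1) (hv : v ⬝ᵥ v = 1) (huv : u ⬝ᵥ v = 0)
    (h : u ⬝ᵥ S *ᵥ u = v ⬝ᵥ S *ᵥ v) :
    (u ⬝ᵥ S *ᵥ u) ^ 2 ≤ (d : ℝ) ^ 2 / 4 * ∫ x, (x ⬝ᵥ S *ᵥ x) ^ 2 ∂σ := by
  have hd : (0 : ℝ) < d := by
    rcases Nat.eq_zero_or_pos d with rfl | hd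
    · simp at hu
    · exact_mod_cast hd
  set T : Matrix (Fin d) (Fin d) ℝ :=
    Matrix.vecMulVec u u +
      Matrix.vecMulVec v v - (2 / ((d : ℝ) + 2)) • (1 : Matrix (Fin d) (Fin d) ℝ) with hTdef
  have hT : Tᵀ = T := by
    simp [hTdef, Matrix.transpose_sub, Matrix.transpose_add, Matrix.transpose_vecMulVec]
  have htT : T.trace = 4 / (d + 2) := by
    simp only [hTdef, Matrix.trace_sub, Matrix.trace_add, Matrix.trace_vecMulVec, hu, hv,
      Matrix.trace_smul, Matrix.trace_one, Fintype.card_fin, smul_eq_mul]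
    field_simp; ring
  have htr : ∀ A : Matrix (Fin d) (Fin d) ℝ, (A * T).trace =
      u ⬝ᵥ A *ᵥ u + v ⬝ᵥ A *ᵥ v - 2 / (d + 2) * A.trace := by
    intro A
    simp only [hTdef, mul_sub, mul_add, Matrix.trace_sub, Matrix.trace_add, Matrix.mul_vecMulVec,
      Matrix.trace_vecMulVec, Matrix.mul_smul, Matrix.trace_smul, mul_one, smul_eq_mul]
    rw [dotProduct_comm (A *ᵥ u), dotProduct_comm (A *ᵥ v)]
  have hTu : u ⬝ᵥ T *ᵥ u = 1 - 2 / (d + 2) := by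
    simp [hTdef, Matrix.sub_mulVec, Matrix.add_mulVec, Matrix.smul_mulVec, Matrix.vecMulVec_mulVec,
      dotProduct_sub, hu, huv, dotProduct_comm v u]
  have hTv : v ⬝ᵥ T *ᵥ v = 1 - 2 / (d + 2) := by
    simp [hTdef, Matrix.sub_mulVec, Matrix.add_mulVec, Matrix.smul_mulVec, Matrix.vecMulVec_mulVec,
      dotProduct_sub, hv, huv]
  set s := u ⬝ᵥ S *ᵥ u with hs
  set I := ∫ x, (x ⬝ᵥ S *ᵥ x) ^ 2 ∂σ with hI
  have h2 := hσ.integral_quadratic_mul_quadratic hS hT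
  rw [htr, htT, ← h] at h2
  have h3 := hσ.integral_quadratic_sq hT
  rw [htr, hTu, hTv, htT] at h3
  have h4 : ∀ c : ℝ, 0 ≤ I - 2 * c * (4 * s / (d * (d + 2))) + c ^ 2 * (4 / (d + 2) ^ 2) := by
    intro c
    have h5 : 0 ≤ ∫ x, ((x ⬝ᵥ S *ᵥ x) ^ 2 - 2 * c * ((x ⬝ᵥ S *ᵥ x) * (x ⬝ᵥ T *ᵥ x))) +
        c ^ 2 * (x ⬝ᵥ T *ᵥ x) ^ 2 ∂σ := by
      refine integral_nonneg fun x => ?_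
      have : 0 ≤ ((x ⬝ᵥ S *ᵥ x) - c * (x ⬝ᵥ T *ᵥ x)) ^ 2 := sq_nonneg _
      simp only [Pi.zero_apply]
      linarith
    rw [integral_add (hσ.integrable (by fun_prop)) (hσ.integrable (by fun_prop)),
      integral_sub (hσ.integrable (by fun_prop)) (hσ.integrable (by fun_prop)),
      integral_const_mul, integral_const_mul, h2, h3, ← hI] at h5
    refine le_of_le_of_eq h5 ?_
    field_simp
    ring
  have h6 := h4 (s * (d + 2) / d)
  have h7 : I - 2 * (s * (d + 2) / d) * (4 * s / (d * (d + 2))) + (s * (d + 2) / d) ^ 2 *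
    (4 / (d + 2) ^ 2) =
      I - 4 * s ^ 2 / d ^ 2 := by field_simp; ring
  rw [h7, sub_nonneg, div_le_iff₀ (by positivity)] at h6
  linarith

end IsSphereMeasure

namespace IsSphereMeasure

variable {d : ℕ} {σ : Measure (Fin d → ℝ)}

lemma exists_sq_sum_le (hσ : IsSphereMeasure d σ) {ι : Type*} [Fintype ι]
    {m : ι → (Fin d → ℝ) → ℝ} (hm : ∀ i, Continuous (m i)) :
    ∃ x₁, x₁ ⬝ᵥ x₁ = 1 ∧ ∀ c : ι → ℝ,
      (∑ i, c i * m i x₁) ^ 2 ≤ Fintype.card ι * ∫ x, (∑ i, c i * m i x) ^ 2 ∂σ := by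
  classical
  have hprob := hσ.prob
  set Γ : Matrix ι ι ℝ := Matrix.of fun i j => ∫ x, m i x * m j x ∂σ with hΓ
  have hΓt : Γᵀ = Γ := by
    ext i j
    simp only [hΓ, Matrix.transpose_apply, Matrix.of_apply, mul_comm]
  obtain ⟨U, l, hU, hU', hUΓ, -⟩ := exists_orthogonal_diagonalization hΓt
  set h : ι → (Fin d → ℝ) → ℝ := fun k x => ∑ i, U i k * m i x with hh
  have hhc : ∀ k, Continuous (h k) := fun k => by fun_prop
  have hint : ∀ b c : ι → ℝ, ∫ x, (∑ i, b i * m i x) * (∑ i, c i * m i x) ∂σ = b ⬝ᵥ Γ *ᵥ c := by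
    intro b c
    simp only [Finset.sum_mul_sum]
    simp only [dotProduct, Matrix.mulVec, Finset.mul_sum]
    rw [integral_finsetSum _ fun k _ => hσ.integrable (by fun_prop)]
    refine Finset.sum_congr rfl fun i _ => ?_
    rw [integral_finsetSum _ fun k _ => hσ.integrable (by fun_prop)]
    refine Finset.sum_congr rfl fun j _ => ?_
    rw [hΓ, Matrix.of_apply, mul_comm _ (c j), ← mul_assoc, ← integral_const_mul]
    congr 1; ext x; ring
  have hΓb : ∀ b : ι → ℝ, b ⬝ᵥ Γ *ᵥ b = ∑ k, l k * (Uᵀ *ᵥ b) k ^ 2 := by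
    intro b
    rw [hUΓ, ← Matrix.mulVec_mulVec, ← Matrix.mulVec_mulVec, Matrix.dotProduct_mulVec,
      ← Matrix.mulVec_transpose, dotProduct]
    simp only [Matrix.mulVec_diagonal]
    exact Finset.sum_congr rfl fun i _ => by ring
  have hl : ∀ k, ∫ x, h k x ^ 2 ∂σ = l k := by
    intro k
    have h1 := hint (fun i => U i k) (fun i => U i k)
    rw [hΓb] at h1
    have h2 : Uᵀ *ᵥ (fun i => U i k) = Pi.single k 1 := by
      ext j
      have := congrFun (congrFun hU j) k
      rw [Matrix.mul_apply, Matrix.one_apply] at this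
      simp only [Matrix.mulVec, dotProduct, Pi.single_apply]
      exact this
    rw [h2] at h1
    simp only [← sq] at h1
    simpa [Pi.single_apply] using h1
  have hl0 : ∀ k, 0 ≤ l k := fun k => by rw [← hl]; exact integral_nonneg fun x => sq_nonneg _
  have hzero : ∀ᵐ x ∂σ, ∀ k, l k = 0 → h k x = 0 := by
    rw [ae_all_iff]
    intro k
    by_cases hk : l k = 0
    · have h1 : (fun x => h k x ^ 2) =ᵐ[σ] 0 := by
        rw [← integral_eq_zero_iff_of_nonneg (fun x => sq_nonneg _) (hσ.integrable ((hhc k).pow 2)),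
          hl, hk]
      filter_upwards [h1] with x hx _
      exact pow_eq_zero_iff two_ne_zero |>.1 hx
    · exact Filter.Eventually.of_forall fun x h => absurd h hk
  have hG : ∫ x, ∑ k, h k x ^ 2 / l k ∂σ ≤ Fintype.card ι := by
    rw [integral_finsetSum _ fun k _ => hσ.integrable (by fun_prop)]
    simp only [integral_div, hl]
    refine le_trans (Finset.sum_le_sum fun k _ => div_self_le_one (l k)) (by simp)
  have hae := hσ.ae_mem.and hzero
  obtain ⟨x₁, hx₁, hx₁G⟩ := exists_notMem_null_le_integral
    (f := fun x => ∑ k, h k x ^ 2 / l k) (hσ.integrable (by fun_prop)) (ae_iff.1 hae)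
  have hx₁' : x₁ ∈ unitSphere d ∧ ∀ k, l k = 0 → h k x₁ = 0 := by
    by_contra hcon; exact hx₁ hcon
  refine ⟨x₁, mem_unitSphere.1 hx₁'.1, fun c => ?_⟩
  have h1 : ∫ x, (∑ i, c i * m i x) ^ 2 ∂σ = ∑ k, l k * (Uᵀ *ᵥ c) k ^ 2 := by
    rw [← hΓb, ← hint]
    simp only [sq]
  have h2 : ∑ i, c i * m i x₁ = ∑ k, (Uᵀ *ᵥ c) k * h k x₁ := by
    have h3 : (∑ k, (Uᵀ *ᵥ c) k * h k x₁) = (Uᵀ *ᵥ c) ⬝ᵥ (Uᵀ *ᵥ fun i => m i x₁) := rfl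
    rw [h3, mulVec_dotProduct_mulVec_of_transpose_mul_eq_one
      (by rw [Matrix.transpose_transpose, hU'])]
    rfl
  have h4 : ∀ k, (Uᵀ *ᵥ c) k * h k x₁ = ((Uᵀ *ᵥ c) k * √(l k)) * (h k x₁ / √(l k)) := by
    intro k
    rcases (hl0 k).eq_or_lt with h0 | h0
    · rw [hx₁'.2 k h0.symm]; simp
    · have := (Real.sqrt_pos.2 h0).ne'
      field_simp
  rw [h1, h2, Finset.sum_congr rfl fun k _ => h4 k, mul_comm]
  refine (Finset.sum_mul_sq_le_sq_mul_sq _ _ _).trans ?_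
  have h5 : ∑ k, ((Uᵀ *ᵥ c) k * √(l k)) ^ 2 = ∑ k, l k * (Uᵀ *ᵥ c) k ^ 2 :=
    Finset.sum_congr rfl fun k _ => by rw [mul_pow, Real.sq_sqrt (hl0 k), mul_comm]
  have h6 : ∑ k, (h k x₁ / √(l k)) ^ 2 = ∑ k, h k x₁ ^ 2 / l k :=
    Finset.sum_congr rfl fun k _ => by rw [div_pow, Real.sq_sqrt (hl0 k)]
  rw [h5, h6]
  exact mul_le_mul_of_nonneg_left (hx₁G.trans hG)
    (Finset.sum_nonneg fun k _ => mul_nonneg (hl0 k) (sq_nonneg _))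

/-- A homogeneous polynomial on the sphere is bounded by its `L²` norm times the square root of the
dimension of the space of homogeneous polynomials of the same degree. -/
lemma sq_eval_le_of_isHomogeneous (hσ : IsSphereMeasure d σ) {j : ℕ} {p : MvPolynomial (Fin d) ℝ}
    (hp : p.IsHomogeneous j) {x₀ : Fin d → ℝ} (hx₀ : x₀ ⬝ᵥ x₀ = 1) :
    (eval x₀ p) ^ 2 ≤ ((d + j - 1).choose j : ℕ) * ∫ x, (eval x p) ^ 2 ∂σ := by
  classical
  obtain ⟨x₁, hx₁, h⟩ := hσ.exists_sq_sum_le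
    (m := fun (α : (Finset.univ : Finset (Fin d)).finsuppAntidiag j) x => ∏ i, x i ^ (α.1 i))
    (fun α => by fun_prop)
  obtain ⟨Q, hQ, hQ', rfl⟩ := exists_orthogonal_mulVec_eq (hx₁.trans hx₀.symm)
  set q : MvPolynomial (Fin d) ℝ := aeval (fun i => ∑ k, C (Q i k) * X k) p with hq
  have hqh : q.IsHomogeneous j := by
    have := hp.aeval (fun i => ∑ k, C (Q i k) * X k)
      (fun i => IsHomogeneous.sum _ _ 1 fun k _ => isHomogeneous_C_mul_X _ _)
    rwa [one_mul] at this
  have hqe : ∀ x, eval x q = eval (Q *ᵥ x) p := by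
    intro x
    rw [hq, ← coe_aeval_eq_eval, ← coe_aeval_eq_eval, RingHom.coe_coe, RingHom.coe_coe,
      ← AlgHom.comp_apply, comp_aeval]
    congr 2
    ext i
    simp [Matrix.mulVec, dotProduct]
  have hqs : ∀ x, eval x q = ∑ α : (Finset.univ : Finset (Fin d)).finsuppAntidiag j,
      coeff α.1 q * ∏ i, x i ^ (α.1 i) := by
    intro x
    rw [eval_eq', Finset.sum_coe_sort ((Finset.univ : Finset (Fin d)).finsuppAntidiag j)
      (fun α => coeff α q * ∏ i, x i ^ (α i))]
    refine Finset.sum_subset (fun α hα => ?_) (fun α _ hα => ?_)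
    · rw [Finset.mem_finsuppAntidiag]
      refine ⟨?_, Finset.subset_univ _⟩
      by_contra hne
      refine mem_support_iff.1 hα (hqh.coeff_eq_zero ?_)
      rwa [Finsupp.degree_eq_sum]
    · rw [notMem_support_iff.1 hα, zero_mul]
  have := h (fun α => coeff α.1 q)
  simp only [← hqs, hqe] at this
  rw [hσ.integral_comp_mulVec hQ (f := fun x => eval x p ^ 2)
      ((MvPolynomial.continuous_eval p).pow 2), Fintype.card_coe,
    Finset.card_finsuppAntidiag_nat_eq_choose, Finset.card_univ, Fintype.card_fin] at this
  exact this

lemma quadratic_pow_le (hσ : IsSphereMeasure d σ) (S : Matrix (Fin d) (Fin d) ℝ) (k : ℕ)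
    {x₀ : Fin d → ℝ} (hx₀ : x₀ ⬝ᵥ x₀ = 1) :
    (x₀ ⬝ᵥ S *ᵥ x₀) ^ (2 * k) ≤
      ((d + 2 * k - 1).choose (2 * k) : ℕ) * ∫ x, (x ⬝ᵥ S *ᵥ x) ^ (2 * k) ∂σ := by
  set p : MvPolynomial (Fin d) ℝ := ∑ i, ∑ j, C (S i j) * X i * X j with hp
  have hph : p.IsHomogeneous 2 :=
    IsHomogeneous.sum _ _ _ fun i _ => IsHomogeneous.sum _ _ _ fun j _ =>
    (isHomogeneous_C_mul_X _ _).mul (isHomogeneous_X _ _)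
  have hpe : ∀ x, eval x p = x ⬝ᵥ S *ᵥ x := by
    intro x
    simp only [hp, map_sum, map_mul, eval_C, eval_X, dotProduct, Matrix.mulVec, Finset.mul_sum]
    exact Finset.sum_congr rfl fun i _ => Finset.sum_congr rfl fun j _ => by ring
  have := hσ.sq_eval_le_of_isHomogeneous (hph.pow k) hx₀
  simpa only [map_pow, hpe, ← pow_mul, mul_comm k 2] using this

end IsSphereMeasure

/-- The complex coordinates of a real vector in `ℝ²ⁿ`. -/
def cz {n : ℕ} (x : Fin (2 * n) → ℝ) (i : Fin n) : ℂ :=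
  x (finProdFinEquiv (0, i)) + x (finProdFinEquiv (1, i)) * Complex.I

/-- Functions that are evaluations of symmetric multiforms of multidegree `(1,1,1,1)`. -/
def HermEval (n m : ℕ) (isR : Bool) (F : (Fin (2 * n) → ℝ) → (Fin (2 * m) → ℝ) → ℝ) : Prop :=
  ∃ a : Fin n → Fin n → Fin m → Fin m → ℂ,
    (∀ i j k l, a i j k l = conj (a j i l k)) ∧
    (isR = true → ∀ i j k l, (a i j k l).im = 0) ∧
    ∀ x y, (F x y : ℂ) =
      ∑ i, ∑ j, ∑ k, ∑ l, a i j k l * conj (cz x i) * cz x j * conj (cz y k) * cz y l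

lemma eval_Zv {n m : ℕ} (x : Fin (2 * n) → ℝ) (y : Fin (2 * m) → ℝ) (i : Fin n) :
    eval (fun p => ((Sum.elim x y p : ℝ) : ℂ)) (Zv n m i) = cz x i := by
  simp only [Zv, zRe, zIm, cz, map_add, map_mul, eval_X, eval_C, Sum.elim_inl]
  have h0 : (finProdFinEquiv (0, i) : Fin (2 * n)) = ⟨i.1, by have := i.2; omega⟩ := by
    apply Fin.ext; simp [finProdFinEquiv]
  have h1 : (finProdFinEquiv (1, i) : Fin (2 * n)) = ⟨n + i.1, by have := i.2; omega⟩ := by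
    apply Fin.ext; simp [finProdFinEquiv]; ring
  rw [h0, h1]; ring

lemma eval_Wv {n m : ℕ} (x : Fin (2 * n) → ℝ) (y : Fin (2 * m) → ℝ) (i : Fin m) :
    eval (fun p => ((Sum.elim x y p : ℝ) : ℂ)) (Wv n m i) = cz y i := by
  simp only [Wv, wRe, wIm, cz, map_add, map_mul, eval_X, eval_C, Sum.elim_inr]
  have h0 : (finProdFinEquiv (0, i) : Fin (2 * m)) = ⟨i.1, by have := i.2; omega⟩ := by
    apply Fin.ext; simp [finProdFinEquiv]
  have h1 : (finProdFinEquiv (1, i) : Fin (2 * m)) = ⟨m + i.1, by have := i.2; omega⟩ := by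
    apply Fin.ext; simp [finProdFinEquiv]; ring
  rw [h0, h1]; ring

lemma eval_Zc {n m : ℕ} (x : Fin (2 * n) → ℝ) (y : Fin (2 * m) → ℝ) (i : Fin n) :
    eval (fun p => ((Sum.elim x y p : ℝ) : ℂ)) (Zc n m i) = conj (cz x i) := by
  rw [← eval_Zv x y]
  simp [Zv, Zc, zRe, zIm, sub_eq_add_neg]

lemma eval_Wc {n m : ℕ} (x : Fin (2 * n) → ℝ) (y : Fin (2 * m) → ℝ) (i : Fin m) :
    eval (fun p => ((Sum.elim x y p : ℝ) : ℂ)) (Wc n m i) = conj (cz y i) := by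
  rw [← eval_Wv x y]
  simp [Wv, Wc, wRe, wIm, sub_eq_add_neg]

lemma eval_herm {n m : ℕ} (a : Fin n → Fin n → Fin m → Fin m → ℂ) (x : Fin (2 * n) → ℝ)
    (y : Fin (2 * m) → ℝ) :
    eval (fun p => ((Sum.elim x y p : ℝ) : ℂ)) (herm n m a) =
      ∑ i, ∑ j, ∑ k, ∑ l, a i j k l * conj (cz x i) * cz x j * conj (cz y k) * cz y l := by
  simp only [herm, map_sum, map_mul, eval_C, eval_Zv, eval_Zc, eval_Wv, eval_Wc]

lemma eval_map_algebraMap {n m : ℕ} (f : MvPolynomial (Fin n ⊕ Fin m) ℝ) (x : Fin n → ℝ)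
    (y : Fin m → ℝ) :
    eval (fun p => ((Sum.elim x y p : ℝ) : ℂ)) (MvPolynomial.map (algebraMap ℝ ℂ) f) =
      (beval f x y : ℂ) := by
  rw [eval_map]
  exact (eval₂_comp_left (algebraMap ℝ ℂ) (RingHom.id ℝ) (Sum.elim x y) f).symm

lemma eq_of_eval_ofReal_eq {ι : Type*} {p q : MvPolynomial ι ℂ}
    (h : ∀ x : ι → ℝ, eval (fun i => (x i : ℂ)) p = eval (fun i => (x i : ℂ)) q) : p = q := by
  refine MvPolynomial.funext_set (fun _ => Set.range ((↑) : ℝ → ℂ))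
    (fun _ => Set.infinite_range_of_injective Complex.ofReal_injective) fun x hx => ?_
  choose z hz using fun i => hx i (Set.mem_univ i)
  rw [← funext hz]
  exact h z

lemma mem_CF_iff {n m : ℕ} {isR : Bool} {f : MvPolynomial (Fin (2 * n) ⊕ Fin (2 * m)) ℝ} :
    f ∈ CF n m isR ↔ HermEval n m isR (beval f) := by
  constructor
  · rintro ⟨a, ha, hR, h⟩
    refine ⟨a, ha, hR, fun x y => ?_⟩
    rw [← eval_map_algebraMap, h, eval_herm]
  · rintro ⟨a, ha, hR, h⟩
    refine ⟨a, ha, hR, eq_of_eval_ofReal_eq fun z => ?_⟩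
    have := h (fun i => z (Sum.inl i)) (fun i => z (Sum.inr i))
    rw [← eval_map_algebraMap, ← eval_herm] at this
    have hz : Sum.elim (fun i => z (Sum.inl i)) (fun i => z (Sum.inr i)) = z :=
      Sum.elim_comp_inl_inr z
    rwa [hz] at this

lemma sum_sq_eq_sum_normSq {n : ℕ} (x : Fin (2 * n) → ℝ) :
    ((x ⬝ᵥ x : ℝ) : ℂ) = ∑ i, conj (cz x i) * cz x i := by
  simp only [dotProduct]
  rw [← finProdFinEquiv.sum_comp, Fintype.sum_prod_type_right, Complex.ofReal_sum]
  refine Finset.sum_congr rfl fun i _ => ?_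
  rw [← Complex.normSq_eq_conj_mul_self, Fin.sum_univ_two]
  simp [cz, Complex.normSq_apply]

namespace HermEval

variable {n m : ℕ} {isR : Bool} {F G : (Fin (2 * n) → ℝ) → (Fin (2 * m) → ℝ) → ℝ}

lemma swap (h : HermEval n m isR F) : HermEval m n isR fun y x => F x y := by
  obtain ⟨a, ha, hR, h⟩ := h
  refine ⟨fun k l i j => a i j k l, fun k l i j => ha i j k l, fun hr k l i j => hR hr i j k l,
    fun y x => ?_⟩
  rw [h x y]
  calc _ = ∑ i, ∑ k, ∑ j, ∑ l, a i j k l * conj (cz y k) * cz y l * conj (cz x i) * cz x j := by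
        refine Finset.sum_congr rfl fun i _ => ?_
        rw [Finset.sum_comm]
        refine Finset.sum_congr rfl fun j _ => Finset.sum_congr rfl fun k _ =>
          Finset.sum_congr rfl fun l _ => by ring
    _ = ∑ i, ∑ k, ∑ l, ∑ j, a i j k l * conj (cz y k) * cz y l * conj (cz x i) * cz x j :=
        Finset.sum_congr rfl fun i _ => Finset.sum_congr rfl fun k _ => Finset.sum_comm
    _ = ∑ k, ∑ i, ∑ l, ∑ j, a i j k l * conj (cz y k) * cz y l * conj (cz x i) * cz x j :=
        Finset.sum_comm
    _ = _ := Finset.sum_congr rfl fun k _ => Finset.sum_comm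

lemma add (hF : HermEval n m isR F) (hG : HermEval n m isR G) :
    HermEval n m isR fun x y => F x y + G x y := by
  obtain ⟨a, ha, hR, h⟩ := hF
  obtain ⟨a', ha', hR', h'⟩ := hG
  refine ⟨fun i j k l => a i j k l + a' i j k l, fun i j k l => ?_, fun hr i j k l => ?_,
    fun x y => ?_⟩
  · rw [map_add, ← ha, ← ha']
  · rw [Complex.add_im, hR hr, hR' hr, add_zero]
  · rw [Complex.ofReal_add, h, h']
    simp only [← Finset.sum_add_distrib, add_mul]

lemma dotProduct_mul_dotProduct (n m : ℕ) (isR : Bool) :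
    HermEval n m isR fun x y => (x ⬝ᵥ x) * (y ⬝ᵥ y) := by
  refine ⟨fun i j k l => if i = j ∧ k = l then 1 else 0, fun i j k l => ?_, fun hr i j k l => ?_,
    fun x y => ?_⟩
  · simp only [apply_ite conj, map_one, map_zero, eq_comm]
  · dsimp only
    split_ifs <;> simp
  · rw [Complex.ofReal_mul, sum_sq_eq_sum_normSq, sum_sq_eq_sum_normSq, Finset.sum_mul_sum]
    refine Finset.sum_congr rfl fun i _ => ?_
    simp only [ite_and, ite_mul, one_mul, zero_mul]
    rw [Finset.sum_comm]
    simp [Finset.sum_ite_irrel]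
    exact Finset.sum_congr rfl fun k _ => by ring

end HermEval

/-- The quadratic form of a matrix, as a linear map into functions. -/
def quadLin (d : ℕ) : Matrix (Fin d) (Fin d) ℝ →ₗ[ℝ] ((Fin d → ℝ) → ℝ) where
  toFun N x := x ⬝ᵥ N *ᵥ x
  map_add' M N := by ext x; simp [Matrix.add_mulVec, dotProduct_add]
  map_smul' c M := by ext x; simp [Matrix.smul_mulVec, dotProduct_smul]

lemma coord_mul_mem_range_quadLin {d : ℕ} (p q : Fin d) :
    (fun x : Fin d → ℝ => x p * x q) ∈ LinearMap.range (quadLin d) := by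
  refine ⟨Matrix.single p q 1, ?_⟩
  ext x
  simp [quadLin, Matrix.single_mulVec, dotProduct, Function.update_apply]

/-- The symmetric matrix of a quadratic form, obtained by polarization. -/
def quadMat {d : ℕ} (g : (Fin d → ℝ) → ℝ) : Matrix (Fin d) (Fin d) ℝ :=
  Matrix.of fun i j => (g (Pi.single i 1 + Pi.single j 1) - g (Pi.single i 1 - Pi.single j 1)) / 4

lemma quadMat_of_mem {d : ℕ} {g : (Fin d → ℝ) → ℝ} (hg : g ∈ LinearMap.range (quadLin d)) :
    ∃ N : Matrix (Fin d) (Fin d) ℝ, (∀ x, g x = x ⬝ᵥ N *ᵥ x) ∧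
      quadMat g = (1 / 2 : ℝ) • (N + Nᵀ) := by
  obtain ⟨N, rfl⟩ := hg
  refine ⟨N, fun x => rfl, ?_⟩
  ext i j
  simp only [quadMat, quadLin, LinearMap.coe_mk, AddHom.coe_mk, Matrix.of_apply,
    Matrix.mulVec_add, Matrix.mulVec_sub, add_dotProduct, dotProduct_add, sub_dotProduct,
    dotProduct_sub, Matrix.mulVec_single_one, single_one_dotProduct, Matrix.smul_apply,
    Matrix.add_apply, Matrix.transpose_apply, Matrix.col_apply, smul_eq_mul]
  ring

lemma quadMat_transpose {d : ℕ} {g : (Fin d → ℝ) → ℝ} (hg : g ∈ LinearMap.range (quadLin d)) :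
    (quadMat g)ᵀ = quadMat g := by
  obtain ⟨N, -, h⟩ := quadMat_of_mem hg
  rw [h, Matrix.transpose_smul, Matrix.transpose_add, Matrix.transpose_transpose, add_comm]

lemma dotProduct_quadMat_mulVec {d : ℕ} {g : (Fin d → ℝ) → ℝ}
    (hg : g ∈ LinearMap.range (quadLin d)) (x : Fin d → ℝ) : x ⬝ᵥ quadMat g *ᵥ x = g x := by
  obtain ⟨N, hN, h⟩ := quadMat_of_mem hg
  have : x ⬝ᵥ Nᵀ *ᵥ x = x ⬝ᵥ N *ᵥ x := by
    rw [Matrix.mulVec_transpose, Matrix.dotProduct_mulVec, dotProduct_comm]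
  rw [h, hN, Matrix.smul_mulVec, dotProduct_smul, Matrix.add_mulVec, dotProduct_add, this,
    smul_eq_mul]
  ring

lemma trace_quadMat {d : ℕ} {g : (Fin d → ℝ) → ℝ} (hg : g ∈ LinearMap.range (quadLin d)) :
    (quadMat g).trace = ∑ i, g (Pi.single i 1) := by
  refine Finset.sum_congr rfl fun i _ => ?_
  rw [← dotProduct_quadMat_mulVec hg]
  simp

/-- Multiplication by the imaginary unit on `ℝ²ⁿ = ℂⁿ`. -/
def mulI {n : ℕ} (x : Fin (2 * n) → ℝ) : Fin (2 * n) → ℝ := fun p =>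
  if (finProdFinEquiv.symm p).1 = 0 then -x (finProdFinEquiv (1, (finProdFinEquiv.symm p).2))
  else x (finProdFinEquiv (0, (finProdFinEquiv.symm p).2))

lemma cz_mulI {n : ℕ} (x : Fin (2 * n) → ℝ) (i : Fin n) : cz (mulI x) i = Complex.I * cz x i := by
  apply Complex.ext <;> simp [cz, mulI]

lemma dotProduct_mulI {n : ℕ} (x : Fin (2 * n) → ℝ) : x ⬝ᵥ mulI x = 0 := by
  simp only [dotProduct]
  rw [← finProdFinEquiv.sum_comp, Fintype.sum_prod_type_right]
  refine Finset.sum_eq_zero fun i _ => ?_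
  rw [Fin.sum_univ_two]
  simp [mulI]; ring

lemma mulI_dotProduct_mulI {n : ℕ} (x : Fin (2 * n) → ℝ) : mulI x ⬝ᵥ mulI x = x ⬝ᵥ x := by
  have h := sum_sq_eq_sum_normSq (mulI x)
  simp only [cz_mulI, map_mul, Complex.conj_I] at h
  have h2 : ∀ i, -Complex.I * conj (cz x i) * (Complex.I * cz x i) = conj (cz x i) * cz x i := by
    intro i
    linear_combination (-(conj (cz x i) * cz x i)) * Complex.I_mul_I
  simp only [h2, ← sum_sq_eq_sum_normSq] at h
  exact_mod_cast h

lemma continuous_cz {n : ℕ} (i : Fin n) : Continuous fun x : Fin (2 * n) → ℝ => cz x i := by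
  unfold cz; fun_prop

namespace HermEval

variable {n m : ℕ} {isR : Bool} {F G : (Fin (2 * n) → ℝ) → (Fin (2 * m) → ℝ) → ℝ}

lemma continuous (h : HermEval n m isR F) :
    Continuous fun p : (Fin (2 * n) → ℝ) × (Fin (2 * m) → ℝ) => F p.1 p.2 := by
  obtain ⟨a, -, -, h⟩ := h
  have hz : ∀ i, Continuous fun p : (Fin (2 * n) → ℝ) × (Fin (2 * m) → ℝ) => cz p.1 i :=
    fun i => (continuous_cz i).comp continuous_fst
  have hw : ∀ i, Continuous fun p : (Fin (2 * n) → ℝ) × (Fin (2 * m) → ℝ) => cz p.2 i :=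
    fun i => (continuous_cz i).comp continuous_snd
  have : Continuous fun p : (Fin (2 * n) → ℝ) × (Fin (2 * m) → ℝ) => (F p.1 p.2 : ℂ).re := by
    simp only [h]
    refine Complex.continuous_re.comp (continuous_finsetSum _ fun i _ =>
      continuous_finsetSum _ fun j _ => continuous_finsetSum _ fun k _ =>
      continuous_finsetSum _ fun l _ => ?_)
    have := hz i; have := hz j; have := hw k; have := hw l
    have := Complex.continuous_conj.comp (hz i)
    have := Complex.continuous_conj.comp (hw k)
    exact ((((continuous_const.mul (Complex.continuous_conj.comp (hz i))).mul (hz j)).mul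
      (Complex.continuous_conj.comp (hw k))).mul (hw l))
  simpa using this

lemma mulI_left (h : HermEval n m isR F) (x : Fin (2 * n) → ℝ) (y : Fin (2 * m) → ℝ) :
    F (mulI x) y = F x y := by
  obtain ⟨a, -, -, h⟩ := h
  have : (F (mulI x) y : ℂ) = F x y := by
    rw [h, h]
    refine Finset.sum_congr rfl fun i _ => Finset.sum_congr rfl fun j _ =>
      Finset.sum_congr rfl fun k _ => Finset.sum_congr rfl fun l _ => ?_
    rw [cz_mulI, cz_mulI, map_mul, Complex.conj_I]
    linear_combination
      (-(a i j k l * conj (cz x i) * cz x j * conj (cz y k) * cz y l)) * Complex.I_mul_I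
  exact_mod_cast this

lemma mem_range_quadLin (h : HermEval n m isR F) (y : Fin (2 * m) → ℝ) :
    (fun x => F x y) ∈ LinearMap.range (quadLin (2 * n)) := by
  obtain ⟨a, -, -, h⟩ := h
  have : (fun x => F x y) = ∑ i, ∑ j, ∑ k, ∑ l, fun x : Fin (2 * n) → ℝ =>
      (a i j k l * conj (cz x i) * cz x j * conj (cz y k) * cz y l).re := by
    ext x
    rw [← Complex.ofReal_re (F x y), h]
    simp only [Complex.re_sum, Finset.sum_apply]
  rw [this]
  refine Submodule.sum_mem _ fun i _ => Submodule.sum_mem _ fun j _ =>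
    Submodule.sum_mem _ fun k _ => Submodule.sum_mem _ fun l _ => ?_
  set c := a i j k l * (conj (cz y k) * cz y l) with hc
  have := Submodule.add_mem _
    (Submodule.smul_mem _ c.re (Submodule.add_mem _
      (coord_mul_mem_range_quadLin (finProdFinEquiv ((0 : Fin 2), i)) (finProdFinEquiv (0, j)))
      (coord_mul_mem_range_quadLin (finProdFinEquiv ((1 : Fin 2), i)) (finProdFinEquiv (1, j)))))
    (Submodule.smul_mem _ c.im (Submodule.sub_mem _
      (coord_mul_mem_range_quadLin (finProdFinEquiv ((1 : Fin 2), i)) (finProdFinEquiv (0, j)))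
      (coord_mul_mem_range_quadLin (finProdFinEquiv ((0 : Fin 2), i)) (finProdFinEquiv (1, j)))))
  convert this using 1
  ext x
  rw [show a i j k l * conj (cz x i) * cz x j * conj (cz y k) * cz y l =
    c * (conj (cz x i) * cz x j) by rw [hc]; ring]
  simp [cz, Complex.mul_re]
  ring

lemma sq_le (h : HermEval n m isR F) {σ : Measure (Fin (2 * n) → ℝ)}
    (hσ : IsSphereMeasure (2 * n) σ) {x : Fin (2 * n) → ℝ} (hx : x ⬝ᵥ x = 1)
    (y : Fin (2 * m) → ℝ) : (F x y) ^ 2 ≤ (n : ℝ) ^ 2 * ∫ x, (F x y) ^ 2 ∂σ := by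
  have hq := h.mem_range_quadLin y
  have := hσ.sq_quadratic_le (S := quadMat fun x => F x y) (quadMat_transpose hq) hx
    ((mulI_dotProduct_mulI x).trans hx) (dotProduct_mulI x)
    (by simp only [dotProduct_quadMat_mulVec hq, h.mulI_left])
  simp only [dotProduct_quadMat_mulVec hq] at this
  refine this.trans_eq ?_
  push_cast; ring

end HermEval

/-- A linear isometric parametrization, by `ℝ^D`, of evaluations of symmetric multiforms. -/
structure Family (n m : ℕ) (isR : Bool) (D : ℕ) (σ₁ : Measure (Fin (2 * n) → ℝ))
    (σ₂ : Measure (Fin (2 * m) → ℝ))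
    (e : (Fin D → ℝ) → (Fin (2 * n) → ℝ) → (Fin (2 * m) → ℝ) → ℝ) : Prop where
  sphere₁ : IsSphereMeasure (2 * n) σ₁
  sphere₂ : IsSphereMeasure (2 * m) σ₂
  herm : ∀ a, HermEval n m isR (e a)
  add : ∀ a b x y, e (a + b) x y = e a x y + e b x y
  smul : ∀ (c : ℝ) a x y, e (c • a) x y = c * e a x y
  ip : ∀ a b, ∫ x, ∫ y, e a x y * e b x y ∂σ₂ ∂σ₁ = a ⬝ᵥ b

namespace Family

variable {n m : ℕ} {isR : Bool} {D : ℕ} {σ₁ : Measure (Fin (2 * n) → ℝ)}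
  {σ₂ : Measure (Fin (2 * m) → ℝ)}
  {e : (Fin D → ℝ) → (Fin (2 * n) → ℝ) → (Fin (2 * m) → ℝ) → ℝ}

lemma ip_symm (h : Family n m isR D σ₁ σ₂ e) (a b : Fin D → ℝ) :
    ∫ y, ∫ x, e a x y * e b x y ∂σ₁ ∂σ₂ = a ⬝ᵥ b := by
  have := h.sphere₁.prob
  have := h.sphere₂.prob
  rw [← h.ip a b]
  refine (integral_integral_swap (f := fun x y => e a x y * e b x y) ?_).symm
  exact h.sphere₁.integrable_prod h.sphere₂ ((h.herm a).continuous.mul (h.herm b).continuous)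

lemma swap (h : Family n m isR D σ₁ σ₂ e) : Family m n isR D σ₂ σ₁ fun a y x => e a x y where
  sphere₁ := h.sphere₂
  sphere₂ := h.sphere₁
  herm a := (h.herm a).swap
  add a b y x := h.add a b x y
  smul c a y x := h.smul c a x y
  ip := h.ip_symm

lemma eval_eq_sum (h : Family n m isR D σ₁ σ₂ e) (a : Fin D → ℝ) (x : Fin (2 * n) → ℝ)
    (y : Fin (2 * m) → ℝ) : e a x y = ∑ p, a p * e (Pi.single p 1) x y := by
  let L : (Fin D → ℝ) →ₗ[ℝ] ℝ :=
    { toFun := fun a => e a x y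
      map_add' := fun a b => h.add a b x y
      map_smul' := fun c a => h.smul c a x y }
  have := L.pi_apply_eq_sum_univ a
  simp only [smul_eq_mul] at this
  refine this.trans (Finset.sum_congr rfl fun p _ => ?_)
  congr 1
  show e _ x y = e _ x y
  congr 1
  ext q
  simp [Pi.single_apply, eq_comm]

lemma neg (h : Family n m isR D σ₁ σ₂ e) (a : Fin D → ℝ) (x : Fin (2 * n) → ℝ)
    (y : Fin (2 * m) → ℝ) : e (-a) x y = -e a x y := by
  have := h.smul (-1) a x y
  simpa using this

lemma continuous (h : Family n m isR D σ₁ σ₂ e) :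
    Continuous fun p : (Fin D → ℝ) × (Fin (2 * n) → ℝ) × (Fin (2 * m) → ℝ) =>
      e p.1 p.2.1 p.2.2 := by
  simp only [fun p : (Fin D → ℝ) × (Fin (2 * n) → ℝ) × (Fin (2 * m) → ℝ) =>
    h.eval_eq_sum p.1 p.2.1 p.2.2]
  refine continuous_finsetSum _ fun p _ => ?_
  exact ((continuous_apply p).comp continuous_fst).mul ((h.herm _).continuous.comp continuous_snd)

lemma sq_le (h : Family n m isR D σ₁ σ₂ e) (a : Fin D → ℝ) {x : Fin (2 * n) → ℝ}
    {y : Fin (2 * m) → ℝ} (hx : x ⬝ᵥ x = 1) (hy : y ⬝ᵥ y = 1) :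
    (e a x y) ^ 2 ≤ ((n : ℝ) * m) ^ 2 * (a ⬝ᵥ a) := by
  have := h.sphere₁.prob
  have := h.sphere₂.prob
  have hc : Continuous fun p : (Fin (2 * n) → ℝ) × (Fin (2 * m) → ℝ) => (e a p.1 p.2) ^ 2 :=
    (h.herm a).continuous.pow 2
  have h1 : ∀ x : Fin (2 * n) → ℝ, (e a x y) ^ 2 ≤ (m : ℝ) ^ 2 * ∫ y, (e a x y) ^ 2 ∂σ₂ :=
    fun x => (h.herm a).swap.sq_le h.sphere₂ hy x
  have hint : Integrable (fun x => ∫ y, (e a x y) ^ 2 ∂σ₂) σ₁ :=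
    (h.sphere₁.integrable_prod h.sphere₂ hc).integral_prod_left
  calc (e a x y) ^ 2 ≤ (n : ℝ) ^ 2 * ∫ x, (e a x y) ^ 2 ∂σ₁ := (h.herm a).sq_le h.sphere₁ hx y
    _ ≤ (n : ℝ) ^ 2 * ∫ x, (m : ℝ) ^ 2 * ∫ y, (e a x y) ^ 2 ∂σ₂ ∂σ₁ := by
        refine mul_le_mul_of_nonneg_left ?_ (by positivity)
        refine integral_mono (h.sphere₁.integrable (hc.comp (by fun_prop : Continuous fun x => (x,
          y))))
          (hint.const_mul _) h1
    _ = _ := by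
        rw [integral_const_mul, ← h.ip a a]
        simp only [← sq]
        ring

/-- Parameters whose multiforms are bounded by one in absolute value on the product of spheres. -/
def supBall (e : (Fin D → ℝ) → (Fin (2 * n) → ℝ) → (Fin (2 * m) → ℝ) → ℝ) : Set (Fin D → ℝ) :=
  {a | ∀ x y, x ⬝ᵥ x = 1 → y ⬝ᵥ y = 1 → |e a x y| ≤ 1}

lemma isClosed_supBall (h : Family n m isR D σ₁ σ₂ e) : IsClosed (supBall e) := by
  simp only [supBall, Set.ofPred_forall]
  refine isClosed_iInter fun x => isClosed_iInter fun y => isClosed_iInter fun _ =>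
    isClosed_iInter fun _ => isClosed_le ?_ continuous_const
  exact (h.continuous.comp (by fun_prop : Continuous fun a : Fin D → ℝ => (a, x, y))).abs

lemma convex_supBall (h : Family n m isR D σ₁ σ₂ e) : Convex ℝ (supBall e) := by
  intro a ha b hb s t hs ht hst x y hx hy
  rw [h.add, h.smul, h.smul]
  have h1 := abs_le.1 (ha x y hx hy)
  have h2 := abs_le.1 (hb x y hx hy)
  rw [abs_le]
  constructor <;> nlinarith

lemma neg_mem_supBall (h : Family n m isR D σ₁ σ₂ e) {a : Fin D → ℝ} (ha : a ∈ supBall e) :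
    -a ∈ supBall e := by
  intro x y hx hy
  rw [h.neg, abs_neg]
  exact ha x y hx hy

lemma dotProduct_le_one_of_mem_supBall (h : Family n m isR D σ₁ σ₂ e) {a : Fin D → ℝ}
    (ha : a ∈ supBall e) : a ⬝ᵥ a ≤ 1 := by
  have := h.sphere₁.prob
  have := h.sphere₂.prob
  rw [← h.ip a a]
  have h1 : ∀ x : Fin (2 * n) → ℝ, x ⬝ᵥ x = 1 → ∫ y, e a x y * e a x y ∂σ₂ ≤ 1 := by
    intro x hx
    have hc : Continuous fun y => e a x y * e a x y := by
      have : Continuous fun y => e a x y :=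
        (h.herm a).continuous.comp (by fun_prop : Continuous fun y => (x, y))
      exact this.mul this
    refine (h.sphere₂.integral_mono hc (continuous_const (y := (1 : ℝ))) fun y hy => ?_).trans_eq
      (by simp)
    have := ha x y hx hy
    rw [← sq]
    exact (sq_le_one_iff_abs_le_one _).2 this
  have hint := (h.sphere₁.integrable_prod h.sphere₂
    ((h.herm a).continuous.mul (h.herm a).continuous)).integral_prod_left
  refine (integral_mono_ae hint (integrable_const (1 : ℝ)) ?_).trans_eq (by simp)
  filter_upwards [h.sphere₁.ae_mem] with x hx
  exact h1 x (mem_unitSphere.1 hx)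

lemma volume_supBall_ne_top (h : Family n m isR D σ₁ σ₂ e) : volume (supBall e) ≠ ⊤ := by
  refine ((measure_mono fun a ha => ?_).trans_lt (volume_unit_ball_ne_top D).lt_top).ne
  have := h.dotProduct_le_one_of_mem_supBall ha
  simp only [dotProduct, ← sq] at this
  exact this

lemma abs_eval_le_of_mem_supBall (h : Family n m isR D σ₁ σ₂ e) {a : Fin D → ℝ}
    (ha : a ∈ supBall e) {y : Fin (2 * m) → ℝ} (hy : y ⬝ᵥ y = 1) (x : Fin (2 * n) → ℝ) :
    |e a x y| ≤ x ⬝ᵥ x := by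
  have hq := (h.herm a).mem_range_quadLin y
  by_cases hx : x = 0
  · subst hx
    have := dotProduct_quadMat_mulVec hq 0
    rw [← this]; simp
  · have hpos : 0 < x ⬝ᵥ x := by
      refine lt_of_le_of_ne (Finset.sum_nonneg fun i _ => mul_self_nonneg _) fun h0 => hx ?_
      exact dotProduct_self_eq_zero.1 h0.symm
    set r := √(x ⬝ᵥ x) with hr
    have hr0 : 0 < r := Real.sqrt_pos.2 hpos
    have hrr : r * r = x ⬝ᵥ x := Real.mul_self_sqrt hpos.le
    have h1 := ha (r⁻¹ • x) y (by
      rw [smul_dotProduct, dotProduct_smul, ← hrr, smul_eq_mul, smul_eq_mul]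
      field_simp) hy
    have h2 : e a (r⁻¹ • x) y = (r * r)⁻¹ * e a x y := by
      have e1 := dotProduct_quadMat_mulVec hq (r⁻¹ • x)
      have e2 := dotProduct_quadMat_mulVec hq x
      rw [← e1, ← e2, Matrix.mulVec_smul, smul_dotProduct, dotProduct_smul, smul_eq_mul,
        smul_eq_mul, mul_inv, mul_assoc]
    rw [h2, abs_mul, abs_of_pos (by positivity), hrr, inv_mul_le_iff₀ hpos, mul_one] at h1
    exact h1

end Family

lemma mulVec_dotProduct_mulVec_le_one {d : ℕ} {S : Matrix (Fin d) (Fin d) ℝ} (hS : Sᵀ = S)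
    (h : ∀ x, |x ⬝ᵥ S *ᵥ x| ≤ x ⬝ᵥ x) {v : Fin d → ℝ} (hv : v ⬝ᵥ v = 1) :
    (S *ᵥ v) ⬝ᵥ (S *ᵥ v) ≤ 1 := by
  set w := S *ᵥ v with hw
  have hsymm : v ⬝ᵥ S *ᵥ w = w ⬝ᵥ w := by
    rw [Matrix.dotProduct_mulVec, ← Matrix.mulVec_transpose, hS]
  have h1 := (abs_le.1 (h (w + v))).2
  have h2 := (abs_le.1 (h (w - v))).1
  simp only [Matrix.mulVec_add, Matrix.mulVec_sub, add_dotProduct, dotProduct_add,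
    sub_dotProduct, dotProduct_sub, ← hw, hsymm, hv] at h1 h2
  linarith

lemma trace_sq_le {d : ℕ} {S : Matrix (Fin d) (Fin d) ℝ} (hS : Sᵀ = S) :
    S.trace ^ 2 ≤ d * (S * S).trace := by
  have h1 : S.trace ^ 2 ≤ d * ∑ i, S i i ^ 2 := by
    have := sq_sum_le_card_mul_sum_sq (s := Finset.univ) (f := fun i => S i i)
    simpa [Matrix.trace] using this
  refine h1.trans (mul_le_mul_of_nonneg_left ?_ (by positivity))
  refine Finset.sum_le_sum fun i _ => ?_
  rw [Matrix.diag_apply, Matrix.mul_apply]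
  have : ∀ j, S i j * S j i = S i j ^ 2 := fun j => by
    rw [sq, ← Matrix.transpose_apply S j i, hS]
  simp only [this]
  exact Finset.single_le_sum (f := fun j => S i j ^ 2) (fun j _ => sq_nonneg _) (Finset.mem_univ i)

namespace Family

variable {n m : ℕ} {isR : Bool} {D : ℕ} {σ₁ : Measure (Fin (2 * n) → ℝ)}
  {σ₂ : Measure (Fin (2 * m) → ℝ)}
  {e : (Fin D → ℝ) → (Fin (2 * n) → ℝ) → (Fin (2 * m) → ℝ) → ℝ}

/-- The symmetric matrix of the quadratic form `x ↦ e a x y`. -/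
def coefMat (e : (Fin D → ℝ) → (Fin (2 * n) → ℝ) → (Fin (2 * m) → ℝ) → ℝ) (a : Fin D → ℝ)
    (y : Fin (2 * m) → ℝ) : Matrix (Fin (2 * n)) (Fin (2 * n)) ℝ := quadMat fun x => e a x y

lemma coefMat_transpose (h : Family n m isR D σ₁ σ₂ e) (a : Fin D → ℝ) (y : Fin (2 * m) → ℝ) :
    (coefMat e a y)ᵀ = coefMat e a y := quadMat_transpose ((h.herm a).mem_range_quadLin y)

lemma dotProduct_coefMat_mulVec (h : Family n m isR D σ₁ σ₂ e) (a : Fin D → ℝ)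
    (x : Fin (2 * n) → ℝ) (y : Fin (2 * m) → ℝ) : x ⬝ᵥ coefMat e a y *ᵥ x = e a x y :=
  dotProduct_quadMat_mulVec ((h.herm a).mem_range_quadLin y) x

lemma coefMat_add (h : Family n m isR D σ₁ σ₂ e) (a b : Fin D → ℝ) (y : Fin (2 * m) → ℝ) :
    coefMat e (a + b) y = coefMat e a y + coefMat e b y := by
  ext i j
  simp only [coefMat, quadMat, Matrix.of_apply, h.add, Matrix.add_apply]
  ring

lemma coefMat_smul (h : Family n m isR D σ₁ σ₂ e) (c : ℝ) (a : Fin D → ℝ)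
    (y : Fin (2 * m) → ℝ) : coefMat e (c • a) y = c • coefMat e a y := by
  ext i j
  simp only [coefMat, quadMat, Matrix.of_apply, h.smul, Matrix.smul_apply, smul_eq_mul]
  ring

lemma continuous_coefMat (h : Family n m isR D σ₁ σ₂ e) :
    Continuous fun p : (Fin D → ℝ) × (Fin (2 * m) → ℝ) => coefMat e p.1 p.2 := by
  refine continuous_pi fun i => continuous_pi fun j => ?_
  simp only [coefMat, quadMat, Matrix.of_apply]
  have hx : ∀ x : Fin (2 * n) → ℝ,
      Continuous fun p : (Fin D → ℝ) × (Fin (2 * m) → ℝ) => e p.1 x p.2 := fun x =>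
    h.continuous.comp (by fun_prop :
      Continuous fun p : (Fin D → ℝ) × (Fin (2 * m) → ℝ) => (p.1, x, p.2))
  exact ((hx _).sub (hx _)).div_const _

lemma continuous_trace_sq (h : Family n m isR D σ₁ σ₂ e) :
    Continuous fun p : (Fin D → ℝ) × (Fin (2 * m) → ℝ) =>
      (coefMat e p.1 p.2 * coefMat e p.1 p.2).trace :=
  (h.continuous_coefMat.matrix_mul h.continuous_coefMat).matrix_trace

lemma trace_sq_eq_sum (h : Family n m isR D σ₁ σ₂ e) (a : Fin D → ℝ) (y : Fin (2 * m) → ℝ) :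
    (coefMat e a y * coefMat e a y).trace = ∑ j, ∑ i, coefMat e a y i j ^ 2 := by
  rw [Matrix.trace]
  refine Finset.sum_congr rfl fun j _ => ?_
  rw [Matrix.diag_apply, Matrix.mul_apply]
  refine Finset.sum_congr rfl fun i _ => ?_
  rw [sq, ← Matrix.transpose_apply (coefMat e a y) i j, h.coefMat_transpose]

lemma lintegral_column_le (h : Family n m isR D σ₁ σ₂ e) {y : Fin (2 * m) → ℝ} (hy : y ⬝ᵥ y = 1)
    (j : Fin (2 * n)) :
    ∫⁻ a in supBall e, ENNReal.ofReal (∑ i, coefMat e a y i j ^ 2) ≤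
      ENNReal.ofReal ((n : ℝ) / (n + 1)) * volume (supBall e) := by
  let u : (Fin D → ℝ) →ₗ[ℝ] EuclideanSpace ℝ (Fin (2 * n)) :=
    { toFun := fun a => WithLp.toLp 2 fun i => coefMat e a y i j
      map_add' := fun a b => by ext i; simp [h.coefMat_add]
      map_smul' := fun c a => by ext i; simp [h.coefMat_smul] }
  have hu : ∀ a, ‖u a‖ ^ 2 = ∑ i, coefMat e a y i j ^ 2 := fun a => by
    rw [EuclideanSpace.norm_sq_eq]
    simp [u]
  have := lintegral_norm_sq_le h.isClosed_supBall.measurableSet h.convex_supBall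
    h.volume_supBall_ne_top (fun x hx => h.neg_mem_supBall hx) (LinearMap.toContinuousLinearMap u)
    (fun a ha => by
      show ‖u a‖ ≤ 1
      rw [← sq_le_one_iff₀ (norm_nonneg _), hu]
      have := mulVec_dotProduct_mulVec_le_one (h.coefMat_transpose a y)
        (fun x => by
          rw [h.dotProduct_coefMat_mulVec]
          exact h.abs_eval_le_of_mem_supBall ha hy x)
        (v := Pi.single j 1) (by simp)
      simpa [dotProduct, ← sq] using this)
  have hu' : ∀ a, ‖(LinearMap.toContinuousLinearMap u) a‖ ^ 2 = ∑ i, coefMat e a y i j ^ 2 := hu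
  simp only [hu', finrank_euclideanSpace, Fintype.card_fin] at this
  refine this.trans_eq ?_
  congr 2
  push_cast
  rw [show (2 * n + 2 : ℝ) = 2 * (n + 1) by ring, mul_div_mul_left _ _ two_ne_zero]

lemma lintegral_trace_sq_le (h : Family n m isR D σ₁ σ₂ e) (hn : 0 < n) {y : Fin (2 * m) → ℝ}
    (hy : y ⬝ᵥ y = 1) :
    ∫⁻ a in supBall e, ENNReal.ofReal ((coefMat e a y * coefMat e a y).trace / (2 * n)) ≤
      ENNReal.ofReal ((n : ℝ) / (n + 1)) * volume (supBall e) := by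
  have hn' : (0 : ℝ) < n := by exact_mod_cast hn
  have hcont : ∀ i j, Continuous fun a => coefMat e a y i j := fun i j =>
    (h.continuous_coefMat.comp (by fun_prop :
      Continuous fun a : Fin D → ℝ => (a, y))).matrix_elem i j
  have h1 : ∀ a, ENNReal.ofReal ((coefMat e a y * coefMat e a y).trace / (2 * n)) =
      ENNReal.ofReal (1 / (2 * n)) * ∑ j, ENNReal.ofReal (∑ i, coefMat e a y i j ^ 2) := fun a => by
    rw [h.trace_sq_eq_sum, div_eq_mul_one_div, mul_comm, ENNReal.ofReal_mul (by positivity),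
      ENNReal.ofReal_sum_of_nonneg fun j _ => Finset.sum_nonneg fun i _ => sq_nonneg _]
  simp only [h1]
  rw [lintegral_const_mul' _ _ ENNReal.ofReal_ne_top, lintegral_finsetSum]
  · calc _ ≤ ENNReal.ofReal (1 / (2 * n)) * ∑ j : Fin (2 * n),
          ENNReal.ofReal ((n : ℝ) / (n + 1)) * volume (supBall e) := by
          gcongr with j
          exact h.lintegral_column_le hy j
      _ = _ := by
          rw [Finset.sum_const, Finset.card_univ, Fintype.card_fin, nsmul_eq_mul, ← mul_assoc,
            ← ENNReal.ofReal_natCast, ← ENNReal.ofReal_mul (by positivity),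
            show 1 / (2 * n : ℝ) * ((2 * n : ℕ) : ℝ) = 1 by push_cast; field_simp,
            ENNReal.ofReal_one, one_mul]
  · intro j _
    exact (continuous_finsetSum _ fun i _ => (hcont i j).pow 2).measurable.ennreal_ofReal

/-- The normalized trace of the coefficient matrix. -/
def meanCoef (e : (Fin D → ℝ) → (Fin (2 * n) → ℝ) → (Fin (2 * m) → ℝ) → ℝ) (a : Fin D → ℝ)
    (y : Fin (2 * m) → ℝ) : ℝ := (coefMat e a y).trace / (2 * n)

lemma continuous_meanCoef (h : Family n m isR D σ₁ σ₂ e) (a : Fin D → ℝ) :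
    Continuous (meanCoef e a) :=
  ((h.continuous_coefMat.comp (by fun_prop :
      Continuous fun y : Fin (2 * m) → ℝ => (a, y))).matrix_trace).div_const _

lemma continuous_trace_sq_right (h : Family n m isR D σ₁ σ₂ e) (a : Fin D → ℝ) :
    Continuous fun y => (coefMat e a y * coefMat e a y).trace :=
  have hc : Continuous fun y => coefMat e a y :=
    h.continuous_coefMat.comp (by fun_prop : Continuous fun y : Fin (2 * m) → ℝ => (a, y))
  (hc.matrix_mul hc).matrix_trace

/-- The linear map sending a parameter to the normalized trace function. -/
def meanLin (h : Family n m isR D σ₁ σ₂ e) : (Fin D → ℝ) →ₗ[ℝ] ((Fin (2 * m) → ℝ) → ℝ) where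
  toFun a := meanCoef e a
  map_add' a b := by ext y; simp [meanCoef, h.coefMat_add, add_div]
  map_smul' c a := by ext y; simp [meanCoef, h.coefMat_smul, mul_div_assoc]

lemma integral_trace_sq (h : Family n m isR D σ₁ σ₂ e) (hn : 0 < n) (a : Fin D → ℝ) :
    ∫ y, (coefMat e a y * coefMat e a y).trace / (2 * n) ∂σ₂ =
      (n + 1) * (a ⬝ᵥ a) - n * ∫ y, meanCoef e a y ^ 2 ∂σ₂ := by
  have hn' : (0 : ℝ) < n := by exact_mod_cast hn
  have h1 : a ⬝ᵥ a = ∫ y, ((2 * (coefMat e a y * coefMat e a y).trace +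
      (coefMat e a y).trace ^ 2) / ((2 * n) * (2 * n + 2))) ∂σ₂ := by
    rw [← h.ip_symm]
    congr 1; ext y
    have := h.sphere₁.integral_quadratic_sq (h.coefMat_transpose a y)
    simp only [h.dotProduct_coefMat_mulVec] at this
    refine Eq.trans ?_ (this.trans (by push_cast; rfl))
    simp only [sq]
  rw [h1, ← integral_const_mul, ← integral_const_mul, ← integral_sub]
  · congr 1; ext y
    rw [meanCoef]
    field_simp
    ring
  · refine (h.sphere₂.integrable ?_).const_mul _
    have := h.continuous_trace_sq_right a
    have h2 : Continuous fun y => (coefMat e a y).trace :=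
      (h.continuous_coefMat.comp (by fun_prop :
      Continuous fun y : Fin (2 * m) → ℝ => (a, y))).matrix_trace
    exact ((this.const_mul 2).add (h2.pow 2)).div_const _
  · exact (h.sphere₂.integrable ((h.continuous_meanCoef a).pow 2)).const_mul _

lemma integral_meanCoef_sq_le (h : Family n m isR D σ₁ σ₂ e) (hn : 0 < n) (a : Fin D → ℝ) :
    ∫ y, meanCoef e a y ^ 2 ∂σ₂ ≤ a ⬝ᵥ a := by
  have hn' : (0 : ℝ) < n := by exact_mod_cast hn
  have h1 : ∫ y, meanCoef e a y ^ 2 ∂σ₂ ≤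
      ∫ y, (coefMat e a y * coefMat e a y).trace / (2 * n) ∂σ₂ := by
    refine integral_mono (h.sphere₂.integrable ((h.continuous_meanCoef a).pow 2))
      (h.sphere₂.integrable ((h.continuous_trace_sq_right a).div_const _)) fun y => ?_
    have := trace_sq_le (h.coefMat_transpose a y)
    push_cast at this
    simp only [meanCoef]
    rw [div_pow, div_le_div_iff₀ (by positivity) (by positivity)]
    nlinarith
  rw [h.integral_trace_sq hn] at h1
  nlinarith

lemma meanCoef_eq_sum (h : Family n m isR D σ₁ σ₂ e) (a : Fin D → ℝ) (y : Fin (2 * m) → ℝ) :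
    meanCoef e a y = ∑ q, a q * meanCoef e (Pi.single q 1) y := by
  have := congrFun (h.meanLin.pi_apply_eq_sum_univ a) y
  simp only [Finset.sum_apply, Pi.smul_apply, smul_eq_mul] at this
  refine this.trans (Finset.sum_congr rfl fun q _ => ?_)
  congr 1
  show meanCoef e _ y = _
  congr 1
  ext r
  simp [Pi.single_apply, eq_comm]

/-- The Gram matrix of the normalized trace functions. -/
def meanGram (σ₂ : Measure (Fin (2 * m) → ℝ))
    (e : (Fin D → ℝ) → (Fin (2 * n) → ℝ) → (Fin (2 * m) → ℝ) → ℝ) : Matrix (Fin D) (Fin D) ℝ :=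
  Matrix.of fun p q => ∫ y, meanCoef e (Pi.single p 1) y * meanCoef e (Pi.single q 1) y ∂σ₂

lemma meanGram_mulVec (h : Family n m isR D σ₁ σ₂ e) (a : Fin D → ℝ) (p : Fin D) :
    (meanGram σ₂ e *ᵥ a) p = ∫ y, meanCoef e (Pi.single p 1) y * meanCoef e a y ∂σ₂ := by
  have h1 := h.meanCoef_eq_sum a
  simp only [h1, Finset.mul_sum, Matrix.mulVec, dotProduct, meanGram, Matrix.of_apply]
  rw [integral_finsetSum]
  · refine Finset.sum_congr rfl fun q _ => ?_
    rw [← integral_mul_const]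
    congr 1; ext y; ring
  · intro q _
    refine h.sphere₂.integrable ?_
    exact (h.continuous_meanCoef _).mul ((h.continuous_meanCoef _).const_mul _)

lemma dotProduct_meanGram_mulVec (h : Family n m isR D σ₁ σ₂ e) (a : Fin D → ℝ) :
    a ⬝ᵥ meanGram σ₂ e *ᵥ a = ∫ y, meanCoef e a y ^ 2 ∂σ₂ := by
  have h1 := h.meanCoef_eq_sum a
  rw [dotProduct]
  simp only [h.meanGram_mulVec, ← integral_const_mul]
  rw [← integral_finsetSum]
  · congr 1; ext y
    rw [sq]
    conv_rhs => rw [h1 y]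
    rw [Finset.sum_mul]
    rw [← h1 y]
    exact Finset.sum_congr rfl fun q _ => by ring
  · intro q _
    exact (h.sphere₂.integrable
      ((h.continuous_meanCoef _).mul (h.continuous_meanCoef _))).const_mul _

lemma rank_meanGram_le (h : Family n m isR D σ₁ σ₂ e) :
    (meanGram σ₂ e).rank ≤ Module.finrank ℝ (LinearMap.range h.meanLin) := by
  have h1 := LinearMap.finrank_range_add_finrank_ker (meanGram σ₂ e).mulVecLin
  have h2 := LinearMap.finrank_range_add_finrank_ker h.meanLin
  have h3 : LinearMap.ker h.meanLin ≤ LinearMap.ker (meanGram σ₂ e).mulVecLin := by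
    intro a ha
    rw [LinearMap.mem_ker] at ha ⊢
    ext p
    rw [Matrix.mulVecLin_apply, h.meanGram_mulVec]
    have : meanCoef e a = 0 := ha
    simp [this]
  have h4 := Submodule.finrank_mono h3
  rw [Matrix.rank]
  omega

theorem volume_supBall_le (h : Family n m isR D σ₁ σ₂ e) (hn : 0 < n) (hD : 0 < D) :
    ENNReal.ofReal (√(n + 1) ^ (D - (meanGram σ₂ e).rank)) * volume (supBall e) ≤
      ENNReal.ofReal (((n : ℝ) / (n + 1) * ((D + 2) / D)) ^ ((D : ℝ) / 2)) *
        volume {x : Fin D → ℝ | ∑ i, x i ^ 2 ≤ 1} := by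
  have hn' : (0 : ℝ) < n := by exact_mod_cast hn
  have := h.sphere₂.prob
  refine volume_le_of_quadratic_average_le hD h.isClosed_supBall.measurableSet
    h.volume_supBall_ne_top ?_ ?_ hn'.le (by positivity) ?_
  · ext p q
    simp only [meanGram, Matrix.transpose_apply, Matrix.of_apply, mul_comm]
  · intro a
    rw [h.dotProduct_meanGram_mulVec]
    exact h.integral_meanCoef_sq_le hn a
  · have h1 : ∀ a, ENNReal.ofReal (((n : ℝ) + 1) * (a ⬝ᵥ a) - n * (a ⬝ᵥ meanGram σ₂ e *ᵥ a)) =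
        ∫⁻ y, ENNReal.ofReal ((coefMat e a y * coefMat e a y).trace / (2 * n)) ∂σ₂ := fun a => by
      rw [h.dotProduct_meanGram_mulVec, ← h.integral_trace_sq hn,
        ofReal_integral_eq_lintegral_ofReal]
      · exact h.sphere₂.integrable ((h.continuous_trace_sq_right a).div_const _)
      · refine Filter.Eventually.of_forall fun y => ?_
        simp only [h.trace_sq_eq_sum]
        exact div_nonneg (Finset.sum_nonneg fun j _ => Finset.sum_nonneg fun i _ => sq_nonneg _)
          (by positivity)
    simp only [h1]
    rw [lintegral_lintegral_swap]
    · calc _ ≤ ∫⁻ _, ENNReal.ofReal ((n : ℝ) / (n + 1)) * volume (supBall e) ∂σ₂ := by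
            refine lintegral_mono_ae ?_
            filter_upwards [h.sphere₂.ae_mem] with y hy
            exact h.lintegral_trace_sq_le hn (mem_unitSphere.1 hy)
        _ = _ := by simp
    · exact (h.continuous_trace_sq.div_const _).measurable.ennreal_ofReal.aemeasurable

end Family

lemma conj_cz_single_mul_cz_single {n : ℕ} (p : Fin (2 * n)) (i j : Fin n) :
    conj (cz (Pi.single p 1) i) * cz (Pi.single p 1) j =
      if i = (finProdFinEquiv.symm p).2 ∧ j = (finProdFinEquiv.symm p).2 then 1 else 0 := by
  obtain ⟨⟨b, i₀⟩, rfl⟩ := (finProdFinEquiv (m := 2) (n := n)).surjective p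
  simp only [Equiv.symm_apply_apply, cz, Pi.single_apply, EmbeddingLike.apply_eq_iff_eq,
    Prod.mk.injEq]
  fin_cases b <;> by_cases hi : i = i₀ <;> by_cases hj : j = i₀ <;> simp [hi, hj]

lemma HermEval.eval_single {n m : ℕ} {isR : Bool}
    {F : (Fin (2 * n) → ℝ) → (Fin (2 * m) → ℝ) → ℝ} (h : HermEval n m isR F) (p : Fin (2 * n)) :
    ∃ b : Fin m → Fin m → ℂ, (isR = true → ∀ k l, (b k l).im = 0) ∧
      ∀ y, F (Pi.single p 1) y = ∑ k, ∑ l, (b k l * (conj (cz y k) * cz y l)).re := by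
  obtain ⟨a, -, hR, h⟩ := h
  set i₀ := (finProdFinEquiv.symm p).2 with hi
  refine ⟨fun k l => a i₀ i₀ k l, fun hr k l => hR hr _ _ k l, fun y => ?_⟩
  rw [← Complex.ofReal_re (F _ y), h]
  have h1 : ∀ i j k l, a i j k l * conj (cz (Pi.single p 1) i) * cz (Pi.single p 1) j *
      conj (cz y k) * cz y l = if i = i₀ then
        (if j = i₀ then a i j k l * (conj (cz y k) * cz y l) else 0) else 0 := fun i j k l => by
    rw [mul_assoc (a i j k l), conj_cz_single_mul_cz_single, ← hi, ← ite_and]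
    split_ifs <;> ring
  simp only [h1, Complex.re_sum]
  rw [Finset.sum_eq_single i₀, Finset.sum_eq_single i₀]
  · simp
  · intro j _ hj; simp [hj]
  · simp
  · intro i _ hi; simp [hi]
  · simp

/-- Real quadratic functions spanned by the real parts `Re (w̄ₖ wₗ)`. -/
def realProd (m : ℕ) : Sym2 (Fin m) → (Fin (2 * m) → ℝ) → ℝ :=
  Sym2.lift ⟨fun k l y => (conj (cz y k) * cz y l).re, fun k l => by
    ext y; simp [Complex.mul_re]; ring⟩

/-- Real quadratic functions spanned by real and imaginary parts of the `w̄ₖ wₗ`. -/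
def complexProd (m : ℕ) : Fin m × Fin m → (Fin (2 * m) → ℝ) → ℝ := fun q y =>
  if q.1 ≤ q.2 then (conj (cz y q.1) * cz y q.2).re else (conj (cz y q.1) * cz y q.2).im

/-- The dimension of the space of normalized trace functions. -/
def traceDim (m : ℕ) (isR : Bool) : ℕ := if isR then (m + 1).choose 2 else m * m

/-- The space of normalized trace functions. -/
def traceSpace (m : ℕ) (isR : Bool) : Submodule ℝ ((Fin (2 * m) → ℝ) → ℝ) :=
  if isR then Submodule.span ℝ (Set.range (realProd m))
  else Submodule.span ℝ (Set.range (complexProd m))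

instance (m : ℕ) (isR : Bool) : FiniteDimensional ℝ (traceSpace m isR) := by
  cases isR
  · exact FiniteDimensional.span_of_finite ℝ (Set.finite_range _)
  · exact FiniteDimensional.span_of_finite ℝ (Set.finite_range _)

lemma finrank_traceSpace_le (m : ℕ) (isR : Bool) :
    Module.finrank ℝ (traceSpace m isR) ≤ traceDim m isR := by
  cases isR
  · refine (finrank_range_le_card (complexProd m)).trans_eq ?_
    simp [traceDim]
  · refine (finrank_range_le_card (realProd m)).trans_eq ?_
    simp [traceDim, Sym2.card]

lemma complexProd_mem (m : ℕ) (k l : Fin m) :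
    (fun y => (conj (cz y k) * cz y l).re) ∈ traceSpace m false ∧
      (fun y => (conj (cz y k) * cz y l).im) ∈ traceSpace m false := by
  have hG : ∀ q, complexProd m q ∈ traceSpace m false := fun q =>
    Submodule.subset_span (Set.mem_range_self q)
  rcases lt_trichotomy k l with h | h | h
  · constructor
    · convert hG (k, l) using 1
      ext y; simp [complexProd, h.le]
    · convert Submodule.neg_mem _ (hG (l, k)) using 1
      ext y; simp [complexProd, h.not_ge]; ring
  · subst h
    constructor
    · convert hG (k, k) using 1
      ext y; simp [complexProd]
    · convert Submodule.zero_mem _ using 1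
      ext y; simp; ring
  · constructor
    · convert hG (l, k) using 1
      ext y; simp [complexProd, h.le]; ring
    · convert hG (k, l) using 1
      ext y; simp [complexProd, h.not_ge]

lemma realProd_mem (m : ℕ) (k l : Fin m) :
    (fun y => (conj (cz y k) * cz y l).re) ∈ traceSpace m true :=
  Submodule.subset_span ⟨s(k, l), rfl⟩

lemma HermEval.eval_single_mem {n m : ℕ} {isR : Bool}
    {F : (Fin (2 * n) → ℝ) → (Fin (2 * m) → ℝ) → ℝ} (h : HermEval n m isR F) (p : Fin (2 * n)) :
    (fun y => F (Pi.single p 1) y) ∈ traceSpace m isR := by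
  obtain ⟨b, hb, h⟩ := h.eval_single p
  have h1 : (fun y => F (Pi.single p 1) y) = ∑ k, ∑ l,
      ((b k l).re • (fun y => (conj (cz y k) * cz y l).re) -
        (b k l).im • fun y => (conj (cz y k) * cz y l).im) := by
    ext y
    rw [h]
    simp only [Finset.sum_apply, Pi.sub_apply, Pi.smul_apply, smul_eq_mul]
    simp only [Complex.mul_re (b _ _)]
  rw [h1]
  refine Submodule.sum_mem _ fun k _ => Submodule.sum_mem _ fun l _ => ?_
  cases isR
  · exact Submodule.sub_mem _ (Submodule.smul_mem _ _ (complexProd_mem m k l).1)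
      (Submodule.smul_mem _ _ (complexProd_mem m k l).2)
  · rw [hb rfl, zero_smul, sub_zero]
    exact Submodule.smul_mem _ _ (realProd_mem m k l)

namespace Family

variable {n m : ℕ} {isR : Bool} {D : ℕ} {σ₁ : Measure (Fin (2 * n) → ℝ)}
  {σ₂ : Measure (Fin (2 * m) → ℝ)}
  {e : (Fin D → ℝ) → (Fin (2 * n) → ℝ) → (Fin (2 * m) → ℝ) → ℝ}

lemma rank_meanGram_le_traceDim (h : Family n m isR D σ₁ σ₂ e) :
    (meanGram σ₂ e).rank ≤ traceDim m isR := by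
  refine h.rank_meanGram_le.trans ((Submodule.finrank_mono ?_).trans (finrank_traceSpace_le m isR))
  rintro _ ⟨a, rfl⟩
  have h1 : h.meanLin a = (2 * n : ℝ)⁻¹ • ∑ p, fun y => e a (Pi.single p 1) y := by
    ext y
    show meanCoef e a y = _
    rw [meanCoef, coefMat, trace_quadMat ((h.herm a).mem_range_quadLin y)]
    simp only [Pi.smul_apply, Finset.sum_apply, smul_eq_mul]
    rw [div_eq_inv_mul]
  rw [h1]
  exact Submodule.smul_mem _ _ (Submodule.sum_mem _ fun p _ => (h.herm a).eval_single_mem p)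

end Family

lemma cast_DCF_true {n m : ℕ} (hn : 3 ≤ n) (hm : 3 ≤ m) :
    (DCF n m true : ℝ) = n * m * (n * m + 1) / 2 - 1 := by
  have h9 : 9 ≤ n * m := Nat.mul_le_mul hn hm
  have h1 : 2 * (n * m * (n * m + 1) / 2) = n * m * (n * m + 1) :=
    Nat.mul_div_cancel' (Nat.even_mul_succ_self (n * m)).two_dvd
  have h2 : 2 ≤ n * m * (n * m + 1) := by nlinarith
  have h3 : 2 * (DCF n m true) + 2 = n * m * (n * m + 1) := by
    simp only [DCF, if_true]; omega
  have h4 : (2 : ℝ) * DCF n m true + 2 = n * m * (n * m + 1) := by exact_mod_cast h3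
  linarith

lemma cast_DCF_false {n m : ℕ} (hn : 3 ≤ n) (hm : 3 ≤ m) :
    (DCF n m false : ℝ) = n ^ 2 * m ^ 2 - 1 := by
  have h1 : 1 ≤ n ^ 2 * m ^ 2 := Nat.one_le_iff_ne_zero.2 (by positivity)
  simp only [DCF, Bool.false_eq_true, if_false]
  push_cast [h1]; rfl

lemma DCF_comm (n m : ℕ) (isR : Bool) : DCF n m isR = DCF m n isR := by
  simp only [DCF, mul_comm n m, mul_comm (n ^ 2) (m ^ 2)]

lemma le_cast_DCF {n m : ℕ} (hn : 3 ≤ n) (hm : 3 ≤ m) (isR : Bool) :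
    (n * m : ℝ) * (n * m + 1) / 2 - 1 ≤ DCF n m isR := by
  have hn' : (3 : ℝ) ≤ n := by exact_mod_cast hn
  have hm' : (3 : ℝ) ≤ m := by exact_mod_cast hm
  cases isR
  · rw [cast_DCF_false hn hm, ← mul_pow]
    have : (9 : ℝ) ≤ n * m := by nlinarith
    nlinarith
  · rw [cast_DCF_true hn hm]

lemma traceDim_mul_le {n m : ℕ} (hn : 3 ≤ n) (hm : 3 ≤ m) (isR : Bool) :
    ((traceDim m isR : ℝ) * n / 2 + 2) * (2 * n + 1) ≤ 2 * DCF n m isR := by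
  obtain ⟨s, rfl⟩ := Nat.exists_eq_add_of_le hn
  obtain ⟨t, rfl⟩ := Nat.exists_eq_add_of_le hm
  rw [← sub_nonneg]
  cases isR
  · rw [cast_DCF_false hn hm]
    simp only [traceDim, Bool.false_eq_true, if_false]
    push_cast
    ring_nf
    positivity
  · rw [cast_DCF_true hn hm]
    simp only [traceDim, if_true, Nat.cast_choose_two]
    push_cast
    ring_nf
    positivity

lemma log_add_one_le {x : ℝ} (hx : 3 ≤ x) : Real.log (x + 1) ≤ x / 2 := by
  have h1 : Real.log (x + 1) = 2 * Real.log 2 + Real.log ((x + 1) / 4) := by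
    rw [Real.log_div (by linarith) (by norm_num), show (4 : ℝ) = 2 ^ 2 by norm_num, Real.log_pow]
    push_cast; ring
  have h2 := Real.log_le_sub_one_of_pos (show 0 < (x + 1) / 4 by linarith)
  have h3 := Real.log_two_lt_d9
  linarith

lemma pow_mul_sqrt_pow_le_one {n m : ℕ} (hn : 3 ≤ n) (hm : 3 ≤ m) (isR : Bool) {r : ℕ}
    (hr : r ≤ traceDim m isR) :
    ((n : ℝ) / (n + 1) * ((DCF n m isR + 2) / DCF n m isR)) ^ ((DCF n m isR : ℝ) / 2) *
      √(n + 1) ^ r ≤ 1 := by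
  have hn' : (3 : ℝ) ≤ n := by exact_mod_cast hn
  have hm' : (3 : ℝ) ≤ m := by exact_mod_cast hm
  have hD : (0 : ℝ) < DCF n m isR := by
    have := le_cast_DCF hn hm isR
    have : (9 : ℝ) ≤ n * m := by nlinarith
    nlinarith
  have key := traceDim_mul_le hn hm isR
  have hr' : (r : ℝ) ≤ traceDim m isR := by exact_mod_cast hr
  set D := (DCF n m isR : ℝ)
  have hb : 0 < (n : ℝ) / (n + 1) * ((D + 2) / D) := by positivity
  have hs : (0 : ℝ) < √(n + 1) := Real.sqrt_pos.2 (by positivity)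
  rw [← Real.log_nonpos_iff (by positivity), Real.log_mul (by positivity) (by positivity),
    Real.log_rpow hb, Real.log_pow, Real.log_sqrt (by positivity),
    Real.log_mul (by positivity) (by positivity)]
  have h1 : Real.log ((n : ℝ) / (n + 1)) ≤ -(2 / (2 * n + 1)) := by
    have := Real.le_log_one_add_of_nonneg (x := 1 / (n : ℝ)) (by positivity)
    rw [← inv_div, Real.log_inv, neg_le_neg_iff]
    convert this using 1
    · field_simp; ring
    · congr 1; field_simp
  have h2 : Real.log ((D + 2) / D) ≤ 2 / D := by
    refine (Real.log_le_sub_one_of_pos (by positivity)).trans_eq ?_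
    field_simp; ring
  have h3 := log_add_one_le hn'
  have h4 : (r : ℝ) * (Real.log (n + 1) / 2) ≤ traceDim m isR * n / 4 := by
    have h5 : Real.log ((n : ℝ) + 1) / 2 ≤ n / 4 := by linarith
    calc _ ≤ (r : ℝ) * (n / 4) := mul_le_mul_of_nonneg_left h5 (by positivity)
      _ ≤ traceDim m isR * (n / 4) := mul_le_mul_of_nonneg_right hr' (by positivity)
      _ = _ := by ring
  have h6 : D / 2 * (Real.log ((n : ℝ) / (n + 1)) + Real.log ((D + 2) / D)) ≤
      D / 2 * (-(2 / (2 * n + 1)) + 2 / D) :=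
    mul_le_mul_of_nonneg_left (add_le_add h1 h2) (by positivity)
  have h7 : D / 2 * (-(2 / (2 * (n : ℝ) + 1)) + 2 / D) = 1 - D / (2 * n + 1) := by
    field_simp; ring
  have h8 : (traceDim m isR : ℝ) * n / 4 + 1 ≤ D / (2 * n + 1) := by
    rw [le_div_iff₀ (by positivity)]
    linarith
  linarith

namespace Family

variable {n m : ℕ} {isR : Bool} {σ₁ : Measure (Fin (2 * n) → ℝ)}
  {σ₂ : Measure (Fin (2 * m) → ℝ)}
  {e : (Fin (DCF n m isR) → ℝ) → (Fin (2 * n) → ℝ) → (Fin (2 * m) → ℝ) → ℝ}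

theorem sqrt_pow_mul_volume_supBall_le (h : Family n m isR (DCF n m isR) σ₁ σ₂ e) (hn : 3 ≤ n)
    (hm : 3 ≤ m) :
    ENNReal.ofReal (√(n + 1) ^ DCF n m isR) * volume (supBall e) ≤
      volume {x : Fin (DCF n m isR) → ℝ | ∑ i, x i ^ 2 ≤ 1} := by
  have hn' : (3 : ℝ) ≤ n := by exact_mod_cast hn
  have hm' : (3 : ℝ) ≤ m := by exact_mod_cast hm
  have hD : 0 < DCF n m isR := by
    have := le_cast_DCF hn hm isR
    have h9 : (9 : ℝ) ≤ n * m := by nlinarith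
    have : (0 : ℝ) < DCF n m isR := by nlinarith
    exact_mod_cast this
  have h1 := h.volume_supBall_le (by omega) hD
  set r := (meanGram σ₂ e).rank with hr
  have hrD : r ≤ DCF n m isR := by
    simpa using (meanGram σ₂ e).rank_le_card_width
  calc ENNReal.ofReal (√(n + 1) ^ DCF n m isR) * volume (supBall e)
      = ENNReal.ofReal (√(n + 1) ^ r) *
          (ENNReal.ofReal (√(n + 1) ^ (DCF n m isR - r)) * volume (supBall e)) := by
        rw [← mul_assoc, ← ENNReal.ofReal_mul (by positivity), ← pow_add, Nat.add_sub_cancel' hrD]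
    _ ≤ ENNReal.ofReal (√(n + 1) ^ r) * _ := mul_le_mul_right h1 _
    _ ≤ _ := by
        rw [← mul_assoc, ← ENNReal.ofReal_mul (by positivity)]
        refine mul_le_of_le_one_left' ?_
        rw [ENNReal.ofReal_le_one, mul_comm]
        exact pow_mul_sqrt_pow_le_one hn hm isR h.rank_meanGram_le_traceDim

end Family

/-- The orthogonal matrix acting on `ℂⁿ = ℝ²ⁿ` by a cyclic shift followed by sign changes. -/
def signShift {n : ℕ} [NeZero n] (g : (Fin n → ℤˣ) × Fin n) :
    Matrix (Fin (2 * n)) (Fin (2 * n)) ℝ :=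
  Matrix.of fun p q =>
    if q = finProdFinEquiv ((finProdFinEquiv.symm p).1, (finProdFinEquiv.symm p).2 + g.2)
    then ((g.1 (finProdFinEquiv.symm p).2 : ℤ) : ℝ) else 0

lemma cast_units_mul_self (u : ℤˣ) : ((u : ℤ) : ℝ) * ((u : ℤ) : ℝ) = 1 := by
  rcases Int.units_eq_one_or u with rfl | rfl <;> simp

lemma signShift_mulVec {n : ℕ} [NeZero n] (g : (Fin n → ℤˣ) × Fin n) (x : Fin (2 * n) → ℝ)
    (b : Fin 2) (i : Fin n) : (signShift g *ᵥ x) (finProdFinEquiv (b, i)) =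
      ((g.1 i : ℤ) : ℝ) * x (finProdFinEquiv (b, i + g.2)) := by
  simp only [signShift, Matrix.mulVec, dotProduct, Matrix.of_apply, Equiv.symm_apply_apply, ite_mul,
    zero_mul, Finset.sum_ite_eq', Finset.mem_univ, if_true]

lemma cz_signShift {n : ℕ} [NeZero n] (g : (Fin n → ℤˣ) × Fin n) (x : Fin (2 * n) → ℝ)
    (i : Fin n) : cz (signShift g *ᵥ x) i = ((g.1 i : ℤ) : ℂ) * cz x (i + g.2) := by
  simp only [cz, signShift_mulVec]
  push_cast; ring

lemma signShift_mul_transpose {n : ℕ} [NeZero n] (g : (Fin n → ℤˣ) × Fin n) :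
    signShift g * (signShift g)ᵀ = 1 := by
  ext p q
  obtain ⟨⟨b, i⟩, rfl⟩ := (finProdFinEquiv (m := 2) (n := n)).surjective p
  obtain ⟨⟨c, j⟩, rfl⟩ := (finProdFinEquiv (m := 2) (n := n)).surjective q
  rw [Matrix.mul_apply, Matrix.one_apply]
  simp only [signShift, Matrix.of_apply, Matrix.transpose_apply, Equiv.symm_apply_apply, ite_mul,
    zero_mul, Finset.sum_ite_eq', Finset.mem_univ, if_true,
    EmbeddingLike.apply_eq_iff_eq, Prod.mk.injEq, add_left_inj]
  split_ifs with h
  · rw [h.2]; simp [cast_units_mul_self]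
  · simp

lemma sum_units_mul_units {n : ℕ} (i j : Fin n) :
    ∑ ε : Fin n → ℤˣ, ((ε i : ℤ) : ℂ) * ((ε j : ℤ) : ℂ) = if i = j then 2 ^ n else 0 := by
  split_ifs with h
  · subst h
    have : ∀ u : ℤˣ, ((u : ℤ) : ℂ) * ((u : ℤ) : ℂ) = 1 := fun u => by
      rcases Int.units_eq_one_or u with rfl | rfl <;> simp
    simp [this]
  · have h1 : ∑ ε : Fin n → ℤˣ, ((ε i : ℤ) : ℂ) * ((ε j : ℤ) : ℂ) =
        ∑ ε : Fin n → ℤˣ, -(((ε i : ℤ) : ℂ) * ((ε j : ℤ) : ℂ)) := by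
      rw [← Equiv.sum_comp (Equiv.mulLeft (Pi.mulSingle i (-1 : ℤˣ)))]
      refine Finset.sum_congr rfl fun ε _ => ?_
      simp [Pi.mulSingle_eq_of_ne (Ne.symm h)]
    rw [Finset.sum_neg_distrib] at h1
    exact self_eq_neg.1 h1

namespace HermEval

variable {n m : ℕ} {isR : Bool} {F : (Fin (2 * n) → ℝ) → (Fin (2 * m) → ℝ) → ℝ}

lemma signShift_left [NeZero n] (h : HermEval n m isR F) (g : (Fin n → ℤˣ) × Fin n) :
    HermEval n m isR fun x y => F (signShift g *ᵥ x) y := by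
  obtain ⟨a, ha, hR, h⟩ := h
  refine ⟨fun i j k l => (((g.1 (i - g.2) : ℤ) : ℝ) * ((g.1 (j - g.2) : ℤ) : ℝ) : ℝ) *
    a (i - g.2) (j - g.2) k l, fun i j k l => ?_, fun hr i j k l => ?_, fun x y => ?_⟩
  · dsimp only
    rw [map_mul, Complex.conj_ofReal, ← ha, mul_comm ((g.1 (i - g.2) : ℤ) : ℝ)]
  · rw [Complex.im_ofReal_mul, hR hr, mul_zero]
  · rw [h, ← Equiv.sum_comp (Equiv.subRight g.2)]
    refine Finset.sum_congr rfl fun i _ => ?_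
    rw [← Equiv.sum_comp (Equiv.subRight g.2)]
    refine Finset.sum_congr rfl fun j _ => Finset.sum_congr rfl fun k _ =>
      Finset.sum_congr rfl fun l _ => ?_
    simp only [cz_signShift, Equiv.subRight_apply, sub_add_cancel, map_mul, Complex.ofReal_mul,
      Complex.ofReal_intCast]
    rw [map_intCast]
    ring

lemma exists_sum_signShift [NeZero n] (h : HermEval n m isR F) :
    ∃ G : (Fin (2 * m) → ℝ) → ℝ, ∀ x y, ∑ g, F (signShift g *ᵥ x) y = (x ⬝ᵥ x) * G y := by
  obtain ⟨a, -, -, h⟩ := h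
  refine ⟨fun y => (2 ^ n * ∑ i, ∑ k, ∑ l, a i i k l * (conj (cz y k) * cz y l)).re,
    fun x y => ?_⟩
  have h1 : ((∑ g, F (signShift g *ᵥ x) y : ℝ) : ℂ) = ((x ⬝ᵥ x : ℝ) : ℂ) *
      (2 ^ n * ∑ i, ∑ k, ∑ l, a i i k l * (conj (cz y k) * cz y l)) := by
    set A : Fin n → Fin n → ℂ := fun i j => ∑ k, ∑ l, a i j k l * (conj (cz y k) * cz y l) with hA
    have h2 : ∀ x, (F x y : ℂ) = ∑ i, ∑ j, A i j * (conj (cz x i) * cz x j) := fun x => by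
      rw [h]
      refine Finset.sum_congr rfl fun i _ => Finset.sum_congr rfl fun j _ => ?_
      simp only [hA, Finset.sum_mul]
      exact Finset.sum_congr rfl fun k _ => Finset.sum_congr rfl fun l _ => by ring
    rw [Complex.ofReal_sum, Fintype.sum_prod_type_right]
    simp only [h2, cz_signShift, map_mul, map_intCast]
    have h3 : ∀ t : Fin n, ∑ ε : Fin n → ℤˣ, ∑ i, ∑ j, A i j *
        (((ε i : ℤ) : ℂ) * conj (cz x (i + t)) * (((ε j : ℤ) : ℂ) * cz x (j + t))) =
        ∑ i, 2 ^ n * A i i * (conj (cz x (i + t)) * cz x (i + t)) := fun t => by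
      rw [Finset.sum_comm]
      refine Finset.sum_congr rfl fun i _ => ?_
      rw [Finset.sum_comm]
      have : ∀ j, ∑ ε : Fin n → ℤˣ, A i j *
          (((ε i : ℤ) : ℂ) * conj (cz x (i + t)) * (((ε j : ℤ) : ℂ) * cz x (j + t))) =
          if i = j then 2 ^ n * (A i j * (conj (cz x (i + t)) * cz x (j + t))) else 0 := fun j => by
        have h4 : ∀ ε : Fin n → ℤˣ, A i j *
          (((ε i : ℤ) : ℂ) * conj (cz x (i + t)) * (((ε j : ℤ) : ℂ) * cz x (j + t))) =
          ((ε i : ℤ) : ℂ) * ((ε j : ℤ) : ℂ) * (A i j * (conj (cz x (i + t)) * cz x (j + t))) :=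
            fun ε => by ring
        simp only [h4]
        rw [← Finset.sum_mul, sum_units_mul_units, ite_mul, zero_mul]
      simp only [this, Finset.sum_ite_eq, Finset.mem_univ, if_true]
      ring
    simp only [h3]
    rw [Finset.sum_comm]
    have h5 : ∀ i : Fin n, ∑ t, 2 ^ n * A i i * (conj (cz x (i + t)) * cz x (i + t)) =
        2 ^ n * A i i * ((x ⬝ᵥ x : ℝ) : ℂ) := fun i => by
      rw [← Finset.mul_sum, sum_sq_eq_sum_normSq]
      congr 1
      exact Equiv.sum_comp (Equiv.addLeft i) fun j => conj (cz x j) * cz x j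
    simp only [h5]
    rw [← Finset.sum_mul, ← Finset.mul_sum]
    ring
  have h6 := congrArg Complex.re h1
  rwa [Complex.ofReal_re, Complex.re_ofReal_mul] at h6

end HermEval

lemma measurePreserving_of_dotProduct_eq {D : ℕ} (g : (Fin D → ℝ) →ₗ[ℝ] (Fin D → ℝ))
    (hg : ∀ a b, g a ⬝ᵥ g b = a ⬝ᵥ b) : MeasurePreserving g volume volume := by
  set M := LinearMap.toMatrix' g with hM
  have h1 : Mᵀ * M = 1 := by
    ext p q
    have := hg (Pi.single p 1) (Pi.single q 1)
    rw [Matrix.mul_apply, Matrix.one_apply]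
    simp only [hM, Matrix.transpose_apply, LinearMap.toMatrix'_apply]
    simp only [dotProduct] at this
    convert this using 1
    · simp [Pi.single_apply, eq_comm]
  have h2 := measurePreserving_mulVec_of_orthogonal (mul_eq_one_comm.1 h1)
  have h3 : (fun x => M *ᵥ x) = g := by
    ext x : 1
    rw [hM, LinearMap.toMatrix'_mulVec]
  rwa [h3] at h2

lemma IsSphereMeasure.integral_integral_comp_mulVec {d d' : ℕ} {σ : Measure (Fin d → ℝ)}
    {σ' : Measure (Fin d' → ℝ)} (hσ : IsSphereMeasure d σ) (hσ' : IsSphereMeasure d' σ')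
    {Q : Matrix (Fin d) (Fin d) ℝ} {R : Matrix (Fin d') (Fin d') ℝ} (hQ : Q * Qᵀ = 1)
    (hR : R * Rᵀ = 1) {F : (Fin d → ℝ) → (Fin d' → ℝ) → ℝ}
    (hF : Continuous fun p : (Fin d → ℝ) × (Fin d' → ℝ) => F p.1 p.2) :
    ∫ x, ∫ y, F (Q *ᵥ x) (R *ᵥ y) ∂σ' ∂σ = ∫ x, ∫ y, F x y ∂σ' ∂σ := by
  have h1 : ∀ x, ∫ y, F (Q *ᵥ x) (R *ᵥ y) ∂σ' = ∫ y, F (Q *ᵥ x) y ∂σ' := fun x =>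
    hσ'.integral_comp_mulVec (f := fun y => F (Q *ᵥ x) y) hR
      (hF.comp (by fun_prop : Continuous fun y => (Q *ᵥ x, y)))
  simp only [h1]
  have := hσ'.prob
  have h2 := hσ.measurePreserving hQ
  have h3 : AEStronglyMeasurable (fun x => ∫ y, F x y ∂σ') σ :=
    (hσ.integrable_prod hσ' hF).integral_prod_left.aestronglyMeasurable
  conv_rhs => rw [← h2.map_eq]
  rw [integral_map h2.measurable.aemeasurable (by rw [h2.map_eq]; exact h3)]

namespace Family

variable {n m : ℕ} {isR : Bool} {D : ℕ} {σ₁ : Measure (Fin (2 * n) → ℝ)}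
  {σ₂ : Measure (Fin (2 * m) → ℝ)}
  {e : (Fin D → ℝ) → (Fin (2 * n) → ℝ) → (Fin (2 * m) → ℝ) → ℝ}

/-- Stability of a family under those orthogonal changes of variables that preserve symmetric
multiforms. -/
def IsStable (n m : ℕ) (isR : Bool)
    (e : (Fin D → ℝ) → (Fin (2 * n) → ℝ) → (Fin (2 * m) → ℝ) → ℝ) : Prop :=
  ∀ Q R, Q * Qᵀ = 1 → R * Rᵀ = 1 → ∀ a,
    HermEval n m isR (fun x y => e a (Q *ᵥ x) (R *ᵥ y)) →
      ∃ b, ∀ x y, e b x y = e a (Q *ᵥ x) (R *ᵥ y)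

/-- Parameters whose multiforms are at least `-1` on the product of spheres. -/
def posBall (e : (Fin D → ℝ) → (Fin (2 * n) → ℝ) → (Fin (2 * m) → ℝ) → ℝ) : Set (Fin D → ℝ) :=
  {a | ∀ x y, x ⬝ᵥ x = 1 → y ⬝ᵥ y = 1 → -1 ≤ e a x y}

lemma isClosed_posBall (h : Family n m isR D σ₁ σ₂ e) : IsClosed (posBall e) := by
  simp only [posBall, Set.ofPred_forall]
  refine isClosed_iInter fun x => isClosed_iInter fun y => isClosed_iInter fun _ =>
    isClosed_iInter fun _ => isClosed_le continuous_const ?_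
  exact h.continuous.comp (by fun_prop : Continuous fun a : Fin D → ℝ => (a, x, y))

lemma convex_posBall (h : Family n m isR D σ₁ σ₂ e) : Convex ℝ (posBall e) := by
  intro a ha b hb s t hs ht hst x y hx hy
  rw [h.add, h.smul, h.smul]
  have h1 := ha x y hx hy
  have h2 := hb x y hx hy
  nlinarith

lemma eq_of_eval_eq (h : Family n m isR D σ₁ σ₂ e) {a b : Fin D → ℝ}
    (hab : ∀ x y, x ⬝ᵥ x = 1 → y ⬝ᵥ y = 1 → e a x y = e b x y) : a = b := by
  have h1 : ∀ x y, x ⬝ᵥ x = 1 → y ⬝ᵥ y = 1 → e (a - b) x y = 0 := fun x y hx hy => by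
    rw [sub_eq_add_neg, h.add, h.neg, hab x y hx hy, add_neg_cancel]
  have h2 : (a - b) ⬝ᵥ (a - b) = 0 := by
    rw [← h.ip, ← integral_zero (Fin (2 * n) → ℝ) ℝ (μ := σ₁)]
    refine h.sphere₁.integral_congr fun x hx => ?_
    rw [← integral_zero (Fin (2 * m) → ℝ) ℝ (μ := σ₂)]
    exact h.sphere₂.integral_congr fun y hy => by rw [h1 x y hx hy, mul_zero]
  exact sub_eq_zero.1 (dotProduct_self_eq_zero.1 h2)

lemma exists_linear_of_stable (h : Family n m isR D σ₁ σ₂ e) (hs : IsStable n m isR e)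
    {Q : Matrix (Fin (2 * n)) (Fin (2 * n)) ℝ} {R : Matrix (Fin (2 * m)) (Fin (2 * m)) ℝ}
    (hQ : Q * Qᵀ = 1) (hR : R * Rᵀ = 1)
    (hQR : ∀ a, HermEval n m isR (fun x y => e a (Q *ᵥ x) (R *ᵥ y))) :
    ∃ g : (Fin D → ℝ) →ₗ[ℝ] (Fin D → ℝ), (∀ a b, g a ⬝ᵥ g b = a ⬝ᵥ b) ∧
      ∀ a x y, e (g a) x y = e a (Q *ᵥ x) (R *ᵥ y) := by
  choose g hg using fun a => hs Q R hQ hR a (hQR a)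
  refine ⟨{ toFun := g
            map_add' := fun a b => h.eq_of_eval_eq fun x y _ _ => by
              rw [hg, h.add, h.add, hg, hg]
            map_smul' := fun c a => h.eq_of_eval_eq fun x y _ _ => by
              rw [hg, h.smul, RingHom.id_apply, h.smul, hg] }, fun a b => ?_, hg⟩
  show g a ⬝ᵥ g b = a ⬝ᵥ b
  rw [← h.ip, ← h.ip]
  simp only [hg]
  exact h.sphere₁.integral_integral_comp_mulVec h.sphere₂ hQ hR
    (F := fun x y => e a x y * e b x y) ((h.herm a).continuous.mul (h.herm b).continuous)

lemma sum_signShift_eq_zero [NeZero n] [NeZero m] (h : Family n m isR D σ₁ σ₂ e)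
    (hmean : ∀ a, ∫ x, ∫ y, e a x y ∂σ₂ ∂σ₁ = 0) {a b : Fin D → ℝ}
    (hab : ∀ x y, e b x y = ∑ g, ∑ g', e a (signShift g *ᵥ x) (signShift g' *ᵥ y)) : b = 0 := by
  have := h.sphere₁.prob
  have := h.sphere₂.prob
  obtain ⟨G, hG⟩ := (h.herm a).exists_sum_signShift
  obtain ⟨G', hG'⟩ := (h.herm a).swap.exists_sum_signShift
  have h1 : ∀ x y, x ⬝ᵥ x = 1 → e b x y = ∑ g', G (signShift g' *ᵥ y) := fun x y hx => by
    rw [hab, Finset.sum_comm]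
    simp only [hG, hx, one_mul]
  have h2 : ∀ x y, y ⬝ᵥ y = 1 → e b x y = ∑ g, G' (signShift g *ᵥ x) := fun x y hy => by
    rw [hab]
    simp only [hG', hy, one_mul]
  refine h.eq_of_eval_eq fun x₀ y₀ hx₀ hy₀ => ?_
  have h3 : ∀ x y, x ⬝ᵥ x = 1 → y ⬝ᵥ y = 1 → e b x y = e b x₀ y₀ := fun x y hx hy => by
    rw [h1 x y hx, ← h1 x₀ y hx₀, h2 x₀ y hy, ← h2 x₀ y₀ hy₀]
  have h4 := hmean b
  rw [h.sphere₁.integral_congr (g := fun _ => e b x₀ y₀) fun x hx => ?_] at h4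
  · rw [integral_const, probReal_univ, one_smul] at h4
    rw [h4]
    have := h.smul 0 0 x₀ y₀
    simpa using this.symm
  · rw [h.sphere₂.integral_congr (g := fun _ => e b x₀ y₀) fun y hy => h3 x y hx hy]
    simp

lemma dotProduct_mulVec_self_of_orthogonal {d : ℕ} {Q : Matrix (Fin d) (Fin d) ℝ}
    (hQ : Q * Qᵀ = 1) (x : Fin d → ℝ) : (Q *ᵥ x) ⬝ᵥ (Q *ᵥ x) = x ⬝ᵥ x :=
  mulVec_dotProduct_mulVec_of_transpose_mul_eq_one (mul_eq_one_comm.1 hQ) x x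

theorem volume_posBall_le (h : Family n m isR D σ₁ σ₂ e) (hn : 0 < n) (hm : 0 < m)
    (hmean : ∀ a, ∫ x, ∫ y, e a x y ∂σ₂ ∂σ₁ = 0) (hs : IsStable n m isR e) :
    volume (posBall e) ≤ 2 ^ D * volume (supBall e) := by
  have : NeZero n := ⟨hn.ne'⟩
  have : NeZero m := ⟨hm.ne'⟩
  have hQR : ∀ (g : (Fin n → ℤˣ) × Fin n) (g' : (Fin m → ℤˣ) × Fin m) a,
      HermEval n m isR (fun x y => e a (signShift g *ᵥ x) (signShift g' *ᵥ y)) := fun g g' a =>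
    (((h.herm a).signShift_left g).swap.signShift_left g').swap
  choose L hL hLe using fun p : ((Fin n → ℤˣ) × Fin n) × ((Fin m → ℤˣ) × Fin m) =>
    h.exists_linear_of_stable hs (signShift_mul_transpose p.1) (signShift_mul_transpose p.2)
      (hQR p.1 p.2)
  have hsum : ∀ a, ∑ p, L p a = 0 := fun a => by
    refine h.sum_signShift_eq_zero (a := a) hmean fun x y => ?_
    rw [← Fintype.sum_prod_type']
    simp only [← hLe]
    let E : (Fin D → ℝ) →ₗ[ℝ] ℝ :=
      { toFun := fun a => e a x y
        map_add' := fun a b => h.add a b x y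
        map_smul' := fun c a => h.smul c a x y }
    exact map_sum E _ _
  have hinv : ∀ p a, L p a ∈ posBall e ↔ a ∈ posBall e := fun p a => by
    have hQ := signShift_mul_transpose p.1
    have hR := signShift_mul_transpose p.2
    constructor
    · intro ha x y hx hy
      have h1 := ha ((signShift p.1)ᵀ *ᵥ x) ((signShift p.2)ᵀ *ᵥ y)
        (by rw [dotProduct_mulVec_self_of_orthogonal
              (by rw [Matrix.transpose_transpose]; exact mul_eq_one_comm.1 hQ), hx])
        (by rw [dotProduct_mulVec_self_of_orthogonal
              (by rw [Matrix.transpose_transpose]; exact mul_eq_one_comm.1 hR), hy])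
      rwa [hLe, Matrix.mulVec_mulVec, Matrix.mulVec_mulVec, hQ, hR, Matrix.one_mulVec,
        Matrix.one_mulVec] at h1
    · intro ha x y hx hy
      rw [hLe]
      exact ha _ _ (by rw [dotProduct_mulVec_self_of_orthogonal hQ, hx])
        (by rw [dotProduct_mulVec_self_of_orthogonal hR, hy])
  have hK := h.isClosed_posBall.measurableSet
  have hball : ∀ k : ℕ, IsCompact {a : Fin D → ℝ | ∑ i, a i ^ 2 ≤ (k : ℝ) ^ 2} := fun k =>
    isCompact_sum_sq_le D k
  have hconv : ∀ k : ℕ, Convex ℝ {a : Fin D → ℝ | ∑ i, a i ^ 2 ≤ (k : ℝ) ^ 2} := fun k => by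
    have h1 : ConvexOn ℝ Set.univ fun a : Fin D → ℝ => ∑ i, a i ^ 2 := by
      refine ⟨convex_univ, fun a _ b _ s t hs ht hst => ?_⟩
      simp only [Pi.add_apply, Pi.smul_apply, smul_eq_mul, Finset.mul_sum]
      rw [← Finset.sum_add_distrib]
      refine Finset.sum_le_sum fun i _ => ?_
      obtain rfl : s = 1 - t := by linarith
      nlinarith [mul_nonneg (mul_nonneg hs ht) (sq_nonneg (a i - b i))]
    simpa using h1.convex_le ((k : ℝ) ^ 2)
  have hbound : ∀ k : ℕ, volume (posBall e ∩ {a | ∑ i, a i ^ 2 ≤ (k : ℝ) ^ 2}) ≤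
      2 ^ D * volume (supBall e) := fun k => by
    refine (volume_le_two_pow_mul_volume_inter_neg (hK.inter (hball k).measurableSet)
      (h.convex_posBall.inter (hconv k))
      ((measure_mono Set.inter_subset_right).trans_lt (hball k).measure_lt_top).ne L
      (fun p => measurePreserving_of_dotProduct_eq _ (hL p)) (fun p a => ?_) hsum).trans ?_
    · refine and_congr (hinv p a) ?_
      have h1 := hL p a a
      simp only [dotProduct, ← sq] at h1
      show ∑ i, (L p a) i ^ 2 ≤ (k : ℝ) ^ 2 ↔ ∑ i, a i ^ 2 ≤ (k : ℝ) ^ 2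
      rw [h1]
    · gcongr
      rintro a ⟨⟨h1, -⟩, h2⟩ x y hx hy
      have h3 := (Set.mem_neg.1 h2).1 x y hx hy
      rw [h.neg] at h3
      exact abs_le.2 ⟨h1 x y hx hy, by linarith⟩
  have hU : posBall e = ⋃ k : ℕ, posBall e ∩ {a | ∑ i, a i ^ 2 ≤ (k : ℝ) ^ 2} := by
    rw [← Set.inter_iUnion, eq_comm, Set.inter_eq_left]
    intro a _
    obtain ⟨k, hk⟩ := exists_nat_ge (∑ i, a i ^ 2 + 1)
    refine Set.mem_iUnion.2 ⟨k, ?_⟩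
    show ∑ i, a i ^ 2 ≤ (k : ℝ) ^ 2
    have : 0 ≤ ∑ i, a i ^ 2 := Finset.sum_nonneg fun i _ => sq_nonneg _
    nlinarith
  rw [hU, Monotone.measure_iUnion]
  · exact iSup_le hbound
  · intro k l hkl
    refine Set.inter_subset_inter_right _ fun a ha => ?_
    show ∑ i, a i ^ 2 ≤ (l : ℝ) ^ 2
    refine le_trans (show ∑ i, a i ^ 2 ≤ (k : ℝ) ^ 2 from ha) ?_
    have : (k : ℝ) ≤ l := by exact_mod_cast hkl
    gcongr

end Family

section Homogeneity

variable {n m : ℕ} {isR : Bool} {F : (Fin (2 * n) → ℝ) → (Fin (2 * m) → ℝ) → ℝ}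

lemma HermEval.smul_left (h : HermEval n m isR F) (c : ℝ) (x : Fin (2 * n) → ℝ)
    (y : Fin (2 * m) → ℝ) : F (c • x) y = c ^ 2 * F x y := by
  have hq := h.mem_range_quadLin y
  have e1 := dotProduct_quadMat_mulVec hq (c • x)
  have e2 := dotProduct_quadMat_mulVec hq x
  rw [← e1, ← e2, Matrix.mulVec_smul, smul_dotProduct, dotProduct_smul, smul_eq_mul,
    smul_eq_mul, sq, mul_assoc]

lemma exists_unit_smul_eq {d : ℕ} {x : Fin d → ℝ} (hx : x ≠ 0) :
    ∃ (c : ℝ) (u : Fin d → ℝ), u ⬝ᵥ u = 1 ∧ c • u = x := by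
  have hpos : 0 < x ⬝ᵥ x :=
    lt_of_le_of_ne (Finset.sum_nonneg fun i _ => mul_self_nonneg _) fun h0 =>
      hx (dotProduct_self_eq_zero.1 h0.symm)
  have hr0 : 0 < √(x ⬝ᵥ x) := Real.sqrt_pos.2 hpos
  refine ⟨√(x ⬝ᵥ x), (√(x ⬝ᵥ x))⁻¹ • x, ?_, smul_inv_smul₀ hr0.ne' x⟩
  rw [smul_dotProduct, dotProduct_smul, smul_eq_mul, smul_eq_mul]
  nth_rw 3 [← Real.mul_self_sqrt hpos.le]
  field_simp

lemma HermEval.nonneg_left (h : HermEval n m isR F) {y : Fin (2 * m) → ℝ}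
    (hF : ∀ x, x ⬝ᵥ x = 1 → 0 ≤ F x y) (x : Fin (2 * n) → ℝ) : 0 ≤ F x y := by
  by_cases hx : x = 0
  · have := h.smul_left 0 x y
    rw [zero_smul, sq, zero_mul, zero_mul] at this
    rw [hx, this]
  · obtain ⟨c, u, hu, rfl⟩ := exists_unit_smul_eq hx
    rw [h.smul_left]
    exact mul_nonneg (sq_nonneg c) (hF u hu)

lemma HermEval.nonneg (h : HermEval n m isR F)
    (hF : ∀ x y, x ⬝ᵥ x = 1 → y ⬝ᵥ y = 1 → 0 ≤ F x y) (x : Fin (2 * n) → ℝ)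
    (y : Fin (2 * m) → ℝ) : 0 ≤ F x y :=
  h.nonneg_left (fun x hx => h.swap.nonneg_left (fun y hy => hF x y hx hy) y) x

end Homogeneity

/-- The linear change of variables `(x, y) ↦ (Q x, R y)`. -/
def linSubst {d d' : ℕ} (Q : Matrix (Fin d) (Fin d) ℝ) (R : Matrix (Fin d') (Fin d') ℝ)
    (f : MvPolynomial (Fin d ⊕ Fin d') ℝ) : MvPolynomial (Fin d ⊕ Fin d') ℝ :=
  aeval (Sum.elim (fun i => ∑ k, C (Q i k) * X (Sum.inl k))
    (fun i => ∑ k, C (R i k) * X (Sum.inr k))) f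

lemma beval_linSubst {d d' : ℕ} (Q : Matrix (Fin d) (Fin d) ℝ) (R : Matrix (Fin d') (Fin d') ℝ)
    (f : MvPolynomial (Fin d ⊕ Fin d') ℝ) (x : Fin d → ℝ) (y : Fin d' → ℝ) :
    beval (linSubst Q R f) x y = beval f (Q *ᵥ x) (R *ᵥ y) := by
  have h : (eval (Sum.elim x y)).comp ((aeval (Sum.elim (fun i => ∑ k, C (Q i k) * X (Sum.inl k))
      (fun i => ∑ k, C (R i k) * X (Sum.inr k))) :
        MvPolynomial (Fin d ⊕ Fin d') ℝ →ₐ[ℝ] MvPolynomial (Fin d ⊕ Fin d') ℝ) : _ →+* _) =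
      eval (Sum.elim (Q *ᵥ x) (R *ᵥ y)) := by
    refine MvPolynomial.ringHom_ext (fun r => by simp) fun i => ?_
    rcases i with i | i <;> simp [Matrix.mulVec, dotProduct]
  exact congrArg (fun φ : MvPolynomial (Fin d ⊕ Fin d') ℝ →+* ℝ => φ f) h

lemma beval_qpoly {d d' : ℕ} (x : Fin d → ℝ) (y : Fin d' → ℝ) :
    beval (qpoly d d' 1 1) x y = (x ⬝ᵥ x) * (y ⬝ᵥ y) := by
  simp [beval, qpoly, dotProduct, sq]

lemma beval_add {d d' : ℕ} (f g : MvPolynomial (Fin d ⊕ Fin d') ℝ) (x : Fin d → ℝ)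
    (y : Fin d' → ℝ) : beval (f + g) x y = beval f x y + beval g x y := map_add _ _ _

section Param

variable {n m : ℕ} {isR : Bool} {D : ℕ} {σ₁ : Measure (Fin (2 * n) → ℝ)}
  {σ₂ : Measure (Fin (2 * m) → ℝ)}
  {ψ : (Fin D → ℝ) →ₗ[ℝ] MvPolynomial (Fin (2 * n) ⊕ Fin (2 * m)) ℝ}

lemma IsUnitaryParam.mem_MCF (hψ : IsUnitaryParam (2 * n) (2 * m) D σ₁ σ₂ (MCF n m isR σ₁ σ₂) ψ)
    (a : Fin D → ℝ) : ψ a ∈ MCF n m isR σ₁ σ₂ := hψ.range ▸ Set.mem_range_self a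

lemma IsUnitaryParam.family (hσ₁ : IsSphereMeasure (2 * n) σ₁) (hσ₂ : IsSphereMeasure (2 * m) σ₂)
    (hψ : IsUnitaryParam (2 * n) (2 * m) D σ₁ σ₂ (MCF n m isR σ₁ σ₂) ψ) :
    Family n m isR D σ₁ σ₂ fun a => beval (ψ a) where
  sphere₁ := hσ₁
  sphere₂ := hσ₂
  herm a := mem_CF_iff.1 (hψ.mem_MCF a).1
  add a b x y := by rw [map_add, beval_add]
  smul c a x y := by simp [beval, map_smul, smul_eval]
  ip := hψ.ip

lemma IsUnitaryParam.isStable (hσ₁ : IsSphereMeasure (2 * n) σ₁)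
    (hσ₂ : IsSphereMeasure (2 * m) σ₂)
    (hψ : IsUnitaryParam (2 * n) (2 * m) D σ₁ σ₂ (MCF n m isR σ₁ σ₂) ψ) :
    Family.IsStable n m isR fun a => beval (ψ a) := by
  intro Q R hQ hR a hQR
  have hc : Continuous fun p : (Fin (2 * n) → ℝ) × (Fin (2 * m) → ℝ) => beval (ψ a) p.1 p.2 :=
    ((hψ.family hσ₁ hσ₂).herm a).continuous
  have hmem : linSubst Q R (ψ a) ∈ MCF n m isR σ₁ σ₂ := by
    refine ⟨mem_CF_iff.2 ?_, ?_⟩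
    · convert hQR using 3 with x y
      exact beval_linSubst Q R _ x y
    · rw [← (hψ.mem_MCF a).2]
      simp only [bavg, beval_linSubst]
      exact hσ₁.integral_integral_comp_mulVec hσ₂ hQ hR (F := beval (ψ a)) hc
  rw [← hψ.range] at hmem
  obtain ⟨b, hb⟩ := hmem
  exact ⟨b, fun x y => by simp only [hb, beval_linSubst]⟩

lemma IsUnitaryParam.preimage_tildeCF (hσ₁ : IsSphereMeasure (2 * n) σ₁)
    (hσ₂ : IsSphereMeasure (2 * m) σ₂)
    (hψ : IsUnitaryParam (2 * n) (2 * m) D σ₁ σ₂ (MCF n m isR σ₁ σ₂) ψ) :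
    ψ ⁻¹' tildeCF n m isR σ₁ σ₂ (PosCF n m isR) = Family.posBall fun a => beval (ψ a) := by
  ext a
  have hherm : HermEval n m isR (beval (ψ a + qpoly (2 * n) (2 * m) 1 1)) := by
    convert ((hψ.family hσ₁ hσ₂).herm a).add (HermEval.dotProduct_mul_dotProduct n m isR) using 3
      with x y
    rw [beval_add, beval_qpoly]
  constructor
  · rintro ⟨-, -, h⟩ x y hx hy
    have := h x y
    rw [beval_add, beval_qpoly, hx, hy] at this
    show -1 ≤ beval (ψ a) x y
    linarith
  · intro h
    refine ⟨hψ.mem_MCF a, mem_CF_iff.2 hherm, hherm.nonneg fun x y hx hy => ?_⟩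
    have : -1 ≤ beval (ψ a) x y := h x y hx hy
    rw [beval_add, beval_qpoly, hx, hy]
    linarith

lemma IsUnitaryParam.preimage_ballCF
    (hψ : IsUnitaryParam (2 * n) (2 * m) D σ₁ σ₂ (MCF n m isR σ₁ σ₂) ψ) :
    ψ ⁻¹' ballCF n m isR σ₁ σ₂ = {a | ∑ i, a i ^ 2 ≤ 1} := by
  ext a
  have : bip σ₁ σ₂ (ψ a) (ψ a) = ∑ i, a i ^ 2 := by simp only [hψ.ip, sq]
  constructor
  · rintro ⟨-, h⟩
    rwa [this] at h
  · intro h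
    exact ⟨hψ.mem_MCF a, by rw [this]; exact h⟩

end Param

/-- The reproducing kernel bound for `2k`-th powers of symmetric multiforms. -/
lemma HermEval.pow_le {n m : ℕ} {isR : Bool} {F : (Fin (2 * n) → ℝ) → (Fin (2 * m) → ℝ) → ℝ}
    (h : HermEval n m isR F) {σ₁ : Measure (Fin (2 * n) → ℝ)} {σ₂ : Measure (Fin (2 * m) → ℝ)}
    (hσ₁ : IsSphereMeasure (2 * n) σ₁) (hσ₂ : IsSphereMeasure (2 * m) σ₂) (k : ℕ)
    {x : Fin (2 * n) → ℝ} {y : Fin (2 * m) → ℝ} (hx : x ⬝ᵥ x = 1) (hy : y ⬝ᵥ y = 1) :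
    F x y ^ (2 * k) ≤ ((2 * n + 2 * k - 1).choose (2 * k) : ℕ) *
      (((2 * m + 2 * k - 1).choose (2 * k) : ℕ) * ∫ x, ∫ y, F x y ^ (2 * k) ∂σ₂ ∂σ₁) := by
  have := hσ₂.prob
  have hc : Continuous fun p : (Fin (2 * n) → ℝ) × (Fin (2 * m) → ℝ) => F p.1 p.2 ^ (2 * k) :=
    h.continuous.pow _
  have h1 := hσ₁.quadratic_pow_le (quadMat fun x => F x y) k hx
  simp only [dotProduct_quadMat_mulVec (h.mem_range_quadLin y)] at h1
  have h2 : ∀ x, F x y ^ (2 * k) ≤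
      ((2 * m + 2 * k - 1).choose (2 * k) : ℕ) * ∫ y, F x y ^ (2 * k) ∂σ₂ := fun x => by
    have := hσ₂.quadratic_pow_le (quadMat fun y => F x y) k hy
    simpa only [dotProduct_quadMat_mulVec (h.swap.mem_range_quadLin x)] using this
  refine h1.trans (mul_le_mul_of_nonneg_left ?_ (Nat.cast_nonneg _))
  rw [← integral_const_mul]
  exact integral_mono
    (hσ₁.integrable (hc.comp (by fun_prop : Continuous fun x => (x, y))))
    ((hσ₁.integrable_prod hσ₂ hc).integral_prod_left.const_mul _) h2

namespace Family

variable {n m : ℕ} {isR : Bool} {D : ℕ} {σ₁ : Measure (Fin (2 * n) → ℝ)}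
  {σ₂ : Measure (Fin (2 * m) → ℝ)}
  {e : (Fin D → ℝ) → (Fin (2 * n) → ℝ) → (Fin (2 * m) → ℝ) → ℝ}

lemma measurable_pow (h : Family n m isR D σ₁ σ₂ e) (k : ℕ) :
    Measurable fun p : (Fin D → ℝ) × (Fin (2 * n) → ℝ) × (Fin (2 * m) → ℝ) =>
      ENNReal.ofReal (e p.1 p.2.1 p.2.2 ^ (2 * k)) :=
  (h.continuous.pow _).measurable.ennreal_ofReal

lemma lintegral_eval_pow_le (h : Family n m isR D σ₁ σ₂ e) (hD : 0 < D) (k : ℕ)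
    {x : Fin (2 * n) → ℝ} {y : Fin (2 * m) → ℝ} (hx : x ⬝ᵥ x = 1) (hy : y ⬝ᵥ y = 1) :
    ∫⁻ a in {a : Fin D → ℝ | ∑ i, a i ^ 2 ≤ 1}, ENNReal.ofReal (e a x y ^ (2 * k)) ≤
      ENNReal.ofReal ((((n : ℝ) * m) ^ 2) ^ k * ((k : ℝ) / D) ^ k) *
        volume {x : Fin D → ℝ | ∑ i, x i ^ 2 ≤ 1} := by
  set φ : Fin D → ℝ := fun p => e (Pi.single p 1) x y with hφ
  have he : ∀ a, e a x y = φ ⬝ᵥ a := fun a => by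
    rw [h.eval_eq_sum, dotProduct]
    exact Finset.sum_congr rfl fun p _ => mul_comm _ _
  have hφ0 : 0 ≤ φ ⬝ᵥ φ := Finset.sum_nonneg fun i _ => mul_self_nonneg _
  have hφ1 : φ ⬝ᵥ φ ≤ ((n : ℝ) * m) ^ 2 := by
    have := h.sq_le φ hx hy
    rw [he] at this
    rcases hφ0.eq_or_lt with h0 | h0
    · rw [← h0]; positivity
    · exact le_of_mul_le_mul_right (by rwa [sq] at this) h0
  simp only [he]
  refine (lintegral_dotProduct_pow_le hD φ).trans ?_
  gcongr

/-- The `2k`-th moment of a multiform on the product of spheres. -/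
def moment (σ₁ : Measure (Fin (2 * n) → ℝ)) (σ₂ : Measure (Fin (2 * m) → ℝ))
    (e : (Fin D → ℝ) → (Fin (2 * n) → ℝ) → (Fin (2 * m) → ℝ) → ℝ) (k : ℕ) (a : Fin D → ℝ) :
    ℝ≥0∞ :=
  ∫⁻ p, ENNReal.ofReal (e a p.1 p.2 ^ (2 * k)) ∂σ₁.prod σ₂

lemma measurable_moment (h : Family n m isR D σ₁ σ₂ e) (k : ℕ) :
    Measurable (moment σ₁ σ₂ e k) := by
  have := h.sphere₁.prob
  have := h.sphere₂.prob
  exact (h.measurable_pow k).lintegral_prod_right'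

lemma lintegral_moment_le (h : Family n m isR D σ₁ σ₂ e) (hD : 0 < D) (k : ℕ) :
    ∫⁻ a in {a : Fin D → ℝ | ∑ i, a i ^ 2 ≤ 1}, moment σ₁ σ₂ e k a ≤
      ENNReal.ofReal ((((n : ℝ) * m) ^ 2) ^ k * ((k : ℝ) / D) ^ k) *
        volume {x : Fin D → ℝ | ∑ i, x i ^ 2 ≤ 1} := by
  have := h.sphere₁.prob
  have := h.sphere₂.prob
  simp only [moment]
  rw [lintegral_lintegral_swap (h.measurable_pow k).aemeasurable]
  refine (lintegral_mono_ae (g := fun _ => ENNReal.ofReal ((((n : ℝ) * m) ^ 2) ^ k *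
    ((k : ℝ) / D) ^ k) * volume {x : Fin D → ℝ | ∑ i, x i ^ 2 ≤ 1}) ?_).trans_eq (by simp)
  filter_upwards [Measure.quasiMeasurePreserving_fst.ae h.sphere₁.ae_mem,
    Measure.quasiMeasurePreserving_snd.ae h.sphere₂.ae_mem] with p hp hp'
  exact h.lintegral_eval_pow_le hD k (mem_unitSphere.1 hp) (mem_unitSphere.1 hp')

lemma ofReal_eval_pow_le (h : Family n m isR D σ₁ σ₂ e) (k : ℕ) (a : Fin D → ℝ)
    {x : Fin (2 * n) → ℝ} {y : Fin (2 * m) → ℝ} (hx : x ⬝ᵥ x = 1) (hy : y ⬝ᵥ y = 1) :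
    ENNReal.ofReal (e a x y ^ (2 * k)) ≤
      ENNReal.ofReal (((2 * n + 2 * k - 1).choose (2 * k) : ℕ) *
        ((2 * m + 2 * k - 1).choose (2 * k) : ℕ)) * moment σ₁ σ₂ e k a := by
  have := h.sphere₁.prob
  have := h.sphere₂.prob
  have hi : Integrable (fun p : (Fin (2 * n) → ℝ) × (Fin (2 * m) → ℝ) => e a p.1 p.2 ^ (2 * k))
      (σ₁.prod σ₂) := h.sphere₁.integrable_prod h.sphere₂ ((h.herm a).continuous.pow (2 * k))
  rw [moment, ← ofReal_integral_eq_lintegral_ofReal hi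
    (Filter.Eventually.of_forall fun p => (even_two_mul k).pow_nonneg _),
    ← ENNReal.ofReal_mul (by positivity), integral_prod _ hi, mul_assoc]
  exact ENNReal.ofReal_le_ofReal ((h.herm a).pow_le h.sphere₁ h.sphere₂ k hx hy)

theorem le_volume_posBall (h : Family n m isR D σ₁ σ₂ e) (hn : 0 < n) (hm : 0 < m) (hD : 0 < D)
    {k : ℕ} (hk : 0 < k) {r : ℝ} (hr : 0 < r)
    (hr' : ((2 * n + 2 * k - 1).choose (2 * k) : ℕ) * ((2 * m + 2 * k - 1).choose (2 * k) : ℕ) *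
      r ^ (2 * k) * ((((n : ℝ) * m) ^ 2) ^ k * ((k : ℝ) / D) ^ k) ≤ 1 / 2) :
    ENNReal.ofReal (r ^ D / 2) * volume {x : Fin D → ℝ | ∑ i, x i ^ 2 ≤ 1} ≤
      volume (posBall e) := by
  set N : ℝ := ((2 * n + 2 * k - 1).choose (2 * k) : ℕ) * ((2 * m + 2 * k - 1).choose (2 * k) : ℕ)
    with hN
  have hN0 : 0 < N := by
    have h1 := Nat.choose_pos (show 2 * k ≤ 2 * n + 2 * k - 1 by omega)
    have h2 := Nat.choose_pos (show 2 * k ≤ 2 * m + 2 * k - 1 by omega)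
    positivity
  set B : Set (Fin D → ℝ) := {x | ∑ i, x i ^ 2 ≤ 1} with hB
  have hBm : MeasurableSet B := by
    have := isCompact_sum_sq_le D 1
    rw [one_pow] at this
    exact this.measurableSet
  have hBt : volume B ≠ ⊤ := volume_unit_ball_ne_top D
  set c : ℝ := N * r ^ (2 * k) with hc
  have hc0 : 0 < c := by positivity
  set P := moment σ₁ σ₂ e k with hP
  have hPm : Measurable P := h.measurable_moment k
  set A : Set (Fin D → ℝ) := {a | ENNReal.ofReal c⁻¹ ≤ P a} with hA
  have hAm : MeasurableSet A := measurableSet_le measurable_const hPm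
  have hAB : volume (A ∩ B) ≤ ENNReal.ofReal (1 / 2) * volume B := by
    have h1 := mul_meas_ge_le_lintegral (μ := volume.restrict B) hPm (ENNReal.ofReal c⁻¹)
    have h2 := h1.trans (h.lintegral_moment_le hD k)
    rw [← hA, Measure.restrict_apply hAm] at h2
    calc volume (A ∩ B) = ENNReal.ofReal c * (ENNReal.ofReal c⁻¹ * volume (A ∩ B)) := by
          rw [← mul_assoc, ← ENNReal.ofReal_mul hc0.le, mul_inv_cancel₀ hc0.ne',
            ENNReal.ofReal_one, one_mul]
      _ ≤ _ := mul_le_mul_right h2 _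
      _ ≤ _ := by
          rw [← mul_assoc, ← ENNReal.ofReal_mul hc0.le]
          gcongr
  have hBA : ENNReal.ofReal (1 / 2) * volume B ≤ volume (B \ A) := by
    have h1 : volume B = volume (A ∩ B) + volume (B \ A) := by
      rw [← measure_inter_add_sdiff B hAm, Set.inter_comm]
    have h2 : ENNReal.ofReal (1 / 2) * volume B + ENNReal.ofReal (1 / 2) * volume B = volume B := by
      rw [← add_mul, ← ENNReal.ofReal_add (by norm_num) (by norm_num)]
      norm_num
    have h3 : ENNReal.ofReal (1 / 2) * volume B ≠ ⊤ := ENNReal.mul_ne_top ENNReal.ofReal_ne_top hBt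
    rw [← ENNReal.add_le_add_iff_left h3, h2]
    calc volume B = volume (A ∩ B) + volume (B \ A) := h1
      _ ≤ _ := by gcongr
  have hsub : r • (B \ A) ⊆ posBall e := by
    rintro _ ⟨a, ⟨-, ha⟩, rfl⟩ x y hx hy
    have ha' : P a < ENNReal.ofReal c⁻¹ := not_le.1 ha
    have h1 := h.ofReal_eval_pow_le k a hx hy
    have h2 : ENNReal.ofReal (e a x y ^ (2 * k)) ≤ ENNReal.ofReal (N * c⁻¹) := by
      rw [ENNReal.ofReal_mul hN0.le]
      exact h1.trans (by gcongr)
    rw [ENNReal.ofReal_le_ofReal_iff (by positivity)] at h2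
    have h3 : e (r • a) x y ^ (2 * k) ≤ 1 := by
      rw [h.smul, mul_pow]
      calc r ^ (2 * k) * e a x y ^ (2 * k) ≤ r ^ (2 * k) * (N * c⁻¹) := by gcongr
        _ = 1 := by rw [hc]; field_simp
    rw [pow_mul] at h3
    have h4 : e (r • a) x y ^ 2 ≤ 1 := (pow_le_one_iff_of_nonneg (sq_nonneg _) hk.ne').1 h3
    exact (abs_le.1 ((sq_le_one_iff_abs_le_one _).1 h4)).1
  calc _ = ENNReal.ofReal (r ^ D) * (ENNReal.ofReal (1 / 2) * volume B) := by
        rw [← mul_assoc, ← ENNReal.ofReal_mul (by positivity), mul_one_div]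
    _ ≤ ENNReal.ofReal (r ^ D) * volume (B \ A) := by gcongr
    _ = volume (r • (B \ A)) := by
        rw [Measure.addHaar_smul, Module.finrank_fin_fun, abs_of_pos (by positivity)]
    _ ≤ _ := measure_mono hsub

end Family

lemma choose_twenty_le {M : ℕ} (hM : 0 < M) :
    ((20 * M - 1).choose (18 * M) : ℝ) ≤ 1 / 10 * (10 ^ 20 / 9 ^ 18) ^ M := by
  have h1 : (20 * M - 1).choose (18 * M) * (20 * M) = (20 * M).choose (18 * M) * (2 * M) := by
    have := Nat.choose_mul_succ_eq (20 * M - 1) (18 * M)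
    rwa [show 20 * M - 1 + 1 = 20 * M by omega, show 20 * M - 18 * M = 2 * M by omega] at this
  have h2 : (9 : ℝ) ^ (18 * M) * (20 * M).choose (18 * M) ≤ 10 ^ (20 * M) := by
    have h := add_pow (9 : ℝ) 1 (20 * M)
    simp only [one_pow, mul_one] at h
    rw [show (9 : ℝ) + 1 = 10 by norm_num] at h
    rw [h]
    exact Finset.single_le_sum (f := fun i => (9 : ℝ) ^ i * (20 * M).choose i)
      (fun i _ => by positivity) (Finset.mem_range.2 (by omega))
  have h3 : ((20 * M - 1).choose (18 * M) : ℝ) = 1 / 10 * (20 * M).choose (18 * M) := by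
    have hM' : (0 : ℝ) < M := by exact_mod_cast hM
    have h : ((20 * M - 1).choose (18 * M) : ℝ) * (20 * M) = (20 * M).choose (18 * M) * (2 * M) :=
      by
      exact_mod_cast h1
    have h' : (((20 * M - 1).choose (18 * M) : ℝ) * 10) * (2 * M) =
      (20 * M).choose (18 * M) * (2 * M) := by rw [← h]; ring
    have := mul_right_cancel₀ (by positivity) h'
    linarith
  rw [h3, div_pow, ← pow_mul, ← pow_mul]
  gcongr
  rw [le_div_iff₀ (by positivity), mul_comm]
  exact h2

lemma choose_two_mul_le {n M : ℕ} (hM : 0 < M) (hn : n ≤ M) :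
    ((2 * n + 2 * (9 * M) - 1).choose (2 * (9 * M)) : ℝ) ≤ 1 / 10 * (10 ^ 20 / 9 ^ 18) ^ M := by
  refine le_trans ?_ (choose_twenty_le hM)
  rw [← mul_assoc]
  exact_mod_cast Nat.choose_le_choose _ (by omega)

lemma rpow_mul_rpow_pow (M : ℝ) (hM : 0 < M) :
    ((3 : ℝ) ^ 3 * (10 : ℝ) ^ (-(20 : ℝ) / 9) * (2 : ℝ) ^ (-(1 : ℝ) / 2) *
      M ^ (-(1 : ℝ) / 2)) ^ 18 = 27 ^ 18 / 10 ^ 40 / (2 * M) ^ 9 := by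
  have h : ∀ (b : ℝ) (s : ℝ) (j : ℕ), 0 < b → s * 18 = -j → (b ^ s) ^ 18 = (b ^ j)⁻¹ := by
    intro b s j hb hs
    rw [← Real.rpow_mul_natCast hb.le, Nat.cast_ofNat, hs, Real.rpow_neg hb.le, Real.rpow_natCast]
  rw [mul_pow, mul_pow, mul_pow, h 10 _ 40 (by norm_num) (by norm_num),
    h 2 _ 9 (by norm_num) (by norm_num), h M _ 9 hM (by norm_num)]
  field_simp
  norm_num

lemma eighteen_mul_le_DCF {n m : ℕ} (hn : 3 ≤ n) (hm : 3 ≤ m) (isR : Bool) :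
    18 * max n m ≤ 2 * DCF n m isR := by
  have h := le_cast_DCF hn hm isR
  have hn' : (3 : ℝ) ≤ n := by exact_mod_cast hn
  have hm' : (3 : ℝ) ≤ m := by exact_mod_cast hm
  have h3 : (3 : ℝ) * (max n m : ℕ) ≤ n * m := by
    rcases le_total n m with h | h
    · rw [max_eq_right h]; gcongr
    · rw [max_eq_left h, mul_comm]; gcongr
  have h9 : (3 : ℝ) ≤ (max n m : ℕ) := by exact_mod_cast hn.trans (le_max_left n m)
  have : (18 * (max n m : ℕ) : ℝ) ≤ 2 * DCF n m isR := by nlinarith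
  exact_mod_cast this

lemma sq_mul_le_DCF {n m : ℕ} (hn : 3 ≤ n) (hm : 3 ≤ m) (isR : Bool) :
    ((n : ℝ) * m) ^ 2 ≤ 2 * DCF n m isR := by
  have h := le_cast_DCF hn hm isR
  have hn' : (3 : ℝ) ≤ n := by exact_mod_cast hn
  have hm' : (3 : ℝ) ≤ m := by exact_mod_cast hm
  have : (9 : ℝ) ≤ n * m := by nlinarith
  nlinarith

namespace Family

variable {n m : ℕ} {isR : Bool} {σ₁ : Measure (Fin (2 * n) → ℝ)} {σ₂ : Measure (Fin (2 * m) → ℝ)}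
  {e : (Fin (DCF n m isR) → ℝ) → (Fin (2 * n) → ℝ) → (Fin (2 * m) → ℝ) → ℝ}

theorem pow_mul_volume_unit_ball_le (h : Family n m isR (DCF n m isR) σ₁ σ₂ e) (hn : 3 ≤ n)
    (hm : 3 ≤ m) :
    ENNReal.ofReal (((3 : ℝ) ^ 3 * (10 : ℝ) ^ (-(20 : ℝ) / 9) * (2 : ℝ) ^ (-(1 : ℝ) / 2) *
        ((max n m : ℕ) : ℝ) ^ (-(1 : ℝ) / 2)) ^ DCF n m isR) *
      volume {x : Fin (DCF n m isR) → ℝ | ∑ i, x i ^ 2 ≤ 1} ≤ volume (posBall e) := by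
  set M := max n m with hM
  have hM0 : 0 < M := by omega
  have hM0' : (0 : ℝ) < M := by exact_mod_cast hM0
  set r : ℝ := (3 : ℝ) ^ 3 * (10 : ℝ) ^ (-(20 : ℝ) / 9) * (2 : ℝ) ^ (-(1 : ℝ) / 2) *
    (M : ℝ) ^ (-(1 : ℝ) / 2) with hr
  have hr0 : 0 < r := by positivity
  have hr18 : r ^ 18 = 27 ^ 18 / 10 ^ 40 / (2 * M) ^ 9 := rpow_mul_rpow_pow M hM0'
  have hMD := eighteen_mul_le_DCF hn hm isR
  have hnm := sq_mul_le_DCF hn hm isR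
  set D := DCF n m isR with hD
  have hD0 : 0 < D := by omega
  have hD0' : (0 : ℝ) < D := by exact_mod_cast hD0
  set t : ℝ := 2 ^ ((1 : ℝ) / D) with ht
  have ht1 : 1 ≤ t := Real.one_le_rpow (by norm_num) (by positivity)
  have htD : t ^ D = 2 := by
    rw [ht, ← Real.rpow_mul_natCast (by norm_num), one_div_mul_cancel hD0'.ne', Real.rpow_one]
  have htM : t ^ (2 * (9 * M)) ≤ 4 := by
    calc t ^ (2 * (9 * M)) ≤ t ^ (D * 2) := pow_le_pow_right₀ ht1 (by omega)
      _ = 4 := by rw [pow_mul, htD]; norm_num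
  have key := h.le_volume_posBall (by omega) (by omega) hD0 (k := 9 * M) (by omega)
    (r := r * t) (by positivity) ?_
  · rwa [mul_pow, htD, mul_div_cancel_right₀ _ (two_ne_zero' ℝ)] at key
  have h1 := choose_two_mul_le hM0 (le_max_left n m)
  have h2 := choose_two_mul_le hM0 (le_max_right n m)
  have h3 : (((n : ℝ) * m) ^ 2) ^ (9 * M) * (((9 * M : ℕ) : ℝ) / D) ^ (9 * M) ≤
      ((18 * M : ℝ) ^ 9) ^ M := by
    rw [← mul_pow, ← pow_mul]
    refine pow_le_pow_left₀ (by positivity) ?_ _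
    rw [← mul_div_assoc, div_le_iff₀ hD0']
    push_cast
    nlinarith
  calc _ ≤ (1 / 10 * (10 ^ 20 / 9 ^ 18) ^ M) * (1 / 10 * (10 ^ 20 / 9 ^ 18) ^ M) *
        ((r ^ 18) ^ M * 4) * ((18 * M : ℝ) ^ 9) ^ M := by
        rw [mul_pow r t, ← pow_mul r, show 18 * M = 2 * (9 * M) by ring]
        gcongr
    _ = 4 / 100 * ((10 ^ 20 / 9 ^ 18) * (10 ^ 20 / 9 ^ 18) * r ^ 18 * (18 * M : ℝ) ^ 9) ^ M := by
        simp only [mul_pow]; ring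
    _ = 4 / 100 * 1 ^ M := by
        congr 2
        rw [hr18]
        field_simp
        norm_num
    _ ≤ 1 / 2 := by norm_num

theorem volume_posBall_le_pow_mul (h : Family n m isR (DCF n m isR) σ₁ σ₂ e) (hn : 3 ≤ n)
    (hm : 3 ≤ m) (hmean : ∀ a, ∫ x, ∫ y, e a x y ∂σ₂ ∂σ₁ = 0) (hs : IsStable n m isR e) :
    volume (posBall e) ≤
      ENNReal.ofReal ((2 * √(min (1 / (1 + (n : ℝ))) (1 / (1 + (m : ℝ))))) ^ DCF n m isR) *
        volume {x : Fin (DCF n m isR) → ℝ | ∑ i, x i ^ 2 ≤ 1} := by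
  have hsup : ENNReal.ofReal (√((max n m : ℕ) + 1) ^ DCF n m isR) * volume (supBall e) ≤
      volume {x : Fin (DCF n m isR) → ℝ | ∑ i, x i ^ 2 ≤ 1} := by
    rcases le_total n m with hnm | hnm
    · rw [max_eq_right hnm]
      have key : ∀ (D : ℕ) (hD : D = DCF m n isR)
          (e : (Fin D → ℝ) → (Fin (2 * n) → ℝ) → (Fin (2 * m) → ℝ) → ℝ),
          Family n m isR D σ₁ σ₂ e → ENNReal.ofReal (√(m + 1) ^ D) * volume (supBall e) ≤
            volume {x : Fin D → ℝ | ∑ i, x i ^ 2 ≤ 1} := by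
        rintro D rfl e h
        have h1 := h.swap.sqrt_pow_mul_volume_supBall_le hm hn
        have h2 : supBall (fun a y x => e a x y) = supBall e := by
          ext a
          exact ⟨fun ha x y hx hy => ha y x hy hx, fun ha x y hx hy => ha y x hy hx⟩
        rwa [h2] at h1
      exact key _ (DCF_comm n m isR) e h
    · rw [max_eq_left hnm]
      exact h.sqrt_pow_mul_volume_supBall_le hn hm
  have hmin : √(min (1 / (1 + (n : ℝ))) (1 / (1 + (m : ℝ)))) = (√((max n m : ℕ) + 1))⁻¹ := by
    rw [← Real.sqrt_inv]
    congr 1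
    rcases le_total n m with hnm | hnm
    · have : (n : ℝ) ≤ m := by exact_mod_cast hnm
      rw [max_eq_right hnm, min_eq_right (by gcongr), one_div, add_comm]
    · have : (m : ℝ) ≤ n := by exact_mod_cast hnm
      rw [max_eq_left hnm, min_eq_left (by gcongr), one_div, add_comm]
  have hpos : 0 < √(((max n m : ℕ) : ℝ) + 1) := Real.sqrt_pos.2 (by positivity)
  rw [hmin, mul_pow, ENNReal.ofReal_mul (by positivity), mul_assoc,
    ENNReal.ofReal_pow (by norm_num), ENNReal.ofReal_ofNat]
  refine (h.volume_posBall_le (by omega) (by omega) hmean hs).trans (mul_le_mul_right ?_ _)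
  calc volume (supBall e) = ENNReal.ofReal ((√((max n m : ℕ) + 1))⁻¹ ^ DCF n m isR) *
        (ENNReal.ofReal (√((max n m : ℕ) + 1) ^ DCF n m isR) * volume (supBall e)) := by
        rw [← mul_assoc, ← ENNReal.ofReal_mul (by positivity), ← mul_pow,
          inv_mul_cancel₀ hpos.ne', one_pow, ENNReal.ofReal_one, one_mul]
    _ ≤ _ := mul_le_mul_right hsup _

end Family

end BiformPaper

open BiformPaper in
/-- **Theorem (bounds on the volume of the section `P̃os_{𝒞_𝔽}`).**  For `𝔽 ∈ {ℝ, ℂ}`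
(`isR = true` for `𝔽 = ℝ`, `isR = false` for `𝔽 = ℂ`) and integers `n, m ≥ 3`:
`3³·10^{−20/9}·2^{−1/2}·max(n,m)^{−1/2} ≤ (Vol P̃os_{𝒞_𝔽} / Vol B_{𝓜_{𝒞_𝔽}})^{1/D}
  ≤ 2·min(1/(1+n), 1/(1+m))^{1/2}`. -/
theorem statement6 (isR : Bool) (n m : ℕ) (hn : 3 ≤ n) (hm : 3 ≤ m)
    (D : ℕ) (hD : D = DCF n m isR)
    (σ₁ : Measure (Fin (2 * n) → ℝ)) (σ₂ : Measure (Fin (2 * m) → ℝ))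
    (hσ₁ : IsSphereMeasure (2 * n) σ₁) (hσ₂ : IsSphereMeasure (2 * m) σ₂)
    (ψ : (Fin D → ℝ) →ₗ[ℝ] MvPolynomial (Fin (2 * n) ⊕ Fin (2 * m)) ℝ)
    (hψ : IsUnitaryParam (2 * n) (2 * m) D σ₁ σ₂ (MCF n m isR σ₁ σ₂) ψ) :
    ENNReal.ofReal ((3 : ℝ) ^ 3 * (10 : ℝ) ^ (-(20 : ℝ) / 9) * (2 : ℝ) ^ (-(1 : ℝ) / 2) *
        ((max n m : ℕ) : ℝ) ^ (-(1 : ℝ) / 2)) ≤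
      (volume (⇑ψ ⁻¹' tildeCF n m isR σ₁ σ₂ (PosCF n m isR)) /
          volume (⇑ψ ⁻¹' ballCF n m isR σ₁ σ₂)) ^ ((1 : ℝ) / (D : ℝ)) ∧
    (volume (⇑ψ ⁻¹' tildeCF n m isR σ₁ σ₂ (PosCF n m isR)) /
        volume (⇑ψ ⁻¹' ballCF n m isR σ₁ σ₂)) ^ ((1 : ℝ) / (D : ℝ)) ≤
      ENNReal.ofReal (2 * Real.sqrt (min (1 / (1 + (n : ℝ))) (1 / (1 + (m : ℝ))))) := by
  subst hD
  have h := hψ.family hσ₁ hσ₂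
  have hD : 0 < DCF n m isR := by
    have := eighteen_mul_le_DCF hn hm isR
    omega
  have hD' : (0 : ℝ) < DCF n m isR := by exact_mod_cast hD
  rw [hψ.preimage_tildeCF hσ₁ hσ₂, hψ.preimage_ballCF]
  have h0 := volume_unit_ball_ne_zero (DCF n m isR)
  have ht := volume_unit_ball_ne_top (DCF n m isR)
  constructor
  · rw [one_div, ENNReal.le_rpow_inv_iff hD', ENNReal.rpow_natCast,
      ← ENNReal.ofReal_pow (by positivity),
      ENNReal.le_div_iff_mul_le (Or.inl h0) (Or.inl ht)]
    exact h.pow_mul_volume_unit_ball_le hn hm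
  · rw [one_div ((DCF n m isR : ℕ) : ℝ), ENNReal.rpow_inv_le_iff hD', ENNReal.rpow_natCast,
      ← ENNReal.ofReal_pow (by positivity)]
    exact ENNReal.div_le_of_le_mul (h.volume_posBall_le_pow_mul hn hm
      (fun a => (hψ.mem_MCF a).2) (hψ.isStable hσ₁ hσ₂))
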